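/- Let X be a Banach space and Γ : [0,1] → cwk(X) a scalarly measurable multifunction. The following are equivalent: (i) Γ is McShane integrable; (ii) Γ is Henstock integrable and every Henstock integrable selection of Γ is McShane integrable; (iii) Γ is Henstock integrable and every Henstock integrable selection of Γ is Pettis integrable; (iv) Γ is Henstock integrable and Γ possesses at least one Pettis integrable selection; (v) Γ is both Henstock integrable and Pettis integrable. -/

import Mathlib

open Set Metric MeasureTheory Pointwise
open scoped ENNReal NNReal

namespace GaugePaper

variable (X : Type*) [NormedAddCommGroup X] [NormedSpace ℝ X]

/-- `A ∈ cwk(X)`: `A` is a nonempty, convex and weakly compact subset of `X`. -/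
def IsCWK (A : Set X) : Prop :=
  A.Nonempty ∧ Convex ℝ A ∧ IsCompact (toWeakSpace ℝ X '' A)

variable {X}

/-- The support function `σ(x*, A)`. -/
noncomputable def suppFn (x' : X →L[ℝ] ℝ) (A : Set X) : ℝ := sSup (x' '' A)

/-- `‖A‖ = sup {‖x‖ : x ∈ A}`. -/
noncomputable def setNorm (A : Set X) : ℝ := sSup ((fun x => ‖x‖) '' A)

/-- A gauge on `[0,1]`: a positive function. -/
def IsGauge (δ : ℝ → ℝ) : Prop := ∀ t ∈ Icc (0:ℝ) 1, 0 < δ t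

/-- A tagged partition of `[0,1]` into `n` (possibly degenerate) nonoverlapping closed
subintervals `[pt i, pt (i+1)]`, with tags `tag i ∈ [0,1]`. -/
structure TP (n : ℕ) where
  pt : Fin (n + 1) → ℝ
  tag : Fin n → ℝ
  mono : Monotone pt
  first : pt 0 = 0
  last : pt (Fin.last n) = 1
  tagMem : ∀ i, tag i ∈ Icc (0:ℝ) 1

namespace TP

variable {n : ℕ} (P : TP n)

/-- The `i`-th subinterval of the partition. -/
def ivl (i : Fin n) : Set ℝ := Icc (P.pt i.castSucc) (P.pt i.succ)

/-- The length `|I_i|` of the `i`-th subinterval. -/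
def len (i : Fin n) : ℝ := P.pt i.succ - P.pt i.castSucc

/-- A Perron (Henstock) partition: each tag belongs to its interval. -/
def IsPerron : Prop := ∀ i, P.tag i ∈ P.ivl i

/-- `δ`-fineness: `I_i ⊆ (t_i - δ(t_i), t_i + δ(t_i))`. -/
def IsFine (δ : ℝ → ℝ) : Prop :=
  ∀ i, P.ivl i ⊆ Ioo (P.tag i - δ (P.tag i)) (P.tag i + δ (P.tag i))

/-- An interior Henstock partition: each tag is in the interior of its interval, except
possibly for intervals containing `0` or `1`, where the tag may also be `0` or `1`. -/
def IsInterior : Prop :=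
  ∀ i, P.tag i ∈ Ioo (P.pt i.castSucc) (P.pt i.succ) ∨
    (((0:ℝ) ∈ P.ivl i ∨ (1:ℝ) ∈ P.ivl i) ∧ P.tag i ∈ P.ivl i ∩ ({0, 1} : Set ℝ))

end TP

/-- Riemann sum of a multifunction: `∑ i |I_i| • Γ(t_i)` (Minkowski sums). -/
def mSum {n : ℕ} (P : TP n) (Γ : ℝ → Set X) : Set X :=
  ∑ i : Fin n, P.len i • Γ (P.tag i)

/-- Riemann sum of a function: `∑ i |I_i| • f(t_i)`. -/
def fSum {n : ℕ} (P : TP n) (f : ℝ → X) : X :=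
  ∑ i : Fin n, P.len i • f (P.tag i)

/-! ### Gauge integrals of multifunctions -/

/-- Henstock integrability of a multifunction `Γ : [0,1] → cwk(X)`. -/
def HenstockIntegrable (Γ : ℝ → Set X) : Prop :=
  ∃ I : Set X, IsCWK X I ∧ ∀ ε > 0, ∃ δ : ℝ → ℝ, IsGauge δ ∧
    ∀ (n : ℕ) (P : TP n), P.IsPerron → P.IsFine δ → hausdorffDist I (mSum P Γ) < ε

/-- McShane integrability of a multifunction (free tags). -/
def McShaneIntegrable (Γ : ℝ → Set X) : Prop :=
  ∃ I : Set X, IsCWK X I ∧ ∀ ε > 0, ∃ δ : ℝ → ℝ, IsGauge δ ∧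
    ∀ (n : ℕ) (P : TP n), P.IsFine δ → hausdorffDist I (mSum P Γ) < ε

/-- `ℋ`-integrability: Henstock integrability with Lebesgue measurable gauges. -/
def HMeasIntegrable (Γ : ℝ → Set X) : Prop :=
  ∃ I : Set X, IsCWK X I ∧ ∀ ε > 0, ∃ δ : ℝ → ℝ, IsGauge δ ∧ AEMeasurable δ volume ∧
    ∀ (n : ℕ) (P : TP n), P.IsPerron → P.IsFine δ → hausdorffDist I (mSum P Γ) < ε

/-- Birkhoff (`ℳ`-) integrability: McShane integrability with Lebesgue measurable gauges. -/
def BirkhoffIntegrable (Γ : ℝ → Set X) : Prop :=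
  ∃ I : Set X, IsCWK X I ∧ ∀ ε > 0, ∃ δ : ℝ → ℝ, IsGauge δ ∧ AEMeasurable δ volume ∧
    ∀ (n : ℕ) (P : TP n), P.IsFine δ → hausdorffDist I (mSum P Γ) < ε

/-! ### Gauge integrals of (single-valued) functions -/

/-- Henstock integrability of a function `f : [0,1] → X`. -/
def FHenstockIntegrable (f : ℝ → X) : Prop :=
  ∃ w : X, ∀ ε > 0, ∃ δ : ℝ → ℝ, IsGauge δ ∧
    ∀ (n : ℕ) (P : TP n), P.IsPerron → P.IsFine δ → ‖w - fSum P f‖ < ε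

/-- McShane integrability of a function. -/
def FMcShaneIntegrable (f : ℝ → X) : Prop :=
  ∃ w : X, ∀ ε > 0, ∃ δ : ℝ → ℝ, IsGauge δ ∧
    ∀ (n : ℕ) (P : TP n), P.IsFine δ → ‖w - fSum P f‖ < ε

/-- `ℋ`-integrability of a function: measurable gauges. -/
def FHMeasIntegrable (f : ℝ → X) : Prop :=
  ∃ w : X, ∀ ε > 0, ∃ δ : ℝ → ℝ, IsGauge δ ∧ AEMeasurable δ volume ∧
    ∀ (n : ℕ) (P : TP n), P.IsPerron → P.IsFine δ → ‖w - fSum P f‖ < ε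

/-- Birkhoff (`ℳ`-) integrability of a function: McShane with measurable gauges. -/
def FBirkhoffIntegrable (f : ℝ → X) : Prop :=
  ∃ w : X, ∀ ε > 0, ∃ δ : ℝ → ℝ, IsGauge δ ∧ AEMeasurable δ volume ∧
    ∀ (n : ℕ) (P : TP n), P.IsFine δ → ‖w - fSum P f‖ < ε

/-- Henstock–Kurzweil integrability of a real-valued function on `[0,1]`. -/
def HKIntegrable (g : ℝ → ℝ) : Prop :=
  ∃ A : ℝ, ∀ ε > 0, ∃ δ : ℝ → ℝ, IsGauge δ ∧
    ∀ (n : ℕ) (P : TP n), P.IsPerron → P.IsFine δ → |fSum P g - A| < ε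

/-! ### Pettis integrals -/

/-- Pettis integrability of a function `f : [0,1] → X`. -/
def FPettisIntegrable (f : ℝ → X) : Prop :=
  (∀ x' : X →L[ℝ] ℝ, IntegrableOn (fun t => x' (f t)) (Icc (0:ℝ) 1) volume) ∧
  ∀ E ⊆ Icc (0:ℝ) 1, NullMeasurableSet E volume →
    ∃ ν : X, ∀ x' : X →L[ℝ] ℝ, x' ν = ∫ t in E, x' (f t)

/-- Pettis integrability of a multifunction `Γ : [0,1] → cwk(X)`. -/
def PettisIntegrable (Γ : ℝ → Set X) : Prop :=
  (∀ x' : X →L[ℝ] ℝ, IntegrableOn (fun t => suppFn x' (Γ t)) (Icc (0:ℝ) 1) volume) ∧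
  ∀ E ⊆ Icc (0:ℝ) 1, NullMeasurableSet E volume →
    ∃ W : Set X, IsCWK X W ∧ ∀ x' : X →L[ℝ] ℝ, suppFn x' W = ∫ t in E, suppFn x' (Γ t)

/-- `f` is a selection of `Γ`. -/
def Selection (Γ : ℝ → Set X) (f : ℝ → X) : Prop := ∀ t ∈ Icc (0:ℝ) 1, f t ∈ Γ t

/-! ### Variational integrals -/

/-- Finite additivity of an interval multifunction on subintervals of `[0,1]`
(an interval `[a,b] ⊆ [0,1]` is encoded by its endpoints). -/
def AdditiveIntervalMF (Φ : ℝ → ℝ → Set X) : Prop :=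
  ∀ a b c : ℝ, 0 ≤ a → a ≤ b → b ≤ c → c ≤ 1 → Φ a c = Φ a b + Φ b c

/-- Finite additivity of a vector-valued interval function on subintervals of `[0,1]`. -/
def AdditiveIntervalF (Φ : ℝ → ℝ → X) : Prop :=
  ∀ a b c : ℝ, 0 ≤ a → a ≤ b → b ≤ c → c ≤ 1 → Φ a c = Φ a b + Φ b c

/-- `Φ` is a variational Henstock primitive of the multifunction `Γ`. -/
def vHPrimitive (Γ : ℝ → Set X) (Φ : ℝ → ℝ → Set X) : Prop :=
  (∀ a b : ℝ, 0 ≤ a → a ≤ b → b ≤ 1 → IsCWK X (Φ a b)) ∧ AdditiveIntervalMF Φ ∧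
  ∀ ε > 0, ∃ δ : ℝ → ℝ, IsGauge δ ∧ ∀ (n : ℕ) (P : TP n), P.IsPerron → P.IsFine δ →
    ∑ i : Fin n, hausdorffDist (Φ (P.pt i.castSucc) (P.pt i.succ)) (P.len i • Γ (P.tag i)) < ε

/-- Variational Henstock integrability of a multifunction. -/
def vHIntegrable (Γ : ℝ → Set X) : Prop := ∃ Φ : ℝ → ℝ → Set X, vHPrimitive Γ Φ

/-- Variational McShane integrability of a multifunction (free tags). -/
def vMSIntegrable (Γ : ℝ → Set X) : Prop :=
  ∃ Φ : ℝ → ℝ → Set X,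
    (∀ a b : ℝ, 0 ≤ a → a ≤ b → b ≤ 1 → IsCWK X (Φ a b)) ∧ AdditiveIntervalMF Φ ∧
    ∀ ε > 0, ∃ δ : ℝ → ℝ, IsGauge δ ∧ ∀ (n : ℕ) (P : TP n), P.IsFine δ →
      ∑ i : Fin n, hausdorffDist (Φ (P.pt i.castSucc) (P.pt i.succ)) (P.len i • Γ (P.tag i)) < ε

/-- Variational `ℋ`-integrability of a multifunction: measurable gauges. -/
def vHMeasIntegrable (Γ : ℝ → Set X) : Prop :=
  ∃ Φ : ℝ → ℝ → Set X,
    (∀ a b : ℝ, 0 ≤ a → a ≤ b → b ≤ 1 → IsCWK X (Φ a b)) ∧ AdditiveIntervalMF Φ ∧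
    ∀ ε > 0, ∃ δ : ℝ → ℝ, IsGauge δ ∧ AEMeasurable δ volume ∧
      ∀ (n : ℕ) (P : TP n), P.IsPerron → P.IsFine δ →
        ∑ i : Fin n, hausdorffDist (Φ (P.pt i.castSucc) (P.pt i.succ)) (P.len i • Γ (P.tag i)) < ε

/-- `Φ` is a variational Henstock primitive of the function `f`. -/
def FvHPrimitive (f : ℝ → X) (Φ : ℝ → ℝ → X) : Prop :=
  AdditiveIntervalF Φ ∧
  ∀ ε > 0, ∃ δ : ℝ → ℝ, IsGauge δ ∧ ∀ (n : ℕ) (P : TP n), P.IsPerron → P.IsFine δ →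
    ∑ i : Fin n, ‖Φ (P.pt i.castSucc) (P.pt i.succ) - P.len i • f (P.tag i)‖ < ε

/-- Variational Henstock integrability of a function. -/
def FvHIntegrable (f : ℝ → X) : Prop := ∃ Φ : ℝ → ℝ → X, FvHPrimitive f Φ

/-- Variational McShane integrability of a function (free tags). -/
def FvMSIntegrable (f : ℝ → X) : Prop :=
  ∃ Φ : ℝ → ℝ → X, AdditiveIntervalF Φ ∧
    ∀ ε > 0, ∃ δ : ℝ → ℝ, IsGauge δ ∧ ∀ (n : ℕ) (P : TP n), P.IsFine δ →
      ∑ i : Fin n, ‖Φ (P.pt i.castSucc) (P.pt i.succ) - P.len i • f (P.tag i)‖ < ε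

/-- Variational `ℋ`-integrability of a function: measurable gauges. -/
def FvHMeasIntegrable (f : ℝ → X) : Prop :=
  ∃ Φ : ℝ → ℝ → X, AdditiveIntervalF Φ ∧
    ∀ ε > 0, ∃ δ : ℝ → ℝ, IsGauge δ ∧ AEMeasurable δ volume ∧
      ∀ (n : ℕ) (P : TP n), P.IsPerron → P.IsFine δ →
        ∑ i : Fin n, ‖Φ (P.pt i.castSucc) (P.pt i.succ) - P.len i • f (P.tag i)‖ < ε

/-! ### Partial Perron partitions and variational measures -/

/-- A finite tagged Perron family of `n` nonoverlapping closed subintervals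
`[a i, b i]` of `[0,1]` (a "partition in `[0,1]`", not necessarily covering it). -/
structure PTP (n : ℕ) where
  a : Fin n → ℝ
  b : Fin n → ℝ
  tag : Fin n → ℝ
  le : ∀ i, a i ≤ b i
  sub : ∀ i, Icc (a i) (b i) ⊆ Icc (0:ℝ) 1
  nonoverlap : ∀ i j, i ≠ j → (Icc (a i) (b i) ∩ Icc (a j) (b j)).Subsingleton
  perron : ∀ i, tag i ∈ Icc (a i) (b i)

/-- `δ`-fineness of a partial Perron family. -/
def PTP.IsFine {n : ℕ} (P : PTP n) (δ : ℝ → ℝ) : Prop :=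
  ∀ i, Icc (P.a i) (P.b i) ⊆ Ioo (P.tag i - δ (P.tag i)) (P.tag i + δ (P.tag i))

/-- `Var(Ψ, δ, E)` for a scalar interval function `Ψ`. -/
noncomputable def scVar (Ψ : ℝ → ℝ → ℝ) (δ : ℝ → ℝ) (E : Set ℝ) : ℝ≥0∞ :=
  ⨆ (n : ℕ) (P : PTP n) (_ : P.IsFine δ ∧ ∀ i, P.tag i ∈ E),
    ∑ i : Fin n, ENNReal.ofReal |Ψ (P.a i) (P.b i)|

/-- The variational measure `V_Ψ(E)` generated by a scalar interval function `Ψ`. -/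
noncomputable def scVarMeasure (Ψ : ℝ → ℝ → ℝ) (E : Set ℝ) : ℝ≥0∞ :=
  ⨅ (δ : ℝ → ℝ) (_ : IsGauge δ), scVar Ψ δ E

/-! ### Sums over tagged partitions of arbitrary intervals -/

/-- `PSum R φ a b S`: `S` is the sum of `φ u v t` over the pieces `([u, v], t)` of some tagged
partition of `[a, b]` all of whose pieces satisfy `R u v t`. -/
inductive PSum {M : Type*} [AddCommMonoid M] (R : ℝ → ℝ → ℝ → Prop) (φ : ℝ → ℝ → ℝ → M) :
    ℝ → ℝ → M → Prop
  | nil (a : ℝ) : PSum R φ a a 0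
  | cons {u v t b : ℝ} {s : M} :
      u ≤ v → R u v t → PSum R φ v b s → PSum R φ u b (φ u v t + s)

/-- The piece `([u, v], t)` is `δ`-fine, its tag being free. -/
def FreePiece (δ : ℝ → ℝ) (u v t : ℝ) : Prop :=
  t ∈ Icc (0:ℝ) 1 ∧ Icc u v ⊆ Ioo (t - δ t) (t + δ t)

/-- The piece `([u, v], t)` is `δ`-fine and contains its tag. -/
def PerronPiece (δ : ℝ → ℝ) (u v t : ℝ) : Prop := t ∈ Icc u v ∧ FreePiece δ u v t

lemma FreePiece.mono {δ δ' : ℝ → ℝ} {u v t : ℝ} (h : FreePiece δ u v t) (hδ : δ t ≤ δ' t) :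
    FreePiece δ' u v t :=
  ⟨h.1, h.2.trans (Ioo_subset_Ioo (by linarith) (by linarith))⟩

lemma PerronPiece.mono {δ δ' : ℝ → ℝ} {u v t : ℝ} (h : PerronPiece δ u v t) (hδ : δ t ≤ δ' t) :
    PerronPiece δ' u v t :=
  ⟨h.1, h.2.mono hδ⟩

lemma IsGauge.min {δ δ' : ℝ → ℝ} (h : IsGauge δ) (h' : IsGauge δ') :
    IsGauge (fun t => min (δ t) (δ' t)) :=
  fun t ht => lt_min (h t ht) (h' t ht)

namespace PSum

variable {M N : Type*} [AddCommMonoid M] [AddCommMonoid N] {R R' : ℝ → ℝ → ℝ → Prop}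
  {φ : ℝ → ℝ → ℝ → M} {φ' : ℝ → ℝ → ℝ → N}

lemma le {a b : ℝ} {s : M} (h : PSum R φ a b s) : a ≤ b := by
  induction h with
  | nil a => exact le_rfl
  | cons huv _ _ ih => exact huv.trans ih

lemma single {u v t : ℝ} (huv : u ≤ v) (h : R u v t) : PSum R φ u v (φ u v t) := by
  simpa using PSum.cons (φ := φ) huv h (PSum.nil v)

lemma append {a b c : ℝ} {s s' : M} (h : PSum R φ a b s) (h' : PSum R φ b c s') :
    PSum R φ a c (s + s') := by
  induction h with
  | nil a => simpa using h'
  | cons huv hR _ ih => rw [add_assoc]; exact PSum.cons huv hR (ih h')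

/-- Change the tags piece by piece and the summand by an additive map. -/
lemma map (F : M →+ N)
    (hF : ∀ u v t, u ≤ v → R u v t → ∃ t', R' u v t' ∧ φ' u v t' = F (φ u v t))
    {a b : ℝ} {s : M} (h : PSum R φ a b s) : PSum R' φ' a b (F s) := by
  induction h with
  | nil a => simpa using PSum.nil a
  | cons huv hR _ ih =>
    obtain ⟨t', h1, h2⟩ := hF _ _ _ huv hR
    rw [map_add, ← h2]
    exact PSum.cons huv h1 ih

lemma mono (hR : ∀ u v t, u ≤ v → R u v t → R' u v t) {a b : ℝ} {s : M} (h : PSum R φ a b s) :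
    PSum R' φ a b s := by
  simpa using h.map (R' := R') (φ' := φ) (AddMonoidHom.id M)
    fun u v t huv h => ⟨t, hR u v t huv h, rfl⟩

lemma exists_fin {a b : ℝ} {s : M} (h : PSum R φ a b s) :
    ∃ (n : ℕ) (pt : Fin (n + 1) → ℝ) (tag : Fin n → ℝ), Monotone pt ∧ pt 0 = a ∧
      pt (Fin.last n) = b ∧ (∀ i, R (pt i.castSucc) (pt i.succ) (tag i)) ∧
      ∑ i, φ (pt i.castSucc) (pt i.succ) (tag i) = s := by
  induction h with
  | nil a =>
    exact ⟨0, fun _ => a, Fin.elim0, monotone_const, rfl, rfl, fun i => i.elim0, by simp⟩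
  | @cons u v t b s huv hR _ ih =>
    obtain ⟨n, pt, tag, hm, h0, hl, hR', hs⟩ := ih
    refine ⟨n + 1, Fin.cons u pt, Fin.cons t tag, ?_, rfl, ?_, ?_, ?_⟩
    · rw [Fin.monotone_iff_le_succ]
      intro i
      refine Fin.cases ?_ (fun i => ?_) i
      · simpa [h0] using huv
      · simpa [← Fin.succ_castSucc] using hm (Fin.castSucc_le_succ i)
    · rw [← Fin.succ_last, Fin.cons_succ, hl]
    · intro i
      refine Fin.cases ?_ (fun i => ?_) i
      · simpa [h0] using hR
      · simpa [← Fin.succ_castSucc] using hR' i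
    · rw [Fin.sum_univ_succ]
      simp [h0, hs]

lemma exists_tp (hR : ∀ u v t, R u v t → t ∈ Icc (0:ℝ) 1) {s : M} (h : PSum R φ 0 1 s) :
    ∃ (n : ℕ) (P : TP n), (∀ i, R (P.pt i.castSucc) (P.pt i.succ) (P.tag i)) ∧
      ∑ i, φ (P.pt i.castSucc) (P.pt i.succ) (P.tag i) = s := by
  obtain ⟨n, pt, tag, hm, h0, hl, hR', hs⟩ := h.exists_fin
  exact ⟨n, ⟨pt, tag, hm, h0, hl, fun i => hR _ _ _ (hR' i)⟩, hR', hs⟩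

lemma concat {n : ℕ} (pt : Fin (n + 1) → ℝ) (S : Fin n → M)
    (h : ∀ i : Fin n, PSum R φ (pt i.castSucc) (pt i.succ) (S i)) :
    PSum R φ (pt 0) (pt (Fin.last n)) (∑ i, S i) := by
  induction n with
  | zero => simpa using PSum.nil (R := R) (φ := φ) (pt 0)
  | succ n ih =>
    rw [Fin.sum_univ_castSucc]
    have := ih (fun i => pt i.castSucc) (fun i => S i.castSucc) (fun i => h i.castSucc)
    exact this.append (h (Fin.last n))

end PSum

/-- **Cousin's lemma**. -/
lemma exists_psum_perron {M : Type*} [AddCommMonoid M] (φ : ℝ → ℝ → ℝ → M) {δ : ℝ → ℝ}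
    (hδ : IsGauge δ) {a b : ℝ} (ha : 0 ≤ a) (hab : a ≤ b) (hb : b ≤ 1) :
    ∃ s, PSum (fun u v t => PerronPiece δ u v t ∧ a ≤ u ∧ v ≤ b) φ a b s := by
  set R := fun u v t => PerronPiece δ u v t ∧ a ≤ u ∧ v ≤ b
  let G : Set ℝ := {x | x ∈ Icc a b ∧ ∃ s, PSum R φ a x s}
  have haG : a ∈ G := ⟨⟨le_rfl, hab⟩, 0, PSum.nil a⟩
  have hbdd : BddAbove G := ⟨b, fun x hx => hx.1.2⟩
  set c := sSup G
  have hac : a ≤ c := le_csSup hbdd haG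
  have hcb : c ≤ b := csSup_le ⟨a, haG⟩ fun x hx => hx.1.2
  have hc := hδ c ⟨ha.trans hac, hcb.trans hb⟩
  obtain ⟨x, hxG, hx⟩ := exists_lt_of_lt_csSup ⟨a, haG⟩ (show c - δ c < sSup G by linarith)
  have hxc : x ≤ c := le_csSup hbdd hxG
  obtain ⟨⟨hax, hxb⟩, s, hs⟩ := hxG
  set y := min (c + δ c / 2) b
  have hcy : c ≤ y := le_min (by linarith) hcb
  have hy : y ∈ G := by
    refine ⟨⟨hac.trans hcy, min_le_right _ _⟩, _, hs.append (PSum.single (hxc.trans hcy)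
      (t := c) ⟨⟨⟨hxc, hcy⟩, ⟨ha.trans hac, hcb.trans hb⟩, ?_⟩, hax, min_le_right _ _⟩)⟩
    intro z hz
    have : z ≤ c + δ c / 2 := hz.2.trans (min_le_left _ _)
    exact ⟨by linarith [hz.1], by linarith⟩
  have hyc : y ≤ c := le_csSup hbdd hy
  have hyb : y = b := by
    rcases min_choice (c + δ c / 2) b with h | h
    · have : y = c + δ c / 2 := h
      linarith
    · exact h
  rw [← hyb]
  exact hyb ▸ hy.2

/-- A finite family of nonoverlapping pieces can be completed to a tagged partition whose sum
is arbitrarily close to that of the family, if the gaps can be filled with small sums. -/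
lemma exists_psum_near {ι : Type*} {R : ℝ → ℝ → ℝ → Prop} {φ : ℝ → ℝ → ℝ → ℝ}
    (hfill : ∀ ρ > 0, ∀ u v, 0 ≤ u → u ≤ v → v ≤ 1 → ∃ S, PSum R φ u v S ∧ |S| ≤ ρ)
    (a b t : ι → ℝ) (s : Finset ι) :
    ∀ c, 0 ≤ c → c ≤ 1 → (∀ i ∈ s, 0 ≤ a i ∧ a i < b i ∧ b i ≤ c ∧ R (a i) (b i) (t i)) →
      (∀ i ∈ s, ∀ j ∈ s, i ≠ j → b i ≤ a j ∨ b j ≤ a i) →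
      ∀ ρ > 0, ∃ S, PSum R φ 0 c S ∧ |S - ∑ i ∈ s, φ (a i) (b i) (t i)| ≤ ρ := by
  classical
  induction s using Finset.induction_on_max_value a with
  | empty =>
    intro c hc0 hc1 _ _ ρ hρ
    simpa using hfill ρ hρ 0 c le_rfl hc0 hc1
  | insert i s his hmax ih =>
    intro c hc0 hc1 hs hd ρ hρ
    obtain ⟨h0, hab, hbc, hR⟩ := hs i (Finset.mem_insert_self _ _)
    obtain ⟨S1, hS1, hS1'⟩ := ih (a i) h0 (by linarith) (fun j hj => by
      obtain ⟨h1, h2, h3, h4⟩ := hs j (Finset.mem_insert_of_mem hj)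
      refine ⟨h1, h2, ?_, h4⟩
      rcases hd j (Finset.mem_insert_of_mem hj) i (Finset.mem_insert_self _ _)
        (fun h => his (h ▸ hj)) with h | h
      · exact h
      · linarith [hmax j hj])
      (fun j hj k hk => hd j (Finset.mem_insert_of_mem hj) k (Finset.mem_insert_of_mem hk))
      (ρ / 2) (by positivity)
    obtain ⟨S2, hS2, hS2'⟩ := hfill (ρ / 2) (by positivity) (b i) c (by linarith) hbc hc1
    refine ⟨_, (hS1.append (PSum.single hab.le hR)).append hS2, ?_⟩
    rw [Finset.sum_insert his]
    rw [abs_le] at *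
    constructor <;> linarith [hS1'.1, hS1'.2, hS2'.1, hS2'.2]

section SaksHenstock

variable {ι : Type*} {R : ℝ → ℝ → ℝ → Prop} {φ : ℝ → ℝ → ℝ → ℝ}
  {ε : ℝ} {a b t : ι → ℝ} {s : Finset ι}

/-- **Saks–Henstock lemma**. -/
lemma abs_sum_le_of_psum
    (hfill : ∀ ρ > 0, ∀ u v, 0 ≤ u → u ≤ v → v ≤ 1 → ∃ S, PSum R φ u v S ∧ |S| ≤ ρ)
    (hε : ∀ S, PSum R φ 0 1 S → |S| ≤ ε)
    (hs : ∀ i ∈ s, 0 ≤ a i ∧ a i < b i ∧ b i ≤ 1 ∧ R (a i) (b i) (t i))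
    (hd : ∀ i ∈ s, ∀ j ∈ s, i ≠ j → b i ≤ a j ∨ b j ≤ a i) :
    |∑ i ∈ s, φ (a i) (b i) (t i)| ≤ ε := by
  refine le_of_forall_pos_le_add fun ρ hρ => ?_
  obtain ⟨S, hS, hS'⟩ := exists_psum_near hfill a b t s 1 zero_le_one le_rfl hs hd ρ hρ
  have := hε S hS
  rw [abs_le] at *
  constructor <;> linarith [hS'.1, hS'.2]

/-- **Saks–Henstock lemma**, absolute values inside the sum. -/
lemma sum_abs_le_of_psum
    (hfill : ∀ ρ > 0, ∀ u v, 0 ≤ u → u ≤ v → v ≤ 1 → ∃ S, PSum R φ u v S ∧ |S| ≤ ρ)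
    (hε : ∀ S, PSum R φ 0 1 S → |S| ≤ ε)
    (hs : ∀ i ∈ s, 0 ≤ a i ∧ a i < b i ∧ b i ≤ 1 ∧ R (a i) (b i) (t i))
    (hd : ∀ i ∈ s, ∀ j ∈ s, i ≠ j → b i ≤ a j ∨ b j ≤ a i) :
    ∑ i ∈ s, |φ (a i) (b i) (t i)| ≤ 2 * ε := by
  classical
  have key : ∀ s' ⊆ s, |∑ i ∈ s', φ (a i) (b i) (t i)| ≤ ε := fun s' hs' =>
    abs_sum_le_of_psum hfill hε (fun i hi => hs i (hs' hi))
      (fun i hi j hj => hd i (hs' hi) j (hs' hj))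
  rw [← Finset.sum_filter_add_sum_filter_not s (fun i => 0 ≤ φ (a i) (b i) (t i))]
  have h1 := key _ (Finset.filter_subset (fun i => 0 ≤ φ (a i) (b i) (t i)) s)
  have h2 := key _ (Finset.filter_subset (fun i => ¬ 0 ≤ φ (a i) (b i) (t i)) s)
  rw [Finset.sum_congr rfl (fun i hi => abs_of_nonneg (Finset.mem_filter.1 hi).2)]
  rw [Finset.sum_congr (s₁ := s.filter fun i => ¬ 0 ≤ φ (a i) (b i) (t i)) rfl
    (fun i hi => abs_of_neg (not_le.1 (Finset.mem_filter.1 hi).2)), Finset.sum_neg_distrib]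
  linarith [abs_le.1 h1, (abs_le.1 h2).1]

end SaksHenstock

namespace PSum

variable {M : Type*} [AddCommMonoid M] {R : ℝ → ℝ → ℝ → Prop}

lemma restrict {φ : ℝ → ℝ → ℝ → M} {a b : ℝ} {s : M} (h : PSum R φ a b s) :
    PSum (fun u v t => R u v t ∧ a ≤ u ∧ v ≤ b) φ a b s := by
  induction h with
  | nil a => exact PSum.nil a
  | cons huv hR h ih =>
    exact PSum.cons huv ⟨hR, le_rfl, h.le⟩
      (ih.mono fun u' v' t' _ h => ⟨h.1, huv.trans h.2.1, h.2.2⟩)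

lemma le_of_forall_le {φ : ℝ → ℝ → ℝ → ℝ} {ψ : ℝ → ℝ} {a b s : ℝ} (h : PSum R φ a b s)
    (hφ : ∀ u v t, u ≤ v → R u v t → φ u v t ≤ ψ v - ψ u) : s ≤ ψ b - ψ a := by
  induction h with
  | nil a => simp
  | cons huv hR _ ih => linarith [hφ _ _ _ huv hR]

lemma abs_le_of_forall_le {φ : ℝ → ℝ → ℝ → ℝ} {ψ : ℝ → ℝ} {a b s : ℝ} (h : PSum R φ a b s)
    (hφ : ∀ u v t, u ≤ v → R u v t → |φ u v t| ≤ ψ v - ψ u) : |s| ≤ ψ b - ψ a := by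
  induction h with
  | nil a => simp
  | cons huv hR _ ih => exact (abs_add_le _ _).trans (by linarith [hφ _ _ _ huv hR])

lemma sub_increment {φ : ℝ → ℝ → ℝ → ℝ} (F : ℝ → ℝ) {a b s : ℝ} (h : PSum R φ a b s) :
    PSum R (fun u v t => φ u v t - (F v - F u)) a b (s - (F b - F a)) := by
  induction h with
  | nil a => simpa using PSum.nil a
  | @cons u v t b s huv hR _ ih =>
    have := PSum.cons (φ := fun u v t => φ u v t - (F v - F u)) huv hR ih
    convert this using 1
    ring

lemma add_increment {φ : ℝ → ℝ → ℝ → ℝ} (F : ℝ → ℝ) {a b s : ℝ}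
    (h : PSum R (fun u v t => φ u v t - (F v - F u)) a b s) :
    PSum R φ a b (s + (F b - F a)) := by
  have := h.sub_increment fun x => - F x
  convert this using 1
  · ext u v t; ring
  · ring

/-- Replace the summand by a larger one, keeping the pieces. -/
lemma exists_ge {φ φ' : ℝ → ℝ → ℝ → ℝ} {a b s : ℝ} (h : PSum R φ a b s)
    (hφ : ∀ u v t, u ≤ v → R u v t → φ u v t ≤ φ' u v t) :
    ∃ s', PSum R φ' a b s' ∧ s ≤ s' := by
  induction h with
  | nil a => exact ⟨0, PSum.nil a, le_rfl⟩
  | cons huv hR _ ih =>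
    obtain ⟨s', h1, h2⟩ := ih
    exact ⟨_, PSum.cons huv hR h1, add_le_add (hφ _ _ _ huv hR) h2⟩

end PSum

lemma IntegrableOn.intervalIntegrable_sub {g : ℝ → ℝ} (hg : IntegrableOn g (Icc (0:ℝ) 1))
    {u v : ℝ} (hu : 0 ≤ u) (huv : u ≤ v) (hv : v ≤ 1) : IntervalIntegrable g volume u v := by
  rw [intervalIntegrable_iff_integrableOn_Icc_of_le huv]
  exact hg.mono_set (Icc_subset_Icc hu hv)

lemma integral_sub_integral_eq {g : ℝ → ℝ} (hg : IntegrableOn g (Icc (0:ℝ) 1))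
    {u v : ℝ} (hu : 0 ≤ u) (huv : u ≤ v) (hv : v ≤ 1) :
    (∫ x in (0:ℝ)..v, g x) - ∫ x in (0:ℝ)..u, g x = ∫ x in u..v, g x :=
  intervalIntegral.integral_interval_sub_left
    (IntegrableOn.intervalIntegrable_sub hg le_rfl (hu.trans huv) hv)
    (IntegrableOn.intervalIntegrable_sub hg le_rfl hu (huv.trans hv))

/-- A Lebesgue integrable function has a gauge for which the errors on free pieces are dominated
by the integral of a nonnegative function of small integral. -/
lemma exists_gauge_of_integrableOn {g : ℝ → ℝ} (hg : IntegrableOn g (Icc (0:ℝ) 1)) {ρ : ℝ}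
    (hρ : 0 < ρ) :
    ∃ δ w : ℝ → ℝ, IsGauge δ ∧ IntegrableOn w (Icc (0:ℝ) 1) ∧ (∀ x, 0 ≤ w x) ∧
      ∫ x in (0:ℝ)..1, w x ≤ ρ ∧ ∀ u v t, 0 ≤ u → u ≤ v → v ≤ 1 → FreePiece δ u v t →
        |(v - u) * g t - ∫ x in u..v, g x| ≤ ∫ x in u..v, w x := by
  obtain ⟨U, hgU, hU, hUi, hUt, hUe⟩ := exists_lt_lowerSemicontinuous_integral_lt g hg
    (half_pos hρ)
  obtain ⟨V, hVg, hV, hVi, hVb, hVe⟩ := exists_upperSemicontinuous_lt_integral_gt g hg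
    (half_pos hρ)
  have hex : ∀ t, ∃ d > 0, ∀ x, dist x t < d → (g t : EReal) < U x ∧ V x < g t := fun t =>
    Metric.eventually_nhds_iff.1 ((hU t _ (hgU t)).and (hV t _ (hVg t)))
  choose δ hδ hδ' using hex
  set w : ℝ → ℝ := fun x => |(U x).toReal - (V x).toReal|
  have hwi : IntegrableOn w (Icc (0:ℝ) 1) := (hUi.sub hVi).abs
  have hae : ∀ᵐ x ∂volume.restrict (Icc (0:ℝ) 1), U x < ⊤ ∧ ⊥ < V x := hUt.and hVb
  have hge : ∀ᵐ x ∂volume.restrict (Icc (0:ℝ) 1),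
      g x ≤ (U x).toReal ∧ (V x).toReal ≤ g x := by
    filter_upwards [hae] with x hx
    constructor
    · have := EReal.toReal_le_toReal (hgU x).le (EReal.coe_ne_bot _) hx.1.ne
      simpa using this
    · have := EReal.toReal_le_toReal (hVg x).le hx.2.ne' (EReal.coe_ne_top _)
      simpa using this
  refine ⟨δ, w, fun t _ => hδ t, hwi, fun x => abs_nonneg _, ?_, ?_⟩
  · rw [intervalIntegral.integral_of_le zero_le_one, ← integral_Icc_eq_integral_Ioc]
    have : ∫ x in Icc (0:ℝ) 1, w x = ∫ x in Icc (0:ℝ) 1, ((U x).toReal - (V x).toReal) := by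
      refine integral_congr_ae ?_
      filter_upwards [hge] with x hx
      exact abs_of_nonneg (by linarith [hx.1, hx.2])
    rw [this, integral_sub hUi hVi]
    linarith
  · intro u v t hu huv hv hp
    have hsub : Icc u v ⊆ Icc (0:ℝ) 1 := Icc_subset_Icc hu hv
    have hii : ∀ {h : ℝ → ℝ}, IntegrableOn h (Icc (0:ℝ) 1) → IntervalIntegrable h volume u v :=
      fun h => IntegrableOn.intervalIntegrable_sub h hu huv hv
    have hae' := ae_restrict_of_ae_restrict_of_subset hsub (hae.and hge)
    have hmem := ae_restrict_mem (μ := volume) (measurableSet_Icc : MeasurableSet (Icc u v))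
    have hc : (v - u) * g t = ∫ _x in u..v, g t := by simp
    rw [hc, ← intervalIntegral.integral_sub (by simp) (hii hg)]
    refine intervalIntegral.abs_integral_le_integral_abs huv |>.trans ?_
    rw [intervalIntegral.integral_of_le huv, intervalIntegral.integral_of_le huv,
      ← integral_Icc_eq_integral_Ioc, ← integral_Icc_eq_integral_Ioc]
    refine integral_mono_ae ?_ (hwi.mono_set hsub) ?_
    · exact ((integrableOn_const (by simp)).sub (hg.mono_set hsub)).abs
    · filter_upwards [hae', hmem] with x hx hxm
      obtain ⟨⟨h1, h2⟩, h3, h4⟩ := hx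
      have hxt : dist x t < δ t := by
        have := hp.2 hxm
        rw [Real.dist_eq, abs_lt]
        constructor <;> linarith [this.1, this.2]
      obtain ⟨h5, h6⟩ := hδ' t x hxt
      have h7 := EReal.toReal_le_toReal h5.le (EReal.coe_ne_bot _) h1.ne
      have h8 := EReal.toReal_le_toReal h6.le h2.ne' (EReal.coe_ne_top _)
      rw [EReal.toReal_coe] at h7 h8
      have : |g t - g x| ≤ (U x).toReal - (V x).toReal := by
        rw [abs_le]; constructor <;> linarith
      exact this.trans (le_abs_self _)

/-- A Lebesgue integrable function is McShane integrable on every subinterval, with one gauge. -/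
lemma exists_gauge_abs_sub_integral_le {g : ℝ → ℝ} (hg : IntegrableOn g (Icc (0:ℝ) 1)) {ρ : ℝ}
    (hρ : 0 < ρ) :
    ∃ δ : ℝ → ℝ, IsGauge δ ∧ ∀ a b S, 0 ≤ a → b ≤ 1 →
      PSum (FreePiece δ) (fun u v t => (v - u) * g t - ∫ x in u..v, g x) a b S → |S| ≤ ρ := by
  obtain ⟨δ, w, hδ, hw, hw0, hwρ, h⟩ := exists_gauge_of_integrableOn hg hρ
  refine ⟨δ, hδ, fun a b S ha hb hS => ?_⟩
  have hab := hS.le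
  have := hS.restrict.abs_le_of_forall_le (ψ := fun y => ∫ x in (0:ℝ)..y, w x)
    fun u v t huv hp => by
      rw [integral_sub_integral_eq hw (ha.trans hp.2.1) huv (hp.2.2.trans hb)]
      exact h u v t (ha.trans hp.2.1) huv (hp.2.2.trans hb) hp.1
  refine this.trans (le_trans ?_ hwρ)
  rw [integral_sub_integral_eq hw ha hab hb]
  exact intervalIntegral.integral_mono_interval ha hab hb (by filter_upwards with x using hw0 x)
    (IntegrableOn.intervalIntegrable_sub hw le_rfl zero_le_one le_rfl)

/-- A nonnegative measurable function with bounded gauge sums is integrable. -/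
lemma integrableOn_of_psum_le {h : ℝ → ℝ} {a b B : ℝ} (ha : 0 ≤ a) (hab : a ≤ b) (hb : b ≤ 1)
    (h0 : ∀ t ∈ Icc (0:ℝ) 1, 0 ≤ h t) (hm : AEMeasurable h (volume.restrict (Icc a b)))
    (hB : ∀ δ, IsGauge δ → ∃ S, PSum (FreePiece δ) (fun u v t => (v - u) * h t) a b S ∧ S ≤ B) :
    IntegrableOn h (Icc a b) ∧ ∫ x in Icc a b, h x ≤ B := by
  have hB0 : 0 ≤ B := by
    obtain ⟨S, hS, hSB⟩ := hB (fun _ => 1) (fun _ _ => one_pos)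
    obtain ⟨S', hS', hSS'⟩ := (hS.map (R' := FreePiece fun _ => 1)
      (φ' := fun u v t => -((v - u) * h t)) (-AddMonoidHom.id ℝ)
      fun u v t _ h => ⟨t, h, by simp⟩).exists_ge (φ' := fun _ _ _ => 0) fun u v t huv hp => by
        have := mul_nonneg (sub_nonneg.2 huv) (h0 t hp.1)
        linarith
    have h1 := hS'.le_of_forall_le (ψ := fun _ => 0) (by simp)
    simp at hSS' h1
    linarith
  have hsub : Icc a b ⊆ Icc (0:ℝ) 1 := Icc_subset_Icc ha hb
  have hnn : ∀ᵐ x ∂volume.restrict (Icc a b), 0 ≤ h x := by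
    filter_upwards [ae_restrict_mem measurableSet_Icc] with x hx using h0 x (hsub hx)
  have key : ∀ k : ℕ, ∫⁻ x in Icc a b, ENNReal.ofReal (min (h x) k) ≤ ENNReal.ofReal B := by
    intro k
    have hmk : AEMeasurable (fun x => min (h x) (k:ℝ)) (volume.restrict (Icc a b)) :=
      hm.min aemeasurable_const
    have hik : IntegrableOn (fun x => min (h x) (k:ℝ)) (Icc a b) := by
      refine Integrable.of_bound hmk.aestronglyMeasurable k ?_
      filter_upwards [hnn] with x hx
      rw [Real.norm_eq_abs, abs_of_nonneg (le_min hx (Nat.cast_nonneg k))]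
      exact min_le_right _ _
    rw [← ofReal_integral_eq_lintegral_ofReal hik
      (by filter_upwards [hnn] with x hx using le_min hx (Nat.cast_nonneg k))]
    refine ENNReal.ofReal_le_ofReal (le_of_forall_pos_le_add fun ρ hρ => ?_)
    set g := (Icc a b).indicator fun x => min (h x) (k:ℝ)
    have hg : IntegrableOn g (Icc (0:ℝ) 1) :=
      (hik.integrable_indicator measurableSet_Icc).integrableOn
    obtain ⟨δ, hδ, H⟩ := exists_gauge_abs_sub_integral_le hg hρ
    obtain ⟨S, hS, hSB⟩ := hB δ hδ
    obtain ⟨S', hS', hSS'⟩ := (hS.map (R' := FreePiece δ)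
      (φ' := fun u v t => -((v - u) * h t)) (-AddMonoidHom.id ℝ)
      fun u v t _ h => ⟨t, h, by simp⟩).exists_ge (φ' := fun u v t => -((v - u) * g t))
      fun u v t huv hp => by
        have : g t ≤ h t := by
          by_cases ht : t ∈ Icc a b
          · simp [g, ht]
          · simpa [g, ht] using h0 t hp.1
        have := mul_le_mul_of_nonneg_left this (sub_nonneg.2 huv)
        linarith
    have hS'' := (hS'.map (R' := FreePiece δ)
      (φ' := fun u v t => (v - u) * g t) (-AddMonoidHom.id ℝ)
      fun u v t _ h => ⟨t, h, by simp⟩).sub_increment fun y => ∫ x in (0:ℝ)..y, g x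
    have h3 := H a b _ ha hb (hS''.restrict.map (AddMonoidHom.id ℝ) fun u v t huv hp => ⟨t, hp.1, by
      simp [integral_sub_integral_eq hg (ha.trans hp.2.1) huv (hp.2.2.trans hb)]⟩)
    rw [integral_sub_integral_eq hg ha hab hb, intervalIntegral.integral_of_le hab,
      ← integral_Icc_eq_integral_Ioc, setIntegral_indicator measurableSet_Icc, inter_self] at h3
    simp at h3 hSS'
    linarith [(abs_le.1 h3).1]
  have hlim : ∫⁻ x in Icc a b, ENNReal.ofReal (h x) ≤ ENNReal.ofReal B := by
    have h1 : ∀ x, ENNReal.ofReal (h x) = ⨆ k : ℕ, ENNReal.ofReal (min (h x) k) := fun x => by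
      refine le_antisymm ?_ (iSup_le fun k => ENNReal.ofReal_le_ofReal (min_le_left _ _))
      obtain ⟨k, hk⟩ := exists_nat_ge (h x)
      exact le_iSup_of_le k (by rw [min_eq_left hk])
    simp_rw [h1]
    rw [lintegral_iSup' (fun k => (hm.min aemeasurable_const).ennreal_ofReal)]
    · exact iSup_le key
    · filter_upwards with x i j hij
      exact ENNReal.ofReal_le_ofReal (min_le_min_left _ (by exact_mod_cast hij))
  have hint : IntegrableOn h (Icc a b) := by
    refine ⟨hm.aestronglyMeasurable, ?_⟩
    rw [hasFiniteIntegral_iff_ofReal hnn]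
    exact hlim.trans_lt ENNReal.ofReal_lt_top
  refine ⟨hint, ?_⟩
  rw [← ENNReal.ofReal_le_ofReal_iff hB0, ofReal_integral_eq_lintegral_ofReal hint hnn]
  exact hlim

/-- A weak-type covering estimate for arbitrary families of balls on the line. -/
lemma volume_iUnion_closedBall_le {T : Set ℝ} {r c : ℝ → ℝ} {R s B : ℝ} (hs : 0 < s)
    (hr : ∀ t ∈ T, 0 < r t ∧ r t ≤ R) (hc : ∀ t ∈ T, s * (2 * r t) ≤ c t)
    (hB : ∀ F : Finset ℝ, (F : Set ℝ) ⊆ T →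
      (F : Set ℝ).PairwiseDisjoint (fun t => closedBall t (r t)) → ∑ t ∈ F, c t ≤ B) :
    volume (⋃ t ∈ T, closedBall t (r t)) ≤ ENNReal.ofReal (5 * B / s) := by
  obtain ⟨u, huT, hud, hu⟩ := Vitali.exists_disjoint_subfamily_covering_enlargement_closedBall
    T (fun t => t) r R (fun t ht => (hr t ht).2) 5 (by norm_num)
  have hcount : u.Countable := hud.countable_of_nonempty_interior fun t ht => by
    refine ⟨t, ?_⟩
    rw [interior_closedBall _ (hr t (huT ht)).1.ne']
    exact mem_ball_self (hr t (huT ht)).1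
  have := hcount.to_subtype
  calc volume (⋃ t ∈ T, closedBall t (r t))
      ≤ volume (⋃ t ∈ u, closedBall t (5 * r t)) := by
        refine measure_mono (iUnion₂_subset fun t ht => ?_)
        obtain ⟨b, hb, hb'⟩ := hu t ht
        exact hb'.trans (subset_biUnion_of_mem (u := fun t => closedBall t (5 * r t)) hb)
    _ ≤ ∑' t : u, volume (closedBall (t:ℝ) (5 * r t)) := measure_biUnion_le _ hcount _
    _ ≤ ENNReal.ofReal (5 * B / s) := by
        rw [ENNReal.tsum_eq_iSup_sum]
        refine iSup_le fun F => ?_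
        simp_rw [Real.volume_closedBall]
        rw [← ENNReal.ofReal_sum_of_nonneg fun t _ => by linarith [(hr t (huT t.2)).1]]
        refine ENNReal.ofReal_le_ofReal ?_
        have h1 := hB (F.map (Function.Embedding.subtype _)) (by
          intro x hx
          simp only [Finset.coe_map, Function.Embedding.subtype_apply, mem_image] at hx
          obtain ⟨y, -, rfl⟩ := hx
          exact huT y.2) (hud.subset (by
          intro x hx
          simp only [Finset.coe_map, Function.Embedding.subtype_apply, mem_image] at hx
          obtain ⟨y, -, rfl⟩ := hx
          exact y.2))
        rw [Finset.sum_map] at h1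
        rw [le_div_iff₀ hs, Finset.sum_mul]
        calc ∑ t ∈ F, 2 * (5 * r t) * s ≤ ∑ t ∈ F, 5 * c t :=
              Finset.sum_le_sum fun t _ => by nlinarith [hc t (huT t.2)]
          _ ≤ 5 * B := by
              rw [← Finset.mul_sum]
              exact mul_le_mul_of_nonneg_left h1 (by norm_num)

/-- The error of the Riemann sum of `g` on the tagged interval `([u, v], t)`. -/
noncomputable abbrev gaugeErr (g : ℝ → ℝ) : ℝ → ℝ → ℝ → ℝ :=
  fun u v t => (v - u) * g t - ∫ x in u..v, g x

lemma exists_psum_gaugeErr_small {g : ℝ → ℝ} (hg : IntegrableOn g (Icc (0:ℝ) 1)) {δ : ℝ → ℝ}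
    (hδ : IsGauge δ) {ρ : ℝ} (hρ : 0 < ρ) {u v : ℝ} (hu : 0 ≤ u) (huv : u ≤ v) (hv : v ≤ 1) :
    ∃ S, PSum (PerronPiece δ) (gaugeErr g) u v S ∧ |S| ≤ ρ := by
  obtain ⟨δ', hδ', H⟩ := exists_gauge_abs_sub_integral_le hg hρ
  obtain ⟨S, hS⟩ := exists_psum_perron (gaugeErr g) (hδ.min hδ') hu huv hv
  exact ⟨S, hS.mono fun _ _ _ _ h => h.1.mono (min_le_left _ _),
    H u v S hu hv (hS.mono fun _ _ _ _ h => h.1.2.mono (min_le_right _ _))⟩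

lemma sum_abs_gaugeErr_le {g : ℝ → ℝ} (hg : IntegrableOn g (Icc (0:ℝ) 1)) {δ : ℝ → ℝ}
    (hδ : IsGauge δ) {ε : ℝ}
    (hε : ∀ S, PSum (PerronPiece δ) (gaugeErr g) 0 1 S → |S| ≤ ε) {ι : Type*} {a b t : ι → ℝ}
    {s : Finset ι} (hs : ∀ i ∈ s, 0 ≤ a i ∧ a i < b i ∧ b i ≤ 1 ∧ PerronPiece δ (a i) (b i) (t i))
    (hd : ∀ i ∈ s, ∀ j ∈ s, i ≠ j → b i ≤ a j ∨ b j ≤ a i) :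
    ∑ i ∈ s, |gaugeErr g (a i) (b i) (t i)| ≤ 2 * ε :=
  sum_abs_le_of_psum (fun _ hρ _ _ hu huv hv => exists_psum_gaugeErr_small hg hδ hρ hu huv hv)
    hε hs hd

/-- Uniform approximation by step functions on a set where the gauge is bounded below. -/
lemma exists_step_approx {Θ : Type*} {g : Θ → ℝ → ℝ}
    (hg : ∀ θ, IntegrableOn (g θ) (Icc (0:ℝ) 1)) {δ : ℝ → ℝ} (hδ : IsGauge δ) {ε M d : ℝ}
    (hε0 : 0 < ε) (hM : 0 ≤ M) (hd : 0 < d)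
    (hε : ∀ θ S, PSum (PerronPiece δ) (gaugeErr (g θ)) 0 1 S → |S| ≤ ε)
    {A : Set ℝ} (hA : A ⊆ Icc 0 1) (hAM : ∀ θ, ∀ t ∈ A, |g θ t| ≤ M) (hAd : ∀ t ∈ A, d ≤ δ t) :
    ∃ q : ℕ, 0 < q ∧ ∀ θ, ∃ a : ℤ → ℝ, (∀ j, |a j| ≤ M) ∧
      ∫ x in toMeasurable volume A ∩ Icc 0 1, |g θ x - a ⌊q * x⌋| ≤ 5 * ε := by
  classical
  obtain ⟨q, hq⟩ := exists_nat_gt (1 / d)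
  have hq0 : (0:ℝ) < q := lt_trans (by positivity) hq
  have hqd : 1 / (q:ℝ) < d := by
    rwa [one_div_lt hd hq0] at hq
  refine ⟨q, by exact_mod_cast hq0, fun θ => ?_⟩
  let blk : ℤ → Set ℝ := fun j => {t | t ∈ A ∧ ⌊q * t⌋ = j}
  have hex : ∀ j, ∃ s t : ℝ, (blk j).Nonempty →
      s ∈ blk j ∧ t ∈ blk j ∧ ∀ x ∈ blk j, |g θ x - g θ s| ≤ |g θ t - g θ s| + ε := by
    intro j
    by_cases hj : (blk j).Nonempty
    · obtain ⟨s, hs⟩ := hj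
      have hne : ((fun x => |g θ x - g θ s|) '' blk j).Nonempty := ⟨_, s, hs, rfl⟩
      have hbdd : BddAbove ((fun x => |g θ x - g θ s|) '' blk j) := by
        refine ⟨M + M, ?_⟩
        rintro _ ⟨x, hx, rfl⟩
        exact (abs_sub _ _).trans (add_le_add (hAM θ x hx.1) (hAM θ s hs.1))
      obtain ⟨_, ⟨t, ht, rfl⟩, hlt⟩ := exists_lt_of_lt_csSup hne (sub_lt_self _ hε0)
      refine ⟨s, t, fun _ => ⟨hs, ht, fun x hx => ?_⟩⟩
      have := le_csSup hbdd ⟨x, hx, rfl⟩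
      simp only at this hlt
      linarith
    · exact ⟨0, 0, fun h => absurd h hj⟩
  choose s t hst using hex
  set a : ℤ → ℝ := fun j => if (blk j).Nonempty then g θ (s j) else 0
  have haM : ∀ j, |a j| ≤ M := by
    intro j
    by_cases hj : (blk j).Nonempty
    · simpa [a, hj] using hAM θ _ (hst j hj).1.1
    · simpa [a, hj] using hM
  refine ⟨a, haM, ?_⟩
  set o : ℤ → ℝ := fun j => if (blk j).Nonempty then |g θ (t j) - g θ (s j)| + ε else 0
  have ho : ∀ x ∈ A, |g θ x - a ⌊q * x⌋| ≤ o ⌊q * x⌋ := by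
    intro x hx
    have hne : (blk ⌊q * x⌋).Nonempty := ⟨x, hx, rfl⟩
    simp only [a, o, if_pos hne]
    exact (hst _ hne).2.2 x ⟨hx, rfl⟩
  have hfl : Measurable fun x : ℝ => ⌊q * x⌋ := Int.measurable_floor.comp (measurable_const_mul _)
  have hma : Measurable fun x : ℝ => a ⌊q * x⌋ := (measurable_of_countable a).comp hfl
  have hmo : Measurable fun x : ℝ => o ⌊q * x⌋ := (measurable_of_countable o).comp hfl
  have hgm : AEMeasurable (g θ) (volume.restrict (Icc 0 1)) := (hg θ).aemeasurable
  set H := toMeasurable volume A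
  have hHm : MeasurableSet H := measurableSet_toMeasurable _ _
  have hae : ∀ᵐ x ∂volume.restrict (Icc (0:ℝ) 1), x ∈ H →
      |g θ x - a ⌊q * x⌋| ≤ o ⌊q * x⌋ := by
    set g' := hgm.mk
    have hg'm : Measurable g' := hgm.measurable_mk
    set C := {x | |g' x - a ⌊q * x⌋| ≤ o ⌊q * x⌋}
    have hC : MeasurableSet C := measurableSet_le (hg'm.sub hma).abs hmo
    have hgg : ∀ᵐ x ∂volume.restrict (Icc (0:ℝ) 1), g θ x = g' x := hgm.ae_eq_mk
    obtain ⟨Z, hZ, hZm, hZ0⟩ := exists_measurable_superset_of_null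
      (mem_ae_iff.1 ((ae_restrict_iff' measurableSet_Icc).1 hgg))
    have hHC : volume (H ∩ (Cᶜ ∩ Zᶜ)) = 0 := by
      rw [Measure.measure_toMeasurable_inter (hC.compl.inter hZm.compl)
        (ne_top_of_le_ne_top (by simp) (measure_mono hA))]
      convert measure_empty (μ := (volume : Measure ℝ))
      ext x
      simp only [mem_inter_iff, mem_empty_iff_false, iff_false, not_and]
      intro hxA hxC hxZ
      have : g θ x = g' x := by
        by_contra h
        exact hxZ (hZ fun h' => h (h' (hA hxA)))
      refine hxC ?_
      change |g' x - a ⌊q * x⌋| ≤ o ⌊q * x⌋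
      rw [← this]
      exact ho x hxA
    have h1 : ∀ᵐ x ∂volume.restrict (Icc (0:ℝ) 1), x ∉ H ∩ (Cᶜ ∩ Zᶜ) :=
      ae_restrict_of_ae (measure_eq_zero_iff_ae_notMem.1 hHC)
    have h2 : ∀ᵐ x ∂volume.restrict (Icc (0:ℝ) 1), x ∉ Z :=
      ae_restrict_of_ae (measure_eq_zero_iff_ae_notMem.1 hZ0)
    filter_upwards [h1, h2, hgg] with x hx1 hx2 hx3 hxH
    by_contra h
    rw [hx3] at h
    exact hx1 ⟨hxH, h, hx2⟩
  set k : ℝ → ℝ := H.indicator fun x => |g θ x - a ⌊q * x⌋|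
  have hki : IntegrableOn k (Icc 0 1) := by
    refine Integrable.indicator (((hg θ).sub ?_).abs) hHm
    exact Integrable.of_bound hma.aestronglyMeasurable M (by filter_upwards with x using haM _)
  have hsum : ∑ j ∈ Finset.range q, (1 / (q:ℝ)) * o j ≤ 5 * ε := by
    set s1 := (Finset.range q).filter fun j : ℕ => (blk j).Nonempty
    have hpiece : ∀ j ∈ s1, ∀ x ∈ blk (j:ℤ), (0:ℝ) ≤ j / q ∧ (j:ℝ) / q < (j + 1) / q ∧
        ((j:ℝ) + 1) / q ≤ 1 ∧ PerronPiece δ (j / q) ((j + 1) / q) x := by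
      intro j hj x hx
      have hjq : ((j:ℝ) + 1) ≤ q := by
        have := Finset.mem_range.1 (Finset.mem_filter.1 hj).1
        exact_mod_cast this
      obtain ⟨h1, h2⟩ := Int.floor_eq_iff.1 hx.2
      push_cast at h1 h2
      have hx1 : (j:ℝ) / q ≤ x := by rw [div_le_iff₀ hq0]; linarith
      have hx2 : x < ((j:ℝ) + 1) / q := by rw [lt_div_iff₀ hq0]; linarith
      have hw : ((j:ℝ) + 1) / q = j / q + 1 / q := by ring
      refine ⟨by positivity, by gcongr; linarith, (div_le_one hq0).2 hjq, ⟨hx1, hx2.le⟩,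
        hA hx.1, fun y hy => ?_⟩
      have := hAd x hx.1
      exact ⟨by linarith [hy.1], by linarith [hy.2]⟩
    have hdis : ∀ i ∈ s1, ∀ j ∈ s1, i ≠ j →
        ((i:ℝ) + 1) / q ≤ j / q ∨ ((j:ℝ) + 1) / q ≤ i / q := by
      intro i _ j _ hij
      rcases lt_or_gt_of_ne hij with h | h
      · left; gcongr; exact_mod_cast h
      · right; gcongr; exact_mod_cast h
    have h1 := sum_abs_gaugeErr_le (hg θ) hδ (hε θ) (s := s1) (a := fun j : ℕ => (j:ℝ) / q)
      (b := fun j : ℕ => ((j:ℝ) + 1) / q) (t := fun j : ℕ => s j)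
      (fun j hj => hpiece j hj _ (hst j (Finset.mem_filter.1 hj).2).1) hdis
    have h2 := sum_abs_gaugeErr_le (hg θ) hδ (hε θ) (s := s1) (a := fun j : ℕ => (j:ℝ) / q)
      (b := fun j : ℕ => ((j:ℝ) + 1) / q) (t := fun j : ℕ => t j)
      (fun j hj => hpiece j hj _ (hst j (Finset.mem_filter.1 hj).2).2.1) hdis
    have h3 : ∑ j ∈ Finset.range q, (1 / (q:ℝ)) * o j =
        ∑ j ∈ s1, (1 / (q:ℝ)) * (|g θ (t j) - g θ (s j)| + ε) := by
      rw [Finset.sum_filter]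
      refine Finset.sum_congr rfl fun j _ => ?_
      by_cases hj : (blk j).Nonempty <;> simp [o, hj]
    have h4 : ∀ j ∈ s1, (1 / (q:ℝ)) * (|g θ (t j) - g θ (s j)| + ε) ≤
        |gaugeErr (g θ) (j / q) ((j + 1) / q) (t j)| +
        |gaugeErr (g θ) (j / q) ((j + 1) / q) (s j)| + 1 / q * ε := by
      intro j _
      rw [mul_add]
      gcongr
      refine le_trans (le_of_eq ?_) (abs_sub _ _)
      nth_rewrite 1 [← abs_of_pos (show 0 < 1 / (q:ℝ) by positivity)]
      rw [← abs_mul]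
      congr 1
      simp only [gaugeErr]
      ring
    rw [h3]
    refine (Finset.sum_le_sum h4).trans ?_
    rw [Finset.sum_add_distrib, Finset.sum_add_distrib, Finset.sum_const, nsmul_eq_mul]
    have h5 : (s1.card : ℝ) * (1 / q * ε) ≤ ε := by
      have : (s1.card : ℝ) ≤ q := by
        have := Finset.card_filter_le (Finset.range q) fun j : ℕ => (blk j).Nonempty
        rw [Finset.card_range] at this
        exact_mod_cast this
      rw [← mul_assoc, mul_one_div]
      exact mul_le_of_le_one_left hε0.le ((div_le_one hq0).2 this)
    linarith
  refine le_trans ?_ hsum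
  have h1 : ∫ x in H ∩ Icc 0 1, |g θ x - a ⌊q * x⌋| = ∫ x in (0:ℝ)..1, k x := by
    rw [intervalIntegral.integral_of_le zero_le_one, ← integral_Icc_eq_integral_Ioc,
      setIntegral_indicator hHm, inter_comm]
  have h2 : ∫ x in (0:ℝ)..1, k x =
      ∑ j ∈ Finset.range q, ∫ x in ((j:ℝ) / q)..(((j + 1 : ℕ) : ℝ) / q), k x := by
    rw [intervalIntegral.sum_integral_adjacent_intervals (a := fun j : ℕ => (j:ℝ) / q)]
    · simp [hq0.ne']
    · intro j hj
      refine IntegrableOn.intervalIntegrable_sub hki (by positivity)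
        (by gcongr; exact_mod_cast Nat.le_succ j) ?_
      rw [div_le_one hq0]; exact_mod_cast hj
  rw [h1, h2]
  refine Finset.sum_le_sum fun j hj => ?_
  have hjq : ((j:ℝ) + 1) ≤ q := by exact_mod_cast Finset.mem_range.1 hj
  have hj1 : ((j:ℝ) + 1) / q ≤ 1 := (div_le_one hq0).2 hjq
  push_cast
  have hjle : (j:ℝ) / q ≤ (j + 1) / q := by gcongr; linarith
  have := intervalIntegral.norm_integral_le_of_norm_le_const_ae (f := k) (C := o j)
    (a := (j:ℝ) / q) (b := (j + 1) / q) (by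
      have h3 : ∀ᵐ x, x ≠ ((j:ℝ) + 1) / q :=
        measure_eq_zero_iff_ae_notMem.1 (measure_singleton (((j:ℝ) + 1) / q))
      filter_upwards [(ae_restrict_iff' measurableSet_Icc).1 hae, h3] with x hx hxne hxm
      rw [uIoc_of_le hjle] at hxm
      have hj0 : (0:ℝ) ≤ j / q := by positivity
      have hfx : ⌊q * x⌋ = j := by
        rw [Int.floor_eq_iff]
        have e1 := hxm.1
        have e2 := lt_of_le_of_ne hxm.2 hxne
        rw [div_lt_iff₀ hq0] at e1
        rw [lt_div_iff₀ hq0] at e2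
        push_cast
        constructor <;> linarith
      have hx' := hx ⟨by linarith [hxm.1], by linarith [hxm.2]⟩
      rw [hfx] at hx'
      have ho0 : 0 ≤ o j := by
        by_cases hj : (blk j).Nonempty
        · simp only [o, if_pos hj]; positivity
        · simp [o, hj]
      by_cases hxH : x ∈ H
      · simp only [k, indicator_of_mem hxH, Real.norm_eq_abs, abs_abs]
        rw [hfx]
        exact hx' hxH
      · simpa [k, hxH] using ho0)
  refine (le_abs_self _).trans (this.trans (le_of_eq ?_))
  rw [abs_of_nonneg (by linarith)]
  ring

/-- Uniform absolute continuity of the indefinite integrals of a family of functions. -/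
def UnifAbsCont {Θ : Type*} (g : Θ → ℝ → ℝ) : Prop :=
  ∀ ε > 0, ∃ η > 0, ∀ θ, ∀ E ⊆ Icc (0:ℝ) 1, MeasurableSet E → volume E ≤ ENNReal.ofReal η →
    ∫ x in E, |g θ x| ≤ ε

/-- The gauge sums of a family converge uniformly to the integrals, over the given pieces. -/
def UnifGauge {Θ : Type*} (R : (ℝ → ℝ) → ℝ → ℝ → ℝ → Prop) (g : Θ → ℝ → ℝ) : Prop :=
  ∀ ε > 0, ∃ δ : ℝ → ℝ, IsGauge δ ∧ ∀ θ S, PSum (R δ) (gaugeErr (g θ)) 0 1 S → |S| ≤ ε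

lemma exists_lt_volume_gauge_ge {δ : ℝ → ℝ} (hδ : IsGauge δ) {A : Set ℝ} (hA : A ⊆ Icc 0 1)
    {η : ℝ} (hη : 0 < η) :
    ∃ m : ℕ, volume A < volume {t ∈ A | 1 / ((m:ℝ) + 1) ≤ δ t} + ENNReal.ofReal η := by
  have hmono : Monotone fun m : ℕ => {t ∈ A | 1 / ((m:ℝ) + 1) ≤ δ t} := by
    intro m n hmn t ht
    refine ⟨ht.1, le_trans ?_ ht.2⟩
    gcongr
  have hU : ⋃ m : ℕ, {t ∈ A | 1 / ((m:ℝ) + 1) ≤ δ t} = A := by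
    refine subset_antisymm (iUnion_subset fun m => sep_subset _ _) fun t ht => ?_
    obtain ⟨m, hm⟩ := exists_nat_one_div_lt (hδ t (hA ht))
    exact mem_iUnion.2 ⟨m, ht, hm.le⟩
  have hlim := tendsto_measure_iUnion_atTop (μ := (volume : Measure ℝ)) hmono
  rw [hU] at hlim
  have hfin : volume A ≠ ∞ := ne_top_of_le_ne_top (by simp) (measure_mono hA)
  have h2 : volume A < volume A + ENNReal.ofReal η :=
    ENNReal.lt_add_right hfin (by simpa using hη)
  exact ((hlim.add_const _).eventually (lt_mem_nhds h2)).exists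

/-- Approximation of a uniformly Henstock integrable family by step functions near a set on
which the family is bounded. -/
lemma exists_open_step_approx {Θ : Type*} {g : Θ → ℝ → ℝ}
    (hg : ∀ θ, IntegrableOn (g θ) (Icc (0:ℝ) 1)) (hac : UnifAbsCont g)
    (hH : UnifGauge PerronPiece g) {A : Set ℝ} (hA : A ⊆ Icc 0 1) {M : ℝ} (hM : 0 < M)
    (hAM : ∀ θ, ∀ t ∈ A, |g θ t| ≤ M) {κ : ℝ} (hκ : 0 < κ) :
    ∃ (δ : ℝ → ℝ) (G : Set ℝ) (q : ℕ), IsGauge δ ∧ IsOpen G ∧ A ⊆ G ∧ 0 < q ∧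
      (∀ θ S, PSum (PerronPiece δ) (gaugeErr (g θ)) 0 1 S → |S| ≤ κ / 2) ∧
      ∀ θ, ∃ a : ℤ → ℝ, (∀ j, |a j| ≤ M) ∧
        ∫ x in G ∩ Icc 0 1, |g θ x - a ⌊q * x⌋| ≤ κ := by
  obtain ⟨δ, hδ, hδ'⟩ := hH (κ / 15) (by positivity)
  obtain ⟨η₀, hη₀, hui⟩ := hac (κ / 3) (by positivity)
  set η := min (η₀ / 2) (κ / (6 * M))
  have hη : 0 < η := by positivity
  obtain ⟨m, hm⟩ := exists_lt_volume_gauge_ge hδ hA hη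
  set A' := {t ∈ A | 1 / ((m:ℝ) + 1) ≤ δ t}
  have hA' : A' ⊆ A := sep_subset _ _
  have hfin : volume A ≠ ∞ := ne_top_of_le_ne_top (by simp) (measure_mono hA)
  obtain ⟨G, hAG, hGo, hG⟩ := A.exists_isOpen_lt_add hfin (ε := ENNReal.ofReal η) (by simpa)
  obtain ⟨q, hq, hq'⟩ := exists_step_approx hg hδ (ε := κ / 15) (M := M) (d := 1 / ((m:ℝ) + 1))
    (by positivity) hM.le (by positivity) hδ' (hA'.trans hA) (fun θ t ht => hAM θ t (hA' ht))
    fun t ht => ht.2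
  refine ⟨δ, G, q, hδ, hGo, hAG, hq, fun θ S hS => (hδ' θ S hS).trans (by linarith), fun θ => ?_⟩
  obtain ⟨a, haM, ha⟩ := hq' θ
  refine ⟨a, haM, ?_⟩
  set H := toMeasurable volume A'
  have hHm : MeasurableSet H := measurableSet_toMeasurable _ _
  set N := (G ∩ Icc 0 1) \ H
  have hNm : MeasurableSet N := (hGo.measurableSet.inter measurableSet_Icc).diff hHm
  have hN : volume N ≤ ENNReal.ofReal (2 * η) := by
    have hGH : volume A' ≤ volume (G ∩ H) :=
      measure_mono (subset_inter (hA'.trans hAG) (subset_toMeasurable _ _))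
    have h1 : volume (G \ H) + volume (G ∩ H) = volume G := measure_sdiff_add_inter G hHm
    have h2 : volume (G \ H) + volume A' < volume A' + ENNReal.ofReal (2 * η) := by
      calc volume (G \ H) + volume A' ≤ volume G := by rw [← h1]; gcongr
        _ < volume A + ENNReal.ofReal η := hG
        _ ≤ volume A' + ENNReal.ofReal η + ENNReal.ofReal η := by gcongr
        _ = volume A' + ENNReal.ofReal (2 * η) := by
          rw [add_assoc, ← ENNReal.ofReal_add hη.le hη.le, two_mul]
    rw [add_comm] at h2
    have h3 := (ENNReal.add_lt_add_iff_left
      (ne_top_of_le_ne_top hfin (measure_mono hA'))).1 h2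
    exact (measure_mono (sdiff_subset_sdiff_left inter_subset_left)).trans h3.le
  have hfl : Measurable fun x : ℝ => a ⌊q * x⌋ :=
    (measurable_of_countable a).comp (Int.measurable_floor.comp (measurable_const_mul _))
  have hai : IntegrableOn (fun x : ℝ => a ⌊q * x⌋) (Icc 0 1) :=
    Integrable.of_bound hfl.aestronglyMeasurable M (by filter_upwards with x using haM _)
  have hdi : IntegrableOn (fun x : ℝ => |g θ x - a ⌊q * x⌋|) (Icc 0 1) := ((hg θ).sub hai).abs
  have habs : IntegrableOn (fun x => |g θ x|) (Icc 0 1) := (hg θ).abs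
  have hNs : N ⊆ Icc 0 1 := sdiff_subset.trans inter_subset_right
  have hNb : ∫ x in N, |g θ x - a ⌊q * x⌋| ≤ κ / 3 + M * (2 * η) := by
    calc ∫ x in N, |g θ x - a ⌊q * x⌋| ≤ ∫ x in N, (|g θ x| + M) := by
          refine integral_mono (hdi.mono_set hNs) ((habs.mono_set hNs).add
            (integrableOn_const (ne_top_of_le_ne_top ENNReal.ofReal_ne_top hN))) fun x => ?_
          exact (abs_sub _ _).trans (by gcongr; exact haM _)
      _ = (∫ x in N, |g θ x|) + volume.real N * M := by
          rw [integral_add (habs.mono_set hNs)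
            (integrableOn_const (ne_top_of_le_ne_top ENNReal.ofReal_ne_top hN))]
          simp
      _ ≤ κ / 3 + M * (2 * η) := by
          have h4 : volume.real N ≤ 2 * η := by
            rw [Measure.real]
            exact ENNReal.toReal_le_of_le_ofReal (by positivity) hN
          have h5 := hui θ N hNs hNm (hN.trans (ENNReal.ofReal_le_ofReal (by
            have := min_le_left (η₀ / 2) (κ / (6 * M))
            linarith)))
          rw [mul_comm]
          gcongr
  have hηM : M * (2 * η) ≤ κ / 3 := by
    have : η ≤ κ / (6 * M) := min_le_right _ _
    rw [le_div_iff₀ (by positivity)] at this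
    linarith
  have hsplit : ∫ x in G ∩ Icc 0 1, |g θ x - a ⌊q * x⌋| ≤
      (∫ x in H ∩ Icc 0 1, |g θ x - a ⌊q * x⌋|) + ∫ x in N, |g θ x - a ⌊q * x⌋| := by
    rw [← setIntegral_union _ hNm (hdi.mono_set inter_subset_right) (hdi.mono_set hNs)]
    · refine setIntegral_mono_set (hdi.mono_set (union_subset inter_subset_right hNs)) ?_ ?_
      · filter_upwards with x using abs_nonneg _
      · refine LE.le.eventuallyLE fun x hx => ?_
        by_cases hxH : x ∈ H
        · exact Or.inl ⟨hxH, hx.2⟩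
        · exact Or.inr ⟨hx, hxH⟩
    · exact disjoint_left.2 fun x hx hx' => hx'.2 hx.1
  linarith

lemma le_or_le_of_disjoint_Icc {a b c d : ℝ} (hab : a ≤ b) (hcd : c ≤ d)
    (h : Disjoint (Icc a b) (Icc c d)) : b ≤ c ∨ d ≤ a := by
  by_contra! hlt
  exact disjoint_left.1 h ⟨le_max_left a c, max_le hab hlt.1.le⟩
    ⟨le_max_right a c, max_le hlt.2.le hcd⟩

/-- Radii adapted to an open set and to the grid of mesh `1 / q`. -/
lemma exists_grid_radius {q : ℕ} (hq : 0 < q) {t d e : ℝ} (ht : t ∈ Icc (0:ℝ) 1) (hd : 0 < d)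
    (he : 0 < e) {G : Set ℝ} (hG : IsOpen G) (htG : t ∈ G) :
    ∃ r > 0, r < d ∧ r ≤ e ∧ closedBall t r ⊆ G ∧ ((¬ ∃ k : ℤ, (k:ℝ) = q * t) →
      closedBall t r ⊆ Icc 0 1 ∧ ∀ x ∈ closedBall t r, ⌊q * x⌋ = ⌊q * t⌋) := by
  have hq0 : (0:ℝ) < q := by exact_mod_cast hq
  by_cases hk : ∃ k : ℤ, (k:ℝ) = q * t
  · obtain ⟨r, hr, hrG⟩ := Metric.nhds_basis_closedBall.mem_iff.1 (hG.mem_nhds htG)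
    refine ⟨min r (min (d / 2) e), by positivity, ?_, ?_, ?_, fun h => absurd hk h⟩
    · exact (min_le_right _ _).trans_lt ((min_le_left _ _).trans_lt (by linarith))
    · exact (min_le_right _ _).trans (min_le_right _ _)
    · exact (closedBall_subset_closedBall (min_le_left _ _)).trans hrG
  · have hlt : (⌊q * t⌋:ℝ) < q * t := lt_of_le_of_ne (Int.floor_le _) fun h => hk ⟨_, h⟩
    have htI : t ∈ G ∩ Ioo ((⌊q * t⌋:ℝ) / q) ((⌊q * t⌋ + 1) / q) := by
      refine ⟨htG, ?_, ?_⟩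
      · rw [div_lt_iff₀ hq0]; linarith
      · rw [lt_div_iff₀ hq0]; linarith [Int.lt_floor_add_one (q * t)]
    obtain ⟨r, hr, hrG⟩ := Metric.nhds_basis_closedBall.mem_iff.1
      ((hG.inter isOpen_Ioo).mem_nhds htI)
    have hsub := (closedBall_subset_closedBall (min_le_left r (min (d / 2) e))).trans hrG
    refine ⟨min r (min (d / 2) e), by positivity, ?_, ?_, hsub.trans inter_subset_left,
      fun _ => ⟨fun x hx => ?_, fun x hx => ?_⟩⟩
    · exact (min_le_right _ _).trans_lt ((min_le_left _ _).trans_lt (by linarith))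
    · exact (min_le_right _ _).trans (min_le_right _ _)
    · obtain ⟨h1, h2⟩ := (hsub hx).2
      have h3 : (0:ℤ) ≤ ⌊q * t⌋ := Int.floor_nonneg.2 (mul_nonneg hq0.le ht.1)
      have h4 : ⌊q * t⌋ + 1 ≤ (q:ℤ) := by
        have : (⌊q * t⌋:ℝ) < ((q:ℤ):ℝ) := by
          push_cast
          exact hlt.trans_le (mul_le_of_le_one_right hq0.le ht.2)
        exact_mod_cast this
      have h3' : (0:ℝ) ≤ ⌊q * t⌋ := by exact_mod_cast h3
      have h4' : (⌊q * t⌋:ℝ) + 1 ≤ q := by exact_mod_cast h4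
      have h5 : (0:ℝ) ≤ ⌊q * t⌋ / q := by positivity
      have h6 : ((⌊q * t⌋:ℝ) + 1) / q ≤ 1 := (div_le_one hq0).2 h4'
      exact ⟨by linarith, by linarith⟩
    · obtain ⟨h1, h2⟩ := (hsub hx).2
      rw [div_lt_iff₀ hq0] at h1
      rw [lt_div_iff₀ hq0] at h2
      rw [Int.floor_eq_iff]
      constructor <;> linarith

lemma volume_grid_le {q : ℕ} (hq : 0 < q) {A : Set ℝ} (hA : A ⊆ Icc 0 1) {r : ℝ → ℝ} {e : ℝ}
    (hr : ∀ t ∈ A, r t ≤ e) :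
    volume (⋃ t ∈ {t ∈ A | ∃ k : ℤ, (k:ℝ) = q * t}, closedBall t (r t)) ≤
      ENNReal.ofReal ((q + 1) * (2 * e)) := by
  have hq0 : (0:ℝ) < q := by exact_mod_cast hq
  have hsub : (⋃ t ∈ {t ∈ A | ∃ k : ℤ, (k:ℝ) = q * t}, closedBall t (r t)) ⊆
      ⋃ j ∈ Finset.range (q + 1), closedBall ((j:ℝ) / q) e := by
    refine iUnion₂_subset fun t ht => ?_
    obtain ⟨htA, k, hk⟩ := ht
    have h0 : 0 ≤ k := by
      have : (0:ℝ) ≤ k := by rw [hk]; exact mul_nonneg hq0.le (hA htA).1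
      exact_mod_cast this
    have h1 : k ≤ q := by
      have : (k:ℝ) ≤ ((q:ℤ):ℝ) := by
        rw [hk]; push_cast; exact mul_le_of_le_one_right hq0.le (hA htA).2
      exact_mod_cast this
    lift k to ℕ using h0
    have hkq : (k:ℝ) / q = t := by
      rw [div_eq_iff hq0.ne']; push_cast at hk; linarith
    refine subset_trans ?_ (subset_biUnion_of_mem (u := fun j : ℕ => closedBall ((j:ℝ) / q) e)
      (show k ∈ ((Finset.range (q + 1) : Finset ℕ) : Set ℕ) by simp; omega))
    rw [hkq]
    exact closedBall_subset_closedBall (hr t htA)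
  refine (measure_mono hsub).trans ((measure_biUnion_finset_le _ _).trans ?_)
  simp only [Real.volume_closedBall, Finset.sum_const, Finset.card_range, nsmul_eq_mul]
  rw [ENNReal.ofReal_mul (by positivity : (0:ℝ) ≤ (q:ℝ) + 1),
    ENNReal.ofReal_add (by positivity) one_pos.le]
  simp

/-- A uniformly Henstock integrable, uniformly absolutely continuous family is uniformly McShane
integrable on each set where it is bounded. -/
lemma exists_gauge_of_bounded_on {Θ : Type*} {g : Θ → ℝ → ℝ}
    (hg : ∀ θ, IntegrableOn (g θ) (Icc (0:ℝ) 1)) (hac : UnifAbsCont g)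
    (hH : UnifGauge PerronPiece g) {A : Set ℝ} (hA : A ⊆ Icc 0 1) {M : ℝ} (hM : 0 < M)
    (hAM : ∀ θ, ∀ t ∈ A, |g θ t| ≤ M) {ε : ℝ} (hε : 0 < ε) :
    ∃ δ : ℝ → ℝ, IsGauge δ ∧ ∀ θ S,
      PSum (fun u v t => t ∈ A → FreePiece δ u v t)
        (fun u v t => A.indicator (gaugeErr (g θ) u v) t) 0 1 S → |S| ≤ ε := by
  classical
  obtain ⟨η₀, hη₀, hui⟩ := hac (ε / 8) (by positivity)
  set η := min η₀ (ε / (8 * M))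
  have hη : 0 < η := by positivity
  set s := ε / 16
  have hs : 0 < s := by positivity
  set κ := min (ε / 8) (η * s / 10)
  have hκ : 0 < κ := by positivity
  obtain ⟨δ, G, q, hδ, hGo, hAG, hq, hδε, hap⟩ := exists_open_step_approx hg hac hH hA hM hAM hκ
  have hq0 : (0:ℝ) < q := by exact_mod_cast hq
  have hr : ∀ t : ℝ, ∃ r > 0, t ∈ A → r < δ t ∧ r ≤ η / (4 * (q + 1)) ∧ closedBall t r ⊆ G ∧
      ((¬ ∃ k : ℤ, (k:ℝ) = q * t) →
        closedBall t r ⊆ Icc 0 1 ∧ ∀ x ∈ closedBall t r, ⌊q * x⌋ = ⌊q * t⌋) := by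
    intro t
    by_cases ht : t ∈ A
    · obtain ⟨r, hr, h⟩ := exists_grid_radius hq (hA ht) (hδ t (hA ht))
        (show 0 < η / (4 * ((q:ℝ) + 1)) by positivity) hGo (hAG ht)
      exact ⟨r, hr, fun _ => h⟩
    · exact ⟨1, one_pos, fun h => absurd h ht⟩
  choose r hr0 hr using hr
  refine ⟨r, fun t _ => hr0 t, fun θ S hS => ?_⟩
  obtain ⟨a, haM, ha⟩ := hap θ
  set h : ℝ → ℝ := fun x => a ⌊q * x⌋
  have hfl : Measurable h :=
    (measurable_of_countable a).comp (Int.measurable_floor.comp (measurable_const_mul _))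
  have hhi : IntegrableOn h (Icc 0 1) :=
    Integrable.of_bound hfl.aestronglyMeasurable M (by filter_upwards with x using haM _)
  have hdi : IntegrableOn (fun x => |g θ x - h x|) (Icc 0 1) := ((hg θ).sub hhi).abs
  set T := {t ∈ A | (¬ ∃ k : ℤ, (k:ℝ) = q * t) ∧ 2 * s < |g θ t - h t|}
  have hTA : T ⊆ A := sep_subset _ _
  -- the balls around bad tags have small measure
  have hT : volume (⋃ t ∈ T, closedBall t (r t)) ≤ ENNReal.ofReal (η / 2) := by
    set c : ℝ → ℝ := fun t => |gaugeErr (g θ) (t - r t) (t + r t) t| +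
      ∫ x in closedBall t (r t), |g θ x - h x|
    have hTb : ∀ t ∈ T, closedBall t (r t) ⊆ Icc 0 1 := fun t ht => ((hr t (hTA ht)).2.2.2 ht.2.1).1
    have hlow : ∀ t ∈ T, (2 * s) * (2 * r t) ≤ c t := by
      intro t ht
      have hle : t - r t ≤ t + r t := by linarith [hr0 t]
      have hb01 := hTb t ht
      have hconst := ((hr t (hTA ht)).2.2.2 ht.2.1).2
      have e1 : ∫ x in closedBall t (r t), (g θ x - h x) =
          (∫ x in (t - r t)..(t + r t), g θ x) - (2 * r t) * h t := by
        rw [integral_sub ((hg θ).mono_set hb01) (hhi.mono_set hb01),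
          intervalIntegral.integral_of_le hle, ← integral_Icc_eq_integral_Ioc,
          ← Real.closedBall_eq_Icc]
        congr 1
        rw [setIntegral_congr_fun (g := fun _ => h t) measurableSet_closedBall fun x hx => by
          simp only [h]; rw [hconst x hx]]
        simp [Measure.real, (hr0 t).le]
      have e2 := abs_integral_le_integral_abs (f := fun x => g θ x - h x)
        (μ := volume.restrict (closedBall t (r t)))
      rw [e1] at e2
      have e3 : 2 * r t * (g θ t - h t) = gaugeErr (g θ) (t - r t) (t + r t) t +
          ((∫ x in (t - r t)..(t + r t), g θ x) - 2 * r t * h t) := by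
        simp only [gaugeErr]; ring
      have e4 : 2 * r t * |g θ t - h t| ≤ c t := by
        rw [← abs_of_pos (show 0 < 2 * r t by linarith [hr0 t]), ← abs_mul, e3]
        exact (abs_add_le _ _).trans (by simp only [c]; gcongr)
      refine le_trans ?_ e4
      rw [mul_comm]
      have := ht.2.2.le
      have := hr0 t
      gcongr
    refine (volume_iUnion_closedBall_le (R := η / (4 * (q + 1))) (B := κ + κ)
      (show 0 < 2 * s by positivity) (fun t ht => ⟨hr0 t, (hr t (hTA ht)).2.1⟩) hlow
      fun F hF hFd => ?_).trans (ENNReal.ofReal_le_ofReal ?_)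
    · simp only [c]
      rw [Finset.sum_add_distrib]
      refine add_le_add ?_ ?_
      · have := sum_abs_gaugeErr_le (hg θ) hδ (hδε θ) (s := F) (a := fun t => t - r t)
          (b := fun t => t + r t) (t := fun t => t) (fun t ht => ?_) fun i hi j hj hij => ?_
        · exact this.trans (by linarith)
        · have hb := hTb t (hF ht)
          rw [Real.closedBall_eq_Icc] at hb
          have hr0 := hr0 t
          have h1 := hb (left_mem_Icc.2 (by linarith))
          have h2 := hb (right_mem_Icc.2 (by linarith))
          have h3 := (hr t (hTA (hF ht))).1
          refine ⟨h1.1, by linarith, h2.2, ⟨by linarith, by linarith⟩, hA (hTA (hF ht)), ?_⟩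
          exact fun x hx => ⟨by linarith [hx.1], by linarith [hx.2]⟩
        · have := hFd hi hj hij
          simp only [Function.onFun, Real.closedBall_eq_Icc] at this
          exact le_or_le_of_disjoint_Icc (by linarith [hr0 i]) (by linarith [hr0 j]) this
      · rw [← integral_biUnion_finset F (fun t _ => measurableSet_closedBall) hFd
          fun t ht => hdi.mono_set (hTb t (hF ht))]
        refine le_trans ?_ ha
        refine setIntegral_mono_set (hdi.mono_set inter_subset_right) ?_ ?_
        · filter_upwards with x using abs_nonneg _
        · refine LE.le.eventuallyLE (iUnion₂_subset fun t ht => ?_)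
          exact subset_inter (hr t (hTA (hF ht))).2.2.1 (hTb t (hF ht))
    · rw [div_le_iff₀ (by positivity)]
      have := min_le_right (ε / 8) (η * s / 10)
      linarith
  set E₀ := (⋃ t ∈ T, closedBall t (r t)) ∪
    ⋃ t ∈ {t ∈ A | ∃ k : ℤ, (k:ℝ) = q * t}, closedBall t (r t)
  have hE₀ : volume E₀ ≤ ENNReal.ofReal η := by
    refine (measure_union_le _ _).trans
      ((add_le_add hT (volume_grid_le hq hA fun t ht => (hr t ht).2.1)).trans ?_)
    rw [← ENNReal.ofReal_add (by positivity) (by positivity)]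
    refine ENNReal.ofReal_le_ofReal (le_of_eq ?_)
    field_simp
    ring
  set E := toMeasurable volume E₀ ∩ Icc 0 1
  have hEm : MeasurableSet E := (measurableSet_toMeasurable _ _).inter measurableSet_Icc
  have hE : volume E ≤ ENNReal.ofReal η :=
    (measure_mono inter_subset_left).trans ((measure_toMeasurable _).le.trans hE₀)
  set Ψ : ℝ → ℝ := fun x => 2 * s + (G.indicator (fun x => |g θ x - h x|) x +
    E.indicator (fun x => |g θ x| + M) x)
  have hi1 : IntegrableOn (G.indicator fun x => |g θ x - h x|) (Icc 0 1) :=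
    Integrable.indicator hdi hGo.measurableSet
  have hi2' : IntegrableOn (fun x => |g θ x| + M) (Icc 0 1) :=
    Integrable.add (hg θ).abs (integrableOn_const (by simp))
  have hi2 : IntegrableOn (E.indicator fun x => |g θ x| + M) (Icc 0 1) :=
    Integrable.indicator hi2' hEm
  have hi0 : IntegrableOn (fun _ : ℝ => 2 * s) (Icc 0 1) := integrableOn_const (by simp)
  have hi12 : IntegrableOn (fun x => G.indicator (fun x => |g θ x - h x|) x +
      E.indicator (fun x => |g θ x| + M) x) (Icc 0 1) := hi1.add hi2
  have hΨi : IntegrableOn Ψ (Icc 0 1) := hi0.add hi12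
  have hind1 : ∀ x, 0 ≤ G.indicator (fun x => |g θ x - h x|) x :=
    fun x => indicator_nonneg (fun x _ => abs_nonneg _) x
  have hind2 : ∀ x, 0 ≤ E.indicator (fun x => |g θ x| + M) x :=
    fun x => indicator_nonneg (fun x _ => by positivity) x
  have hΨ0 : ∀ x, 0 ≤ Ψ x := fun x => add_nonneg (by positivity) (add_nonneg (hind1 x) (hind2 x))
  have hpw : ∀ t ∈ A, ∀ x ∈ closedBall t (r t) ∩ Icc 0 1, |g θ t - g θ x| ≤ Ψ x := by
    intro t ht x hx
    by_cases hbad : (∃ k : ℤ, (k:ℝ) = q * t) ∨ t ∈ T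
    · have hxE : x ∈ E := by
        refine ⟨subset_toMeasurable _ _ ?_, hx.2⟩
        rcases hbad with hb | hb
        · exact Or.inr (mem_biUnion (show t ∈ {t ∈ A | ∃ k : ℤ, (k:ℝ) = q * t} from ⟨ht, hb⟩) hx.1)
        · exact Or.inl (mem_biUnion hb hx.1)
      have h1 : |g θ t - g θ x| ≤ |g θ x| + M :=
        (abs_sub _ _).trans (by linarith [hAM θ t ht])
      have h2 : Ψ x = 2 * s + (G.indicator (fun x => |g θ x - h x|) x + (|g θ x| + M)) := by
        simp [Ψ, hxE]
      linarith [hind1 x]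
    · push Not at hbad
      obtain ⟨hb1, hb2⟩ := hbad
      have hng : ¬ ∃ k : ℤ, (k:ℝ) = q * t := fun ⟨k, hk⟩ => hb1 k hk
      have hgood : |g θ t - h t| ≤ 2 * s := by
        by_contra hlt
        exact hb2 ⟨ht, hng, not_le.1 hlt⟩
      have hxt : h x = h t := by simp only [h]; rw [((hr t ht).2.2.2 hng).2 x hx.1]
      have hxG : x ∈ G := (hr t ht).2.2.1 hx.1
      have h2 : Ψ x = 2 * s + (|g θ x - h x| + E.indicator (fun x => |g θ x| + M) x) := by
        simp [Ψ, hxG]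
      have h3 : |g θ t - g θ x| ≤ |g θ t - h t| + |g θ x - h x| := by
        rw [hxt, abs_sub_comm (g θ x)]
        exact abs_sub_le _ _ _
      linarith [hind2 x]
  have hmain : |S| ≤ ∫ x in (0:ℝ)..1, Ψ x := by
    have := hS.restrict.abs_le_of_forall_le (ψ := fun y => ∫ x in (0:ℝ)..y, Ψ x)
      fun u v t huv hp => by
        obtain ⟨hp, hu, hv⟩ := hp
        rw [integral_sub_integral_eq hΨi hu huv hv]
        by_cases ht : t ∈ A
        · rw [indicator_of_mem ht]
          have hc : (v - u) * g θ t = ∫ _x in u..v, g θ t := by simp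
          have hgi := IntegrableOn.intervalIntegrable_sub (hg θ) hu huv hv
          simp only [gaugeErr]
          rw [hc, ← intervalIntegral.integral_sub (by simp) hgi]
          refine (intervalIntegral.abs_integral_le_integral_abs huv).trans ?_
          refine intervalIntegral.integral_mono_on huv ?_
            (IntegrableOn.intervalIntegrable_sub hΨi hu huv hv) fun x hx => ?_
          · exact ((by simp : IntervalIntegrable (fun _ => g θ t) volume u v).sub hgi).abs
          · refine hpw t ht x ⟨?_, hu.trans hx.1, hx.2.trans hv⟩
            have := (hp ht).2 hx
            rw [Real.closedBall_eq_Icc]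
            exact Ioo_subset_Icc_self this
        · rw [indicator_of_notMem ht, abs_zero]
          exact intervalIntegral.integral_nonneg huv fun x _ => hΨ0 x
    simpa using this
  refine hmain.trans ?_
  have hsplit : ∫ x in (0:ℝ)..1, Ψ x = 2 * s + ((∫ x in G ∩ Icc 0 1, |g θ x - h x|) +
      ∫ x in E, (|g θ x| + M)) := by
    rw [intervalIntegral.integral_of_le zero_le_one, ← integral_Icc_eq_integral_Ioc]
    simp only [Ψ]
    rw [integral_add hi0 hi12, integral_add hi1 hi2,
      setIntegral_indicator hGo.measurableSet, setIntegral_indicator hEm,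
      inter_comm (Icc 0 1) G, inter_eq_right.2 (inter_subset_right : E ⊆ Icc 0 1)]
    simp [E]
  have hEint : ∫ x in E, (|g θ x| + M) ≤ ε / 8 + ε / 8 := by
    have hEfin : volume E ≠ ∞ := ne_top_of_le_ne_top ENNReal.ofReal_ne_top hE
    have habs : IntegrableOn (fun x => |g θ x|) (Icc 0 1) := (hg θ).abs
    rw [integral_add (habs.mono_set inter_subset_right) (integrableOn_const hEfin)]
    refine add_le_add (hui θ E inter_subset_right hEm
      (hE.trans (ENNReal.ofReal_le_ofReal (min_le_left _ _)))) ?_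
    have h4 : volume.real E ≤ η := ENNReal.toReal_le_of_le_ofReal hη.le hE
    have h5 : η ≤ ε / (8 * M) := min_le_right _ _
    rw [le_div_iff₀ (by positivity)] at h5
    simp
    nlinarith
  have hκε : κ ≤ ε / 8 := min_le_left _ _
  rw [hsplit]
  simp only [s]
  linarith

namespace PSum

/-- Splitting a sum according to a natural-number-valued label of the tags. -/
lemma exists_split {R : ℝ → ℝ → ℝ → Prop} {φ : ℝ → ℝ → ℝ → ℝ} (k : ℝ → ℕ) {a b s : ℝ}
    (h : PSum R φ a b s) :
    ∃ (T : ℕ → ℝ) (N : ℕ),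
      (∀ n, PSum R (fun u v t => {t | k t = n}.indicator (φ u v) t) a b (T n)) ∧
      (∀ n ≥ N, T n = 0) ∧ s = ∑ n ∈ Finset.range N, T n := by
  induction h with
  | nil a => exact ⟨fun _ => 0, 0, fun n => PSum.nil a, fun _ _ => rfl, by simp⟩
  | @cons u v t b s huv hR _ ih =>
    obtain ⟨T, N, h1, h2, h3⟩ := ih
    refine ⟨fun n => {t | k t = n}.indicator (φ u v) t + T n, max N (k t + 1),
      fun n => PSum.cons (φ := fun u v t => {t | k t = n}.indicator (φ u v) t) huv hR (h1 n),
      fun n hn => ?_, ?_⟩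
    · have hk : k t ≠ n := by have := le_trans (le_max_right _ _) hn; omega
      simp [hk, h2 n ((le_max_left _ _).trans hn)]
    · rw [Finset.sum_add_distrib, h3]
      congr 1
      · rw [Finset.sum_eq_single (k t)]
        · simp
        · intro n _ hn
          simp [hn.symm]
        · intro hn
          simp at hn
      · refine Finset.sum_subset (Finset.range_mono (le_max_left _ _)) fun n _ hn => ?_
        exact h2 n (by simpa using hn)

end PSum

/-- **Uniform Fremlin theorem**: a pointwise bounded, uniformly absolutely continuous and uniformly
Henstock integrable family is uniformly McShane integrable. -/
theorem UnifGauge.free_of_perron {Θ : Type*} {g : Θ → ℝ → ℝ}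
    (hg : ∀ θ, IntegrableOn (g θ) (Icc (0:ℝ) 1)) (hac : UnifAbsCont g)
    (hH : UnifGauge PerronPiece g) (hb : ∀ t ∈ Icc (0:ℝ) 1, ∃ M, ∀ θ, |g θ t| ≤ M) :
    UnifGauge FreePiece g := by
  intro ε hε
  have hb' : ∀ t, ∃ M, t ∈ Icc (0:ℝ) 1 → ∀ θ, |g θ t| ≤ M := fun t => by
    by_cases ht : t ∈ Icc (0:ℝ) 1
    · obtain ⟨M, hM⟩ := hb t ht
      exact ⟨M, fun _ => hM⟩
    · exact ⟨0, fun h => absurd h ht⟩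
  choose M hM using hb'
  set k : ℝ → ℕ := fun t => ⌈M t⌉₊
  have hC : ∀ n : ℕ, ∃ δ : ℝ → ℝ, IsGauge δ ∧ ∀ θ S,
      PSum (fun u v t => t ∈ {t ∈ Icc (0:ℝ) 1 | k t = n} → FreePiece δ u v t)
        (fun u v t => {t ∈ Icc (0:ℝ) 1 | k t = n}.indicator (gaugeErr (g θ) u v) t) 0 1 S →
        |S| ≤ ε / 2 * (1 / 2) ^ n := fun n =>
    exists_gauge_of_bounded_on hg hac hH (sep_subset _ _) (M := n + 1) (by positivity)
      (fun θ t ht => (hM t ht.1 θ).trans (by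
        have h1 := Nat.le_ceil (M t)
        have h2 : (k t : ℝ) = n := by exact_mod_cast ht.2
        simp only [k] at h2
        linarith)) (by positivity)
  choose δ hδ hδ' using hC
  refine ⟨fun t => δ (k t) t, fun t ht => hδ _ t ht, fun θ S hS => ?_⟩
  obtain ⟨T, N, h1, -, rfl⟩ := hS.exists_split k
  refine (Finset.abs_sum_le_sum_abs _ _).trans ?_
  have h2 : ∀ n, |T n| ≤ ε / 2 * (1 / 2) ^ n := fun n => by
    refine hδ' n θ (T n) ((h1 n).map (AddMonoidHom.id ℝ) fun u v t huv hp => ⟨t, ?_, ?_⟩)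
    · rintro ⟨-, rfl⟩
      exact hp
    · by_cases hk : k t = n <;> simp [indicator, hk, hp.1.1, hp.1.2]
  calc ∑ n ∈ Finset.range N, |T n| ≤ ∑ n ∈ Finset.range N, ε / 2 * (1 / 2) ^ n :=
        Finset.sum_le_sum fun n _ => h2 n
    _ ≤ ε / 2 * 2 := by
        rw [← Finset.mul_sum]
        gcongr
        exact sum_geometric_two_le N
    _ = ε := by ring

/-- `δ` is a gauge for which all Henstock sums of `g` are within `ε` of `A`. -/
def HKGauge (g : ℝ → ℝ) (A ε : ℝ) (δ : ℝ → ℝ) : Prop :=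
  IsGauge δ ∧ ∀ S, PSum (PerronPiece δ) (fun u v t => (v - u) * g t) 0 1 S → |S - A| ≤ ε

lemma exists_hk_primitive {g : ℝ → ℝ} {A : ℝ} (hg : ∀ ε > 0, ∃ δ, HKGauge g A ε δ) {x : ℝ}
    (hx : x ∈ Icc (0:ℝ) 1) :
    ∃ L : ℝ, ∀ ε δ S, HKGauge g A ε δ →
      PSum (PerronPiece δ) (fun u v t => (v - u) * g t) 0 x S → |S - L| ≤ ε := by
  set φ : ℝ → ℝ → ℝ → ℝ := fun u v t => (v - u) * g t
  have key : ∀ ε δ S ε' δ' S', HKGauge g A ε δ → PSum (PerronPiece δ) φ 0 x S →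
      HKGauge g A ε' δ' → PSum (PerronPiece δ') φ 0 x S' → S - ε ≤ S' + ε' := by
    intro ε δ S ε' δ' S' h hS h' hS'
    obtain ⟨T, hT⟩ := exists_psum_perron φ (h.1.min h'.1) hx.1 hx.2 le_rfl
    have h1 := h.2 _ (hS.append (hT.mono fun u v t _ h => h.1.mono (min_le_left _ _)))
    have h2 := h'.2 _ (hS'.append (hT.mono fun u v t _ h => h.1.mono (min_le_right _ _)))
    rw [abs_le] at h1 h2
    linarith [h1.2, h2.1]
  set Q : Set ℝ := {y | ∃ ε δ S, HKGauge g A ε δ ∧ PSum (PerronPiece δ) φ 0 x S ∧ y = S - ε}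
  have hQ : Q.Nonempty := by
    obtain ⟨δ, hδ⟩ := hg 1 one_pos
    obtain ⟨S, hS⟩ := exists_psum_perron φ hδ.1 le_rfl hx.1 hx.2
    exact ⟨_, 1, δ, S, hδ, hS.mono fun u v t _ h => h.1, rfl⟩
  refine ⟨sSup Q, fun ε δ S h hS => ?_⟩
  have hub : S + ε ∈ upperBounds Q := by
    rintro _ ⟨ε', δ', S', h', hS', rfl⟩
    exact key _ _ _ _ _ _ h' hS' h hS
  have h1 := csSup_le hQ hub
  have h2 : S - ε ≤ sSup Q := le_csSup ⟨_, hub⟩ ⟨ε, δ, S, h, hS, rfl⟩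
  rw [abs_le]
  constructor <;> linarith

/-- The Saks–Henstock lemma for the primitive of a Henstock–Kurzweil integrable function. -/
lemma exists_hk_saks_henstock {g : ℝ → ℝ} {A : ℝ} (hg : ∀ ε > 0, ∃ δ, HKGauge g A ε δ) :
    ∃ F : ℝ → ℝ, ∀ ε > 0, ∃ δ, IsGauge δ ∧ ∀ (s : Finset ℝ) (a b : ℝ → ℝ),
      (∀ t ∈ s, 0 ≤ a t ∧ a t < b t ∧ b t ≤ 1 ∧ PerronPiece δ (a t) (b t) t) →
      (∀ t ∈ s, ∀ t' ∈ s, t ≠ t' → b t ≤ a t' ∨ b t' ≤ a t) →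
      ∑ t ∈ s, |(b t - a t) * g t - (F (b t) - F (a t))| ≤ ε := by
  set φ : ℝ → ℝ → ℝ → ℝ := fun u v t => (v - u) * g t
  choose! F hF using fun x (hx : x ∈ Icc (0:ℝ) 1) => exists_hk_primitive hg hx
  refine ⟨F, fun ε hε => ?_⟩
  obtain ⟨δ, hδ⟩ := hg (ε / 4) (by positivity)
  refine ⟨δ, hδ.1, fun s a b hs hd => ?_⟩
  have := sum_abs_le_of_psum (R := PerronPiece δ) (φ := fun u v t => φ u v t - (F v - F u))
    (ε := ε / 2) (a := a) (b := b) (t := fun t => t) (s := s) ?_ ?_ hs hd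
  · linarith
  · intro ρ hρ u v hu huv hv
    obtain ⟨δ', hδ'⟩ := hg (ρ / 2) (by positivity)
    obtain ⟨T, hT⟩ := exists_psum_perron φ (hδ.1.min hδ'.1) le_rfl hu (huv.trans hv)
    obtain ⟨T', hT'⟩ := exists_psum_perron φ (hδ.1.min hδ'.1) hu huv hv
    refine ⟨_, (hT'.mono fun u v t _ h => h.1.mono (min_le_left _ _)).sub_increment F, ?_⟩
    have h0 := hT.mono (R' := PerronPiece δ') fun u v t _ h => h.1.mono (min_le_right _ _)
    have h1 := hF u ⟨hu, huv.trans hv⟩ _ _ _ hδ' h0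
    have h2 := hF v ⟨hu.trans huv, hv⟩ _ _ _ hδ'
      (h0.append (hT'.mono fun u v t _ h => h.1.mono (min_le_right _ _)))
    rw [abs_le] at *
    constructor <;> linarith [h1.1, h1.2, h2.1, h2.2]
  · intro S hS
    have h1 := hF 1 ⟨zero_le_one, le_rfl⟩ _ _ _ hδ hS.add_increment
    have h2 := hF 0 ⟨le_rfl, zero_le_one⟩ _ _ _ hδ (PSum.nil 0)
    rw [abs_le] at *
    constructor <;> linarith [h1.1, h1.2, h2.1, h2.2]

/-- Henstock–Kurzweil integrable functions are measurable. -/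
theorem aemeasurable_of_hkGauge {g : ℝ → ℝ} {A : ℝ} (hg : ∀ ε > 0, ∃ δ, HKGauge g A ε δ) :
    AEMeasurable g (volume.restrict (Icc (0:ℝ) 1)) := by
  obtain ⟨F, hF⟩ := exists_hk_saks_henstock hg
  have hFc : ContinuousOn F (Icc 0 1) := by
    intro x hx
    rw [Metric.continuousWithinAt_iff]
    intro ε hε
    obtain ⟨δ, hδ, H⟩ := hF (ε / 2) (by positivity)
    have hlim : Filter.Tendsto (fun y => |y - x| * |g x|) (nhds x) (nhds 0) := by
      have : Continuous fun y => |y - x| * |g x| := by fun_prop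
      simpa using this.tendsto x
    obtain ⟨d, hd, hd'⟩ := Metric.eventually_nhds_iff.1
      (hlim.eventually (gt_mem_nhds (half_pos hε)))
    refine ⟨min d (δ x), lt_min hd (hδ x hx), fun y hy hyx => ?_⟩
    have h1 := hd' (hyx.trans_le (min_le_left _ _))
    have h2 : |y - x| < δ x := by
      rw [← Real.dist_eq]; exact hyx.trans_le (min_le_right _ _)
    rw [Real.dist_eq]
    have hδx := hδ x hx
    rcases lt_trichotomy x y with h | h | h
    · have := H {x} (fun _ => x) (fun _ => y) (by
        simp only [Finset.mem_singleton, forall_eq]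
        refine ⟨hx.1, h, hy.2, ⟨le_rfl, h.le⟩, hx, fun z hz => ⟨?_, ?_⟩⟩
        · linarith [hz.1]
        · linarith [hz.2, le_abs_self (y - x)]) (by simp)
      rw [Finset.sum_singleton] at this
      have h3 := abs_sub_abs_le_abs_sub (F y - F x) ((y - x) * g x)
      rw [abs_sub_comm (F y - F x), abs_mul] at h3
      linarith
    · simpa [h] using hε
    · have := H {x} (fun _ => y) (fun _ => x) (by
        simp only [Finset.mem_singleton, forall_eq]
        refine ⟨hy.1, h, hx.2, ⟨h.le, le_rfl⟩, hx, fun z hz => ⟨?_, ?_⟩⟩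
        · linarith [hz.1, neg_abs_le (y - x)]
        · linarith [hz.2]) (by simp)
      rw [Finset.sum_singleton] at this
      have h3 := abs_sub_abs_le_abs_sub (F x - F y) ((x - y) * g x)
      rw [abs_sub_comm (F x - F y), abs_mul, abs_sub_comm x y, abs_sub_comm (F x)] at h3
      linarith
  set Fe := IccExtend (zero_le_one' ℝ) ((Icc (0:ℝ) 1).domRestrict F)
  have hFe : Continuous Fe := (continuousOn_iff_continuous_domRestrict.1 hFc).Icc_extend'
  have hFeq : ∀ x ∈ Icc (0:ℝ) 1, Fe x = F x := fun x hx => IccExtend_of_mem _ _ hx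
  set r : ℕ → ℝ := fun n => 1 / ((n:ℝ) + 1)
  have hr0 : ∀ n, 0 < r n := fun n => by positivity
  have hr : Filter.Tendsto r Filter.atTop (nhds 0) := tendsto_one_div_add_atTop_nhds_zero_nat
  set D : ℕ → ℝ → ℝ := fun n t => (Fe (t + r n) - Fe (t - r n)) / (2 * r n)
  set T : ℝ → Set ℝ := fun s => {t ∈ Ioo (0:ℝ) 1 | ∃ᶠ n in Filter.atTop, s ≤ |D n t - g t|}
  have hT : ∀ s > 0, volume (T s) = 0 := by
    intro s hs
    have hle : ∀ ε > 0, volume (T s) ≤ ENNReal.ofReal (5 * ε / s) := by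
      intro ε hε
      obtain ⟨δ, hδ, H⟩ := hF ε hε
      have hn : ∀ t : ℝ, ∃ n, t ∈ T s →
          s ≤ |D n t - g t| ∧ r n < δ t ∧ 0 ≤ t - r n ∧ t + r n ≤ 1 := by
        intro t
        by_cases ht : t ∈ T s
        · have hlt : 0 < min (δ t) (min t (1 - t)) :=
            lt_min (hδ t (Ioo_subset_Icc_self ht.1)) (lt_min ht.1.1 (sub_pos.2 ht.1.2))
          obtain ⟨n, hn1, hn2⟩ := (ht.2.and_eventually (hr.eventually (gt_mem_nhds hlt))).exists
          rw [lt_min_iff, lt_min_iff] at hn2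
          exact ⟨n, fun _ => ⟨hn1, hn2.1, by linarith [hn2.2.1], by linarith [hn2.2.2]⟩⟩
        · exact ⟨0, fun h => absurd h ht⟩
      choose n hn using hn
      refine (measure_mono fun t ht => mem_iUnion₂.2 ⟨t, ht, mem_closedBall_self
        (hr0 (n t)).le⟩).trans (volume_iUnion_closedBall_le (T := T s) (r := fun t => r (n t))
        (c := fun t => |(t + r (n t) - (t - r (n t))) * g t - (F (t + r (n t)) - F (t - r (n t)))|)
        (R := 1) hs (fun t _ => ⟨hr0 _, ?_⟩) (fun t ht => ?_) fun s' hs' hd => ?_)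
      · rw [div_le_one (by positivity)]
        simp
      · obtain ⟨h1, h2, h3, h4⟩ := hn t ht
        have hp := hr0 (n t)
        have h5 : t + r (n t) ∈ Icc (0:ℝ) 1 := ⟨by linarith, h4⟩
        have h6 : t - r (n t) ∈ Icc (0:ℝ) 1 := ⟨h3, by linarith⟩
        rw [← hFeq _ h5, ← hFeq _ h6]
        have : (t + r (n t) - (t - r (n t))) * g t - (Fe (t + r (n t)) - Fe (t - r (n t))) =
            -((D (n t) t - g t) * (2 * r (n t))) := by
          simp only [D]
          field_simp
          ring
        rw [this, abs_neg, abs_mul, abs_of_pos (by positivity : 0 < 2 * r (n t))]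
        exact mul_le_mul_of_nonneg_right h1 (by positivity)
      · refine H s' (fun t => t - r (n t)) (fun t => t + r (n t)) (fun t ht => ?_) ?_
        · obtain ⟨h1, h2, h3, h4⟩ := hn t (hs' ht)
          have hp := hr0 (n t)
          refine ⟨h3, by linarith, h4, ⟨by linarith, by linarith⟩,
            Ioo_subset_Icc_self (hs' ht).1, fun z hz => ⟨by linarith [hz.1], by linarith [hz.2]⟩⟩
        · intro t ht t' ht' hne
          have := hd ht ht' hne
          simp only [Function.onFun, Real.closedBall_eq_Icc] at this
          exact le_or_le_of_disjoint_Icc (by linarith [hr0 (n t)]) (by linarith [hr0 (n t')]) this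
    refine le_antisymm (ENNReal.le_of_forall_pos_le_add fun ε hε _ => ?_) zero_le
    have hε' : (0:ℝ) < ε := hε
    refine (hle (ε * s / 5) (by positivity)).trans (le_of_eq ?_)
    rw [zero_add, show 5 * (ε * s / 5) / s = (ε:ℝ) by field_simp, ENNReal.ofReal_coe_nnreal]
  have hnull : volume (⋃ k : ℕ, T (r k)) = 0 := measure_iUnion_null fun k => hT _ (hr0 k)
  refine aemeasurable_of_tendsto_metrizable_ae Filter.atTop (f := D) (fun n => ?_) ?_
  · exact (by fun_prop : Continuous (D n)).measurable.aemeasurable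
  · rw [← Measure.restrict_congr_set (Ioo_ae_eq_Icc (a := (0:ℝ)) (b := 1) (μ := volume)),
      ae_restrict_iff' measurableSet_Ioo]
    filter_upwards [measure_eq_zero_iff_ae_notMem.1 hnull] with t ht ht01
    rw [Metric.tendsto_nhds]
    intro ε hε
    obtain ⟨k, hk⟩ := (hr.eventually (gt_mem_nhds hε)).exists
    have : t ∉ T (r k) := fun h => ht (mem_iUnion.2 ⟨k, h⟩)
    have h2 : ¬ ∃ᶠ n in Filter.atTop, r k ≤ |D n t - g t| := fun h => this ⟨ht01, h⟩
    rw [Filter.not_frequently] at h2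
    filter_upwards [h2] with n hn
    rw [Real.dist_eq]
    exact (not_le.1 hn).trans hk

/-! ### Approximation of McShane integrable families by simple reparametrizations -/

namespace PSum

variable {M N : Type*} [AddCommMonoid M] [AddCommMonoid N] {R : ℝ → ℝ → ℝ → Prop}
  {φ : ℝ → ℝ → ℝ → M}

lemma exists_of_forall_piece {Q : ℝ → ℝ → N → Prop} (hnil : ∀ a, Q a a 0)
    (happ : ∀ a b c s s', Q a b s → Q b c s' → Q a c (s + s'))
    (hQ : ∀ u v t, u ≤ v → R u v t → ∃ s, Q u v s) {a b : ℝ} {s : M} (h : PSum R φ a b s) :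
    ∃ s, Q a b s := by
  induction h with
  | nil a => exact ⟨0, hnil a⟩
  | cons huv hR _ ih =>
    obtain ⟨s', hs'⟩ := ih
    obtain ⟨s, hs⟩ := hQ _ _ _ huv hR
    exact ⟨_, happ _ _ _ _ _ hs hs'⟩

/-- The simple function taking on the interior of each piece the value of its tag. -/
lemma exists_simpleFunc (hR : ∀ u v t, R u v t → t ∈ Icc (0:ℝ) 1) {a b : ℝ} {s : M}
    (h : PSum R φ a b s) :
    ∃ (τ : SimpleFunc ℝ ℝ) (Z : Set ℝ), (∀ x, τ x ∈ Icc (0:ℝ) 1) ∧ Z.Finite ∧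
      PSum (fun u v t => R u v t ∧ u ∈ Z ∧ v ∈ Z ∧ ∀ x ∈ Ioo u v, τ x = t) φ a b s := by
  induction h with
  | nil a =>
    exact ⟨SimpleFunc.const ℝ 0, ∅, fun _ => ⟨le_rfl, zero_le_one⟩, finite_empty, PSum.nil a⟩
  | @cons u v t b s huv hp _ ih =>
    obtain ⟨τ, Z, hτ, hZ, h⟩ := ih
    refine ⟨SimpleFunc.piecewise (Iio v) measurableSet_Iio (SimpleFunc.const ℝ t) τ,
      insert u (insert v Z), fun x => ?_, (hZ.insert v).insert u,
      PSum.cons huv ⟨hp, by simp, by simp, ?_⟩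
        (h.restrict.mono ?_)⟩
    · by_cases hx : x < v
      · simpa [SimpleFunc.coe_piecewise, Set.piecewise, hx] using hR _ _ _ hp
      · simpa [SimpleFunc.coe_piecewise, Set.piecewise, hx] using hτ x
    · intro x hx
      simp [SimpleFunc.coe_piecewise, Set.piecewise, hx.2]
    · rintro u' v' t' - ⟨⟨h1, h2, h3, h4⟩, h5, -⟩
      refine ⟨h1, by simp [h2], by simp [h3], fun x hx => ?_⟩
      simp [SimpleFunc.coe_piecewise, Set.piecewise, h5.trans hx.1.le, h4 x hx]

end PSum

/-- The family `g` is uniformly McShane integrable. -/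
def UnifMcShane {Θ : Type*} (g : Θ → ℝ → ℝ) : Prop :=
  ∃ A : Θ → ℝ, ∀ ε > 0, ∃ δ : ℝ → ℝ, IsGauge δ ∧ ∀ θ S,
    PSum (FreePiece δ) (fun u v t => (v - u) * g θ t) 0 1 S → |S - A θ| ≤ ε

theorem UnifMcShane.exists_simpleFunc {Θ : Type*} {g : Θ → ℝ → ℝ} (h : UnifMcShane g)
    (hm : ∀ θ, AEMeasurable (g θ) (volume.restrict (Icc (0:ℝ) 1))) {ε : ℝ} (hε : 0 < ε) :
    ∃ τ : SimpleFunc ℝ ℝ, (∀ x, τ x ∈ Icc (0:ℝ) 1) ∧ ∀ θ, IntegrableOn (g θ) (Icc (0:ℝ) 1) ∧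
      IntegrableOn (fun x => g θ (τ x)) (Icc (0:ℝ) 1) ∧
      ∫ x in Icc (0:ℝ) 1, |g θ x - g θ (τ x)| ≤ ε := by
  classical
  obtain ⟨A, hA⟩ := h
  obtain ⟨δ, hδ, H⟩ := hA (ε / 2) (by positivity)
  obtain ⟨s₀, hs₀⟩ := exists_psum_perron (fun _ _ _ => (0:ℝ)) hδ le_rfl zero_le_one le_rfl
  obtain ⟨τ, Z, hτ01, hZ, hs₀⟩ := hs₀.exists_simpleFunc fun u v t h => h.1.2.1
  replace hs₀ := hs₀.restrict
  refine ⟨τ, hτ01, fun θ => ?_⟩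
  set h : ℝ → ℝ := Zᶜ.indicator fun x => |g θ x - g θ (τ x)|
  have hτ : IntegrableOn (fun x => g θ (τ x)) (Icc (0:ℝ) 1) :=
    (τ.map (g θ)).integrable_of_isFiniteMeasure
  have hgm : AEMeasurable (fun x => g θ x - g θ (τ x)) (volume.restrict (Icc (0:ℝ) 1)) :=
    (hm θ).sub hτ.aestronglyMeasurable.aemeasurable
  have hhm : AEMeasurable h (volume.restrict (Icc (0:ℝ) 1)) :=
    (continuous_abs.measurable.comp_aemeasurable hgm).indicator hZ.measurableSet.compl
  have hh0 : ∀ x, 0 ≤ h x := fun x => indicator_nonneg (fun _ _ => abs_nonneg _) x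
  have hN := integrableOn_of_psum_le (h := h) (B := ε) le_rfl zero_le_one le_rfl
    (fun t _ => hh0 t) hhm ?_
  · have hae : h =ᵐ[volume.restrict (Icc (0:ℝ) 1)] fun x => |g θ x - g θ (τ x)| := by
      refine ae_restrict_of_ae ?_
      filter_upwards [measure_eq_zero_iff_ae_notMem.1 (hZ.measure_zero volume)] with x hx
      exact indicator_of_mem (show x ∈ Zᶜ from hx) _
    have hi : IntegrableOn (fun x => g θ x - g θ (τ x)) (Icc (0:ℝ) 1) :=
      (integrable_norm_iff hgm.aestronglyMeasurable).1 (hN.1.congr hae)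
    refine ⟨?_, hτ, ?_⟩
    · have := hi.add hτ
      refine this.congr (Filter.Eventually.of_forall fun x => ?_)
      simp
    · rw [← integral_congr_ae hae]
      exact hN.2
  · intro δ' hδ'
    have hex := hs₀.exists_of_forall_piece (N := ℝ × ℝ)
      (Q := fun u v S => PSum (FreePiece δ) (fun u v t => (v - u) * g θ t) u v S.1 ∧
        PSum (FreePiece δ) (fun u v t => (v - u) * g θ t) u v S.2 ∧
        PSum (FreePiece δ') (fun u v t => (v - u) * h t) u v (S.1 - S.2))
      (fun a => ⟨PSum.nil a, PSum.nil a, by simpa using PSum.nil a⟩)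
      (fun a b c s s' hs hs' => ⟨hs.1.append hs'.1, hs.2.1.append hs'.2.1, by
        have := hs.2.2.append hs'.2.2
        rwa [sub_add_sub_comm] at this⟩) ?_
    · obtain ⟨S, h1, h2, h3⟩ := hex
      refine ⟨_, h3, ?_⟩
      have h1 := H _ _ h1
      have h2 := H _ _ h2
      rw [abs_le] at h1 h2
      linarith [h1.2, h2.1]
    · rintro p q s hpq ⟨⟨⟨⟨-, hsI⟩, -⟩, hpZ, hqZ, hτs⟩, hp0, hq1⟩
      set up : ℝ → ℝ := fun t => if t ∉ Z ∧ g θ s ≤ g θ t then t else s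
      set lo : ℝ → ℝ := fun t => if t ∉ Z ∧ ¬ g θ s ≤ g θ t then t else s
      obtain ⟨S, hS⟩ := exists_psum_perron
        (fun u v t => ((v - u) * g θ (up t), (v - u) * g θ (lo t))) (hδ.min hδ') hp0 hpq hq1
      have hs : ∀ u v t, PerronPiece (fun t => min (δ t) (δ' t)) u v t ∧ p ≤ u ∧ v ≤ q →
          FreePiece δ u v s := fun u v t h =>
        ⟨hsI.1, (Icc_subset_Icc h.2.1 h.2.2).trans hsI.2⟩
      have ht : ∀ u v t, PerronPiece (fun t => min (δ t) (δ' t)) u v t ∧ p ≤ u ∧ v ≤ q →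
          FreePiece δ u v t := fun u v t h => h.1.2.mono (min_le_left _ _)
      refine ⟨S, hS.map (AddMonoidHom.fst ℝ ℝ) fun u v t _ h => ⟨up t, ?_, rfl⟩,
        hS.map (AddMonoidHom.snd ℝ ℝ) fun u v t _ h => ⟨lo t, ?_, rfl⟩,
        hS.map (AddMonoidHom.fst ℝ ℝ - AddMonoidHom.snd ℝ ℝ) fun u v t _ hp =>
          ⟨t, hp.1.2.mono (min_le_right _ _), ?_⟩⟩
      · simp only [up]
        split_ifs
        exacts [ht _ _ _ h, hs _ _ _ h]
      · simp only [lo]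
        split_ifs
        exacts [ht _ _ _ h, hs _ _ _ h]
      · simp only [AddMonoidHom.sub_apply, AddMonoidHom.coe_fst, AddMonoidHom.coe_snd, up, lo, h]
        by_cases htZ : t ∈ Z
        · simp [htZ]
        · have h1 : p < t := lt_of_le_of_ne (hp.2.1.trans hp.1.1.1) fun h => htZ (h ▸ hpZ)
          have h2 : t < q := lt_of_le_of_ne (hp.1.1.2.trans hp.2.2) fun h => htZ (h ▸ hqZ)
          rw [indicator_of_mem (show t ∈ Zᶜ from htZ), hτs t ⟨h1, h2⟩]
          by_cases hle : g θ s ≤ g θ t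
          · simp [htZ, hle, abs_of_nonneg (sub_nonneg.2 hle)]
            ring
          · simp [htZ, hle, abs_of_neg (sub_neg.2 (not_le.1 hle))]
            ring

lemma UnifMcShane.unifAbsCont {Θ : Type*} {g : Θ → ℝ → ℝ} (h : UnifMcShane g)
    (hm : ∀ θ, AEMeasurable (g θ) (volume.restrict (Icc (0:ℝ) 1)))
    (hb : ∀ t ∈ Icc (0:ℝ) 1, ∃ M, ∀ θ, |g θ t| ≤ M) : UnifAbsCont g := by
  intro ε hε
  obtain ⟨τ, hτ01, hτ⟩ := h.exists_simpleFunc hm (half_pos hε)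
  choose! M hM using hb
  obtain ⟨C, hC⟩ := (τ.finite_range.image M).bddAbove
  have hC' : ∀ θ x, |g θ (τ x)| ≤ max C 1 := fun θ x =>
    (hM _ (hτ01 x) θ).trans ((hC ⟨_, ⟨x, rfl⟩, rfl⟩).trans (le_max_left _ _))
  have hC0 : 0 < max C 1 := lt_max_of_lt_right one_pos
  refine ⟨ε / 2 / max C 1, by positivity, fun θ E hE hEm hEv => ?_⟩
  obtain ⟨h1, h2, h3⟩ := hτ θ
  have hEfin : volume E ≠ ∞ := ne_top_of_le_ne_top ENNReal.ofReal_ne_top hEv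
  have hi1 : IntegrableOn (fun x => |g θ x - g θ (τ x)|) (Icc (0:ℝ) 1) := (h1.sub h2).abs
  have hi2 : IntegrableOn (fun _ => max C 1) E := integrableOn_const hEfin
  calc ∫ x in E, |g θ x| ≤ ∫ x in E, (|g θ x - g θ (τ x)| + max C 1) := by
        refine integral_mono (h1.mono_set hE).abs ((hi1.mono_set hE).add hi2) fun x => ?_
        have := abs_add_le (g θ x - g θ (τ x)) (g θ (τ x))
        rw [sub_add_cancel] at this
        exact this.trans (add_le_add_right (hC' θ x) _)
    _ = (∫ x in E, |g θ x - g θ (τ x)|) + volume.real E * max C 1 := by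
        rw [integral_add (hi1.mono_set hE) hi2]
        simp
    _ ≤ ε / 2 + ε / 2 / max C 1 * max C 1 := by
        refine add_le_add ?_ (mul_le_mul_of_nonneg_right ?_ hC0.le)
        · exact (setIntegral_mono_set hi1 (Filter.Eventually.of_forall fun x => abs_nonneg _)
            hE.eventuallyLE).trans h3
        · exact ENNReal.toReal_le_of_le_ofReal (by positivity) hEv
    _ = ε := by field_simp; ring

/-! ### Convex weakly compact sets and support functions -/

namespace IsCWK

variable {K A B : Set X}

lemma nonempty (h : IsCWK X K) : K.Nonempty := h.1

lemma convex (h : IsCWK X K) : Convex ℝ K := h.2.1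

lemma isCompact (h : IsCWK X K) : IsCompact (toWeakSpace ℝ X '' K) := h.2.2

lemma exists_isMaxOn (h : IsCWK X K) (x' : X →L[ℝ] ℝ) : ∃ x ∈ K, ∀ y ∈ K, x' y ≤ x' x := by
  have hc : Continuous fun x : WeakSpace ℝ X => x' ((toWeakSpace ℝ X).symm x) :=
    WeakBilin.eval_continuous _ x'
  obtain ⟨_, ⟨x, hx, rfl⟩, hmax⟩ :=
    h.isCompact.exists_isMaxOn (h.nonempty.image _) hc.continuousOn
  exact ⟨x, hx, fun y hy => by simpa using hmax (mem_image_of_mem _ hy)⟩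

lemma exists_eq_suppFn (h : IsCWK X K) (x' : X →L[ℝ] ℝ) : ∃ x ∈ K, x' x = suppFn x' K := by
  obtain ⟨x, hx, hmax⟩ := h.exists_isMaxOn x'
  refine ⟨x, hx, ((IsGreatest.csSup_eq ⟨mem_image_of_mem _ hx, ?_⟩ : suppFn x' K = x' x)).symm⟩
  rintro _ ⟨y, hy, rfl⟩
  exact hmax y hy

lemma le_suppFn (h : IsCWK X K) (x' : X →L[ℝ] ℝ) {x : X} (hx : x ∈ K) : x' x ≤ suppFn x' K := by
  obtain ⟨y, -, hmax⟩ := h.exists_isMaxOn x'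
  refine le_csSup ⟨x' y, ?_⟩ (mem_image_of_mem _ hx)
  rintro _ ⟨z, hz, rfl⟩
  exact hmax z hz

lemma suppFn_le_iff (h : IsCWK X K) {x' : X →L[ℝ] ℝ} {c : ℝ} :
    suppFn x' K ≤ c ↔ ∀ x ∈ K, x' x ≤ c := by
  refine ⟨fun hc x hx => (h.le_suppFn x' hx).trans hc, fun hc => ?_⟩
  obtain ⟨x, hx, he⟩ := h.exists_eq_suppFn x'
  exact he ▸ hc x hx

lemma exists_norm_le (h : IsCWK X K) : ∃ C, ∀ x ∈ K, ‖x‖ ≤ C := by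
  obtain ⟨C, hC⟩ := banach_steinhaus (𝕜 := ℝ) (𝕜₂ := ℝ)
    (g := fun x : K => NormedSpace.inclusionInDoubleDual ℝ X x) fun x' => by
      refine ⟨max (suppFn x' K) (suppFn (-x') K), fun x => ?_⟩
      have h1 := h.le_suppFn x' x.2
      have h2 := h.le_suppFn (-x') x.2
      simp only [NormedSpace.dual_def, Real.norm_eq_abs]
      rw [neg_apply] at h2
      exact abs_le.2 ⟨by linarith [le_max_right (suppFn x' K) (suppFn (-x') K)],
        h1.trans (le_max_left _ _)⟩
  refine ⟨C, fun x hx => ?_⟩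
  exact ((NormedSpace.inclusionInDoubleDualLi ℝ).norm_map x).symm.trans_le (hC ⟨x, hx⟩)

lemma isBounded (h : IsCWK X K) : Bornology.IsBounded K := by
  obtain ⟨C, hC⟩ := h.exists_norm_le
  exact isBounded_iff_forall_norm_le.2 ⟨C, hC⟩

lemma isClosed (h : IsCWK X K) : IsClosed K := by
  have := h.isCompact.isClosed.preimage (toWeakSpaceCLM ℝ X).continuous
  convert this using 1
  exact ((toWeakSpace ℝ X).injective.preimage_image K).symm

lemma of_subset (h : IsCWK X K) (hA : A.Nonempty) (hAc : Convex ℝ A)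
    (hcl : IsClosed A) (hAK : A ⊆ K) : IsCWK X A := by
  refine ⟨hA, hAc, h.isCompact.of_isClosed_subset ?_ (image_mono hAK)⟩
  have := hAc.toWeakSpace_closure ℝ
  rw [hcl.closure_eq] at this
  exact closure_eq_iff_isClosed.1 this.symm

lemma singleton (x : X) : IsCWK X {x} :=
  ⟨singleton_nonempty x, convex_singleton x, by simp⟩

lemma zero : IsCWK X (0 : Set X) := singleton 0

lemma add (hA : IsCWK X A) (hB : IsCWK X B) : IsCWK X (A + B) := by
  refine ⟨hA.nonempty.add hB.nonempty, hA.convex.add hB.convex, ?_⟩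
  rw [image_add]
  exact hA.isCompact.add hB.isCompact

lemma smul (hA : IsCWK X A) (c : ℝ) : IsCWK X (c • A) := by
  refine ⟨hA.nonempty.smul_set, hA.convex.smul c, ?_⟩
  rw [image_smul_set]
  exact hA.isCompact.smul c

lemma sum {ι : Type*} (s : Finset ι) {A : ι → Set X} (hA : ∀ i ∈ s, IsCWK X (A i)) :
    IsCWK X (∑ i ∈ s, A i) :=
  Finset.sum_induction A (IsCWK X) (fun _ _ => add) zero hA

lemma suppFn_add (hA : IsCWK X A) (hB : IsCWK X B) (x' : X →L[ℝ] ℝ) :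
    suppFn x' (A + B) = suppFn x' A + suppFn x' B := by
  refine le_antisymm ((hA.add hB).suppFn_le_iff.2 ?_) ?_
  · rintro _ ⟨a, ha, b, hb, rfl⟩
    rw [map_add]
    exact add_le_add (hA.le_suppFn x' ha) (hB.le_suppFn x' hb)
  · obtain ⟨a, ha, h1⟩ := hA.exists_eq_suppFn x'
    obtain ⟨b, hb, h2⟩ := hB.exists_eq_suppFn x'
    rw [← h1, ← h2, ← map_add]
    exact (hA.add hB).le_suppFn x' (add_mem_add ha hb)

lemma suppFn_smul (hA : IsCWK X A) {c : ℝ} (hc : 0 ≤ c) (x' : X →L[ℝ] ℝ) :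
    suppFn x' (c • A) = c * suppFn x' A := by
  refine le_antisymm ((hA.smul c).suppFn_le_iff.2 ?_) ?_
  · rintro _ ⟨a, ha, rfl⟩
    simpa using mul_le_mul_of_nonneg_left (hA.le_suppFn x' ha) hc
  · obtain ⟨a, ha, h1⟩ := hA.exists_eq_suppFn x'
    rw [← h1, ← smul_eq_mul, ← map_smul]
    exact (hA.smul c).le_suppFn x' (smul_mem_smul_set ha)

lemma _root_.GaugePaper.suppFn_singleton (x' : X →L[ℝ] ℝ) (x : X) : suppFn x' {x} = x' x := by
  simp [suppFn]

lemma suppFn_sum {ι : Type*} (s : Finset ι) {A : ι → Set X} (hA : ∀ i ∈ s, IsCWK X (A i))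
    (x' : X →L[ℝ] ℝ) : suppFn x' (∑ i ∈ s, A i) = ∑ i ∈ s, suppFn x' (A i) := by
  classical
  induction s using Finset.induction_on with
  | empty =>
    rw [Finset.sum_empty, Finset.sum_empty, ← singleton_zero, suppFn_singleton, map_zero]
  | insert i s hi ih =>
    rw [Finset.sum_insert hi, Finset.sum_insert hi, suppFn_add (hA i (by simp))
      (sum s fun j hj => hA j (by simp [hj])), ih fun j hj => hA j (by simp [hj])]

lemma suppFn_functional_smul (hA : IsCWK X A) {c : ℝ} (hc : 0 ≤ c) (x' : X →L[ℝ] ℝ) :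
    suppFn (c • x') A = c * suppFn x' A := by
  refine le_antisymm (hA.suppFn_le_iff.2 fun a ha => ?_) ?_
  · simpa using mul_le_mul_of_nonneg_left (hA.le_suppFn x' ha) hc
  · obtain ⟨a, ha, h1⟩ := hA.exists_eq_suppFn x'
    rw [← h1]
    simpa using hA.le_suppFn (c • x') ha

lemma suppFn_functional_add (hA : IsCWK X A) (x' y' : X →L[ℝ] ℝ) :
    suppFn (x' + y') A ≤ suppFn x' A + suppFn y' A :=
  hA.suppFn_le_iff.2 fun _ ha => add_le_add (hA.le_suppFn x' ha) (hA.le_suppFn y' ha)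

lemma abs_suppFn_le (hA : IsCWK X A) {C : ℝ} (hC : ∀ x ∈ A, ‖x‖ ≤ C) (x' : X →L[ℝ] ℝ) :
    |suppFn x' A| ≤ ‖x'‖ * C := by
  obtain ⟨a, ha, h1⟩ := hA.exists_eq_suppFn x'
  rw [← h1]
  exact (x'.le_opNorm a).trans (mul_le_mul_of_nonneg_left (hC a ha) (norm_nonneg _))

lemma hausdorffEDist_ne_top (hA : IsCWK X A) (hB : IsCWK X B) : hausdorffEDist A B ≠ ⊤ :=
  hausdorffEDist_ne_top_of_nonempty_of_bounded hA.nonempty hB.nonempty hA.isBounded hB.isBounded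

lemma suppFn_le_add_hausdorffDist (hA : IsCWK X A) (hB : IsCWK X B) (x' : X →L[ℝ] ℝ) :
    suppFn x' A ≤ suppFn x' B + ‖x'‖ * hausdorffDist A B := by
  obtain ⟨a, ha, h1⟩ := hA.exists_eq_suppFn x'
  rw [← h1]
  have key : ∀ ε > 0, x' a ≤ suppFn x' B + ‖x'‖ * (hausdorffDist A B + ε) := by
    intro ε hε
    obtain ⟨b, hb, hab⟩ := exists_dist_lt_of_hausdorffDist_lt ha (lt_add_of_pos_right _ hε)
      (hA.hausdorffEDist_ne_top hB)
    have h2 := hB.le_suppFn x' hb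
    have h3 := (le_abs_self _).trans (x'.le_opNorm (a - b))
    rw [map_sub, ← dist_eq_norm] at h3
    have h4 := mul_le_mul_of_nonneg_left hab.le (norm_nonneg x')
    linarith
  refine le_of_forall_pos_le_add fun ε hε => ?_
  have := key (ε / (‖x'‖ + 1)) (by positivity)
  have h5 : ‖x'‖ * (ε / (‖x'‖ + 1)) ≤ ε := by
    rw [mul_div_assoc', div_le_iff₀ (by positivity)]
    nlinarith [norm_nonneg x']
  linarith

lemma abs_suppFn_sub_le (hA : IsCWK X A) (hB : IsCWK X B) (x' : X →L[ℝ] ℝ) :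
    |suppFn x' A - suppFn x' B| ≤ ‖x'‖ * hausdorffDist A B := by
  have h1 := hA.suppFn_le_add_hausdorffDist hB x'
  have h2 := hB.suppFn_le_add_hausdorffDist hA x'
  rw [hausdorffDist_comm] at h2
  rw [abs_le]
  constructor <;> linarith

lemma infDist_le (hA : IsCWK X A) (hB : IsCWK X B) {r : ℝ} (hr : 0 ≤ r)
    (h : ∀ x' : X →L[ℝ] ℝ, suppFn x' A ≤ suppFn x' B + r * ‖x'‖) {x : X} (hx : x ∈ A) :
    infDist x B ≤ r := by
  by_contra! hlt
  obtain ⟨ρ, hrρ, hρ⟩ := exists_between hlt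
  have hρ0 : 0 < ρ := hr.trans_lt hrρ
  obtain ⟨f, u, h1, h2⟩ := geometric_hahn_banach_open (convex_ball x (infDist x B)) isOpen_ball
    hB.convex (disjoint_ball_infDist)
  have hf : ‖f‖ ≤ (u - f x) / ρ := by
    refine f.opNorm_bound_of_ball_bound hρ0 _ fun z hz => ?_
    rw [mem_closedBall_zero_iff] at hz
    have h3 := h1 (x + z) (by simpa using hz.trans_lt hρ)
    have h4 := h1 (x - z) (by simpa using hz.trans_lt hρ)
    rw [map_add] at h3
    rw [map_sub] at h4
    rw [Real.norm_eq_abs, abs_le]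
    constructor <;> linarith
  rw [le_div_iff₀ hρ0] at hf
  obtain ⟨b, hb, hbe⟩ := hB.exists_eq_suppFn (-f)
  have h5 := hA.le_suppFn (-f) hx
  have h6 := h (-f)
  have h7 := h2 b hb
  have h8 := h1 x (mem_ball_self (hρ0.trans hρ))
  rw [norm_neg] at h6
  rw [neg_apply] at h5 hbe
  have h9 : 0 < ‖f‖ := by
    rw [norm_pos_iff]
    rintro rfl
    simp at h7 h8
    linarith
  nlinarith [mul_lt_mul_of_pos_right hrρ h9]

lemma hausdorffDist_le (hA : IsCWK X A) (hB : IsCWK X B) {r : ℝ} (hr : 0 ≤ r)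
    (h : ∀ x' : X →L[ℝ] ℝ, |suppFn x' A - suppFn x' B| ≤ r * ‖x'‖) : hausdorffDist A B ≤ r := by
  refine hausdorffDist_le_of_infDist hr (fun x hx => hA.infDist_le hB hr (fun x' => ?_) hx)
    fun x hx => hB.infDist_le hA hr (fun x' => ?_) hx
  · linarith [(abs_le.1 (h x')).2]
  · linarith [(abs_le.1 (h x')).1]

end IsCWK

namespace TP

variable {n : ℕ} (P : TP n)

lemma len_nonneg (i : Fin n) : 0 ≤ P.len i :=
  sub_nonneg.2 (P.mono i.castSucc_le_succ)

lemma isCWK_mSum {Γ : ℝ → Set X} (hΓ : ∀ t ∈ Icc (0:ℝ) 1, IsCWK X (Γ t)) : IsCWK X (mSum P Γ) :=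
  IsCWK.sum _ fun i _ => (hΓ _ (P.tagMem i)).smul _

lemma suppFn_mSum {Γ : ℝ → Set X} (hΓ : ∀ t ∈ Icc (0:ℝ) 1, IsCWK X (Γ t)) (x' : X →L[ℝ] ℝ) :
    suppFn x' (mSum P Γ) = ∑ i, P.len i * suppFn x' (Γ (P.tag i)) := by
  rw [mSum, IsCWK.suppFn_sum _ fun i _ => (hΓ _ (P.tagMem i)).smul _]
  exact Finset.sum_congr rfl fun i _ => (hΓ _ (P.tagMem i)).suppFn_smul (P.len_nonneg i) x'

lemma fSum_mem_mSum {Γ : ℝ → Set X} {f : ℝ → X} (hf : Selection Γ f) : fSum P f ∈ mSum P Γ :=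
  Set.finsetSum_mem_finsetSum _ _ _ fun i _ => smul_mem_smul_set (hf _ (P.tagMem i))

lemma map_fSum (f : ℝ → X) (x' : X →L[ℝ] ℝ) :
    x' (fSum P f) = ∑ i, P.len i * x' (f (P.tag i)) := by
  simp [fSum]

lemma psum_of_isFine {M : Type*} [AddCommMonoid M] (φ : ℝ → ℝ → ℝ → M) {δ : ℝ → ℝ}
    (h : P.IsFine δ) :
    PSum (FreePiece δ) φ 0 1 (∑ i, φ (P.pt i.castSucc) (P.pt i.succ) (P.tag i)) := by
  have := PSum.concat (R := FreePiece δ) (φ := φ) P.pt _ fun i =>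
    PSum.single (t := P.tag i) (P.mono i.castSucc_le_succ) ⟨P.tagMem i, h i⟩
  rwa [P.first, P.last] at this

end TP

lemma PSum.exists_tp_free {M : Type*} [AddCommMonoid M] {φ : ℝ → ℝ → ℝ → M} {δ : ℝ → ℝ} {s : M}
    (h : PSum (FreePiece δ) φ 0 1 s) :
    ∃ (n : ℕ) (P : TP n), P.IsFine δ ∧
      ∑ i, φ (P.pt i.castSucc) (P.pt i.succ) (P.tag i) = s := by
  obtain ⟨n, P, h1, h2⟩ := h.exists_tp fun u v t h => h.1
  exact ⟨n, P, fun i => (h1 i).2, h2⟩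

lemma PSum.exists_tp_perron {M : Type*} [AddCommMonoid M] {φ : ℝ → ℝ → ℝ → M} {δ : ℝ → ℝ} {s : M}
    (h : PSum (PerronPiece δ) φ 0 1 s) :
    ∃ (n : ℕ) (P : TP n), P.IsPerron ∧ P.IsFine δ ∧
      ∑ i, φ (P.pt i.castSucc) (P.pt i.succ) (P.tag i) = s := by
  obtain ⟨n, P, h1, h2⟩ := h.exists_tp fun u v t h => h.2.1
  exact ⟨n, P, fun i => (h1 i).1, fun i => (h1 i).2.2, h2⟩

/-! ### Strongly exposed points and Henstock integrable selections -/

/-- Some slice of `K` determined by `f` has diameter at most `ε`. -/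
def SmallSlice (K : Set X) (ε : ℝ) (f : X →L[ℝ] ℝ) : Prop :=
  ∃ α > 0, ∀ x ∈ K, ∀ y ∈ K, suppFn f K - α < f x → suppFn f K - α < f y → dist x y ≤ ε

namespace IsCWK

variable {K : Set X}

lemma exists_pos_norm_le (hK : IsCWK X K) : ∃ C > 0, ∀ x ∈ K, ‖x‖ ≤ C := by
  obtain ⟨C, hC⟩ := hK.exists_norm_le
  exact ⟨max C 1, by positivity, fun x hx => (hC x hx).trans (le_max_left _ _)⟩

lemma suppFn_le_add_norm_mul (hK : IsCWK X K) {C : ℝ} (hC : ∀ x ∈ K, ‖x‖ ≤ C)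
    (f g : X →L[ℝ] ℝ) : suppFn f K ≤ suppFn g K + ‖f - g‖ * C := by
  have h1 := hK.suppFn_functional_add g (f - g)
  rw [add_sub_cancel] at h1
  linarith [(abs_le.1 (hK.abs_suppFn_le hC (f - g))).2]

lemma continuous_suppFn (hK : IsCWK X K) : Continuous fun f : X →L[ℝ] ℝ => suppFn f K := by
  obtain ⟨C, hC0, hC⟩ := hK.exists_pos_norm_le
  refine (LipschitzWith.of_le_add_mul C.toNNReal fun f g => ?_).continuous
  rw [Real.coe_toNNReal _ hC0.le, dist_eq_norm, mul_comm]
  exact hK.suppFn_le_add_norm_mul hC f g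

lemma isOpen_smallSlice (hK : IsCWK X K) (ε : ℝ) : IsOpen {f | SmallSlice K ε f} := by
  obtain ⟨C, hC0, hC⟩ := hK.exists_pos_norm_le
  refine Metric.isOpen_iff.2 fun f ⟨α, hα, h⟩ => ⟨α / (4 * C), by positivity, fun g hg => ?_⟩
  rw [mem_ball, dist_comm, dist_eq_norm, lt_div_iff₀ (by positivity)] at hg
  have h1 := hK.suppFn_le_add_norm_mul hC f g
  have h2 : ∀ x ∈ K, suppFn g K - α / 2 < g x → suppFn f K - α < f x := fun x hx hgx => by
    have h3 : |(f - g) x| ≤ ‖f - g‖ * C :=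
      ((f - g).le_opNorm x).trans (mul_le_mul_of_nonneg_left (hC x hx) (norm_nonneg _))
    rw [sub_apply] at h3
    linarith [(abs_le.1 h3).1]
  exact ⟨α / 2, by positivity, fun x hx y hy hx' hy' =>
    h x hx y hy (h2 x hx hx') (h2 y hy hy')⟩

lemma isClosed_setOf_exists_eq_suppFn (hK : IsCWK X K) {D : Set X} (hD : IsClosed D)
    (hDc : Convex ℝ D) : IsClosed {f : X →L[ℝ] ℝ | ∃ x ∈ K ∩ D, f x = suppFn f K} := by
  rcases (K ∩ D).eq_empty_or_nonempty with h | h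
  · simp [h]
  have hc : IsCWK X (K ∩ D) :=
    hK.of_subset h (hK.convex.inter hDc) (hK.isClosed.inter hD) inter_subset_left
  have : {f : X →L[ℝ] ℝ | ∃ x ∈ K ∩ D, f x = suppFn f K} =
      {f | suppFn f K = suppFn f (K ∩ D)} := by
    ext f
    constructor
    · rintro ⟨x, hx, he⟩
      exact le_antisymm (he ▸ hc.le_suppFn f hx)
        (hc.suppFn_le_iff.2 fun y hy => hK.le_suppFn f hy.1)
    · intro he
      obtain ⟨x, hx, h1⟩ := hc.exists_eq_suppFn f
      exact ⟨x, hx, h1.trans (Eq.symm he)⟩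
  rw [this]
  exact isClosed_eq hK.continuous_suppFn hc.continuous_suppFn

lemma exists_smallSlice_of_isSeparable (hK : IsCWK X K) (hs : TopologicalSpace.IsSeparable K)
    (f : X →L[ℝ] ℝ) {r ε : ℝ} (hr : 0 < r) (hε : 0 < ε) : ∃ g ∈ ball f r, SmallSlice K ε g := by
  obtain ⟨c, hcc, hc⟩ := hs
  have hne : c.Nonempty := by
    obtain ⟨x, hx⟩ := hK.nonempty
    exact closure_nonempty_iff.1 ⟨x, hc hx⟩
  obtain ⟨d, rfl⟩ := hcc.exists_eq_range hne
  set e := ε / 4 with he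
  have he0 : 0 < e := by positivity
  obtain ⟨g, hg, hgr⟩ := (dense_iUnion_interior_of_closed
    (fun n => hK.isClosed_setOf_exists_eq_suppFn (isClosed_closedBall (x := d n) (ε := e))
      (convex_closedBall _ _)) (by
    refine eq_univ_of_forall fun g => mem_iUnion.2 ?_
    obtain ⟨x, hx, hgx⟩ := hK.exists_eq_suppFn g
    obtain ⟨_, ⟨n, rfl⟩, hn⟩ := Metric.mem_closure_iff.1 (hc hx) e he0
    exact ⟨n, x, ⟨hx, hn.le⟩, hgx⟩)).exists_dist_lt f hr
  obtain ⟨n, hn⟩ := mem_iUnion.1 hg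
  obtain ⟨ρ, hρ, hball⟩ := Metric.mem_nhds_iff.1 (mem_interior_iff_mem_nhds.1 hn)
  have key : ∀ x ∈ K, suppFn g K - ρ * e / 2 < g x → dist x (d n) ≤ 2 * e := by
    intro x hx hgx
    by_contra! hlt
    obtain ⟨u, hu, hux⟩ := exists_dual_vector'' ℝ (x - d n)
    obtain ⟨z, ⟨hz, hzd⟩, hze⟩ : g + (ρ / 2) • u ∈
        {f : X →L[ℝ] ℝ | ∃ x ∈ K ∩ closedBall (d n) e, f x = suppFn f K} := by
      apply hball
      rw [mem_ball, dist_eq_norm, add_sub_cancel_left, norm_smul, Real.norm_eq_abs,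
        abs_of_pos (by positivity)]
      nlinarith
    have h1 := hK.le_suppFn (g + (ρ / 2) • u) hx
    rw [← hze] at h1
    simp only [add_apply, smul_apply, smul_eq_mul] at h1
    have h2 := hK.le_suppFn g hz
    have h3 : u (z - d n) ≤ e := by
      refine (le_abs_self _).trans ((u.le_opNorm _).trans ?_)
      rw [mem_closedBall, dist_eq_norm] at hzd
      nlinarith [norm_nonneg (z - d n)]
    rw [dist_eq_norm] at hlt
    rw [map_sub] at h3 hux
    have h4 : u x - u z > e := by
      simp only [RCLike.ofReal_real_eq_id, id_eq] at hux
      linarith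
    nlinarith [mul_lt_mul_of_pos_left h4 (half_pos hρ)]
  refine ⟨g, by rwa [mem_ball, dist_comm], ρ * e / 2, by positivity, fun x hx y hy hgx hgy => ?_⟩
  have := dist_triangle_right x y (d n)
  linarith [key x hx hgx, key y hy hgy]

lemma exists_finite_of_not_smallSlice (hK : IsCWK X K) {f : X →L[ℝ] ℝ} {r ε : ℝ}
    (h : ∀ g ∈ closedBall f r, ¬ SmallSlice K ε g) {z : X} (hz : z ∈ K) {α : ℝ} (hα : 0 < α) :
    ∃ R ⊆ K, R.Finite ∧
      ∀ g ∈ closedBall f r, ∃ x ∈ R, ε / 2 < dist x z ∧ g z - α < g x := by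
  obtain ⟨t, ht⟩ := (WeakDual.isCompact_closedBall (𝕜 := ℝ) f r).elim_finite_subcover
    (fun x : {x // x ∈ K ∧ ε / 2 < dist x z} => {g : WeakDual ℝ X | g z - α < g x})
    (fun x => isOpen_lt ((WeakDual.eval_continuous z).sub continuous_const)
      (WeakDual.eval_continuous _)) fun g hg => by
      have h1 := h _ hg
      simp only [SmallSlice, not_exists, not_and] at h1
      have h2 := h1 α hα
      push Not at h2
      obtain ⟨x, hx, y, hy, hgx, hgy, hxy⟩ := h2
      have h3 := hK.le_suppFn (WeakDual.toStrongDual g) hz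
      rcases lt_or_ge (ε / 2) (dist x z) with h4 | h4
      · exact mem_iUnion.2 ⟨⟨x, hx, h4⟩, (sub_le_sub_right h3 α).trans_lt hgx⟩
      · refine mem_iUnion.2 ⟨⟨y, hy, ?_⟩, (sub_le_sub_right h3 α).trans_lt hgy⟩
        linarith [dist_triangle_right x y z]
  refine ⟨Subtype.val '' (t : Set {x // x ∈ K ∧ ε / 2 < dist x z}), ?_,
    t.finite_toSet.image _, fun g hg => ?_⟩
  · rintro _ ⟨x, -, rfl⟩
    exact x.2.1
  · obtain ⟨x, hxt, hx⟩ := mem_iUnion₂.1 (ht (a := StrongDual.toWeakDual g) hg)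
    exact ⟨x, mem_image_of_mem _ hxt, x.2.2, hx⟩

lemma exists_smallSlice (hK : IsCWK X K) (f : X →L[ℝ] ℝ) {r ε : ℝ} (hr : 0 < r) (hε : 0 < ε) :
    ∃ g ∈ closedBall f r, SmallSlice K ε g := by
  by_contra! hno
  have hR : ∀ (z : X) (m : ℕ), ∃ R ⊆ K, R.Finite ∧ (z ∈ K →
      ∀ g ∈ closedBall f r, ∃ x ∈ R, ε / 2 < dist x z ∧ g z - 1 / ((m : ℝ) + 1) < g x) := by
    intro z m
    by_cases hz : z ∈ K
    · obtain ⟨R, h1, h2, h3⟩ := hK.exists_finite_of_not_smallSlice hno hz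
        (Nat.one_div_pos_of_nat (n := m) (α := ℝ))
      exact ⟨R, h1, h2, fun _ => h3⟩
    · exact ⟨∅, empty_subset _, finite_empty, fun h => (hz h).elim⟩
  choose R hRK hRfin hRs using hR
  obtain ⟨z0, hz0⟩ := hK.nonempty
  let Q : ℕ → Set X := fun n => Nat.rec {z0} (fun _ S => S ∪ ⋃ z ∈ S, ⋃ m, R z m) n
  have hQsucc : ∀ n, Q (n + 1) = Q n ∪ ⋃ z ∈ Q n, ⋃ m, R z m := fun n => rfl
  have hQc : ∀ n, (Q n).Countable := fun n => by
    induction n with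
    | zero => exact countable_singleton z0
    | succ n ih =>
      rw [hQsucc]
      exact ih.union (ih.biUnion fun z _ => countable_iUnion fun m => (hRfin z m).countable)
  have hQK : ∀ n, Q n ⊆ K := fun n => by
    induction n with
    | zero => exact singleton_subset_iff.2 hz0
    | succ n ih =>
      rw [hQsucc]
      exact union_subset ih (iUnion₂_subset fun z _ => iUnion_subset fun m => hRK z m)
  set S := ⋃ n, Q n with hS
  have hSK : S ⊆ K := iUnion_subset hQK
  have hRS : ∀ z ∈ S, ∀ m, R z m ⊆ S := fun z hz m x hx => by
    obtain ⟨n, hn⟩ := mem_iUnion.1 hz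
    refine mem_iUnion.2 ⟨n + 1, ?_⟩
    rw [hQsucc]
    exact Or.inr (mem_iUnion₂.2 ⟨z, hn, mem_iUnion.2 ⟨m, hx⟩⟩)
  set L := closure (convexHull ℝ S) with hL
  have hSL : S ⊆ L := (subset_convexHull ℝ S).trans subset_closure
  have hLc : IsCWK X L :=
    hK.of_subset ⟨z0, hSL (mem_iUnion.2 ⟨0, rfl⟩)⟩ (convex_convexHull ℝ S).closure isClosed_closure
      (closure_minimal (convexHull_min hSK hK.convex) hK.isClosed)
  have hLs : TopologicalSpace.IsSeparable L := by
    refine TopologicalSpace.IsSeparable.closure (TopologicalSpace.IsSeparable.mono ?_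
      (convexHull_subset_affineSpan S |>.trans (affineSpan_subset_span (k := ℝ))))
    exact ((countable_iUnion hQc).isSeparable).span
  obtain ⟨g, hg, α, hα, hsl⟩ := hLc.exists_smallSlice_of_isSeparable hLs f hr (half_pos hε)
  obtain ⟨z, hz, hgz⟩ : ∃ z ∈ S, suppFn g L - α / 2 < g z := by
    by_contra! hle
    have : suppFn g L ≤ suppFn g L - α / 2 := by
      refine hLc.suppFn_le_iff.2 fun x hx => ?_
      refine closure_minimal (convexHull_min hle ?_) ?_ hx
      · exact convex_halfSpace_le g.isLinear _
      · exact isClosed_le g.continuous continuous_const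
    linarith
  obtain ⟨m, hm⟩ := exists_nat_one_div_lt (half_pos hα)
  obtain ⟨x, hx, hxz, hgx⟩ := hRs z m (hSK hz) g (ball_subset_closedBall hg)
  have := hsl x (hSL (hRS z hz m hx)) z (hSL hz) (by linarith) (by linarith)
  linarith

/-- Every convex weakly compact set has a strongly exposed point. -/
lemma exists_stronglyExposed (hK : IsCWK X K) : ∃ (f : X →L[ℝ] ℝ), ∃ x₀ ∈ K, ∀ ε > 0, ∃ α > 0,
    ∀ x ∈ K, suppFn f K - α < f x → dist x x₀ ≤ ε := by
  have hd : Dense (⋂ n : ℕ, {f | SmallSlice K (1 / ((n : ℝ) + 1)) f}) := by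
    refine dense_iInter_of_isOpen_nat (fun n => hK.isOpen_smallSlice _) fun n => ?_
    refine Metric.dense_iff.2 fun f r hr => ?_
    obtain ⟨g, hg, hgs⟩ := hK.exists_smallSlice f (half_pos hr)
      (Nat.one_div_pos_of_nat (n := n) (α := ℝ))
    exact ⟨g, closedBall_subset_ball (half_lt_self hr) hg, hgs⟩
  obtain ⟨f, hf⟩ := hd.nonempty
  obtain ⟨x₀, hx₀, he⟩ := hK.exists_eq_suppFn f
  refine ⟨f, x₀, hx₀, fun ε hε => ?_⟩
  obtain ⟨n, hn⟩ := exists_nat_one_div_lt hε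
  obtain ⟨α, hα, h⟩ := mem_iInter.1 hf n
  exact ⟨α, hα, fun x hx hfx => (h x hx x₀ hx₀ hfx (by linarith)).trans hn.le⟩

end IsCWK

/-- A Henstock integrable multifunction with values in `cwk(X)` has a Henstock integrable
selection. -/
lemma HenstockIntegrable.exists_selection {Γ : ℝ → Set X}
    (hΓ : ∀ t ∈ Icc (0:ℝ) 1, IsCWK X (Γ t)) (h : HenstockIntegrable Γ) :
    ∃ f : ℝ → X, Selection Γ f ∧ FHenstockIntegrable f := by
  obtain ⟨I, hI, hint⟩ := h
  obtain ⟨x', x₀, hx₀, hexp⟩ := hI.exists_stronglyExposed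
  have hsel : ∀ t, ∃ x, t ∈ Icc (0:ℝ) 1 → x ∈ Γ t ∧ x' x = suppFn x' (Γ t) := fun t => by
    by_cases ht : t ∈ Icc (0:ℝ) 1
    · obtain ⟨x, hx⟩ := (hΓ t ht).exists_eq_suppFn x'
      exact ⟨x, fun _ => hx⟩
    · exact ⟨0, fun h => (ht h).elim⟩
  choose f hf using hsel
  have hfs : Selection Γ f := fun t ht => (hf t ht).1
  refine ⟨f, hfs, x₀, fun ε hε => ?_⟩
  obtain ⟨α, hα, hα'⟩ := hexp (ε / 2) (by positivity)
  set η := min (ε / 2) (α / (4 * (‖x'‖ + 1))) with hη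
  have hη0 : 0 < η := by positivity
  have hηα : ‖x'‖ * η ≤ α / 4 := by
    calc ‖x'‖ * η ≤ (‖x'‖ + 1) * (α / (4 * (‖x'‖ + 1))) := by
          gcongr
          · linarith
          · exact min_le_right _ _
      _ = α / 4 := by field_simp
  obtain ⟨δ, hδ, hP⟩ := hint η hη0
  refine ⟨δ, hδ, fun n P h1 h2 => ?_⟩
  have hlt := hP n P h1 h2
  have hc := P.isCWK_mSum hΓ
  obtain ⟨y, hy, hyd⟩ := exists_dist_lt_of_hausdorffDist_lt' (P.fSum_mem_mSum hfs) hlt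
    (hI.hausdorffEDist_ne_top hc)
  have hσ : x' (fSum P f) = suppFn x' (mSum P Γ) := by
    rw [P.map_fSum, P.suppFn_mSum hΓ]
    exact Finset.sum_congr rfl fun i _ => by rw [(hf _ (P.tagMem i)).2]
  have h3 := hI.suppFn_le_add_hausdorffDist hc x'
  have h4 := (le_abs_self _).trans (x'.le_opNorm (fSum P f - y))
  rw [map_sub, ← dist_eq_norm, dist_comm] at h4
  have h5 := mul_le_mul_of_nonneg_left hlt.le (norm_nonneg x')
  have h6 := mul_le_mul_of_nonneg_left hyd.le (norm_nonneg x')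
  have h7 := hα' y hy (by linarith)
  have h8 : η ≤ ε / 2 := min_le_left _ _
  rw [← dist_eq_norm]
  linarith [dist_triangle_left x₀ (fSum P f) y]

/-! ### Uniform absolute continuity of the Pettis integral -/

/-- A linear functional on the dual dominated by the support function of a convex weakly compact
set is the evaluation at a point of the set. -/
lemma IsCWK.exists_eq_of_le_suppFn {K : Set X} (hK : IsCWK X K) (l : (X →L[ℝ] ℝ) →ₗ[ℝ] ℝ)
    (hl : ∀ f, l f ≤ suppFn f K) : ∃ x ∈ K, ∀ f, l f = f x := by
  classical
  have hcont : ∀ f : X →L[ℝ] ℝ,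
      Continuous fun x : WeakSpace ℝ X => f ((toWeakSpace ℝ X).symm x) :=
    fun f => WeakBilin.eval_continuous _ f
  obtain ⟨x, ⟨x, hx, rfl⟩, h⟩ := hK.isCompact.inter_iInter_nonempty
    (fun f : X →L[ℝ] ℝ => {x | f ((toWeakSpace ℝ X).symm x) = l f})
    (fun f => isClosed_eq (hcont f) continuous_const) fun s => by
      let T : X →ₗ[ℝ] (s → ℝ) := LinearMap.pi fun f => (f.1 : X →ₗ[ℝ] ℝ)
      suffices hmem : (fun f : s => l f.1) ∈ T '' K by
        obtain ⟨x, hx, he⟩ := hmem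
        exact ⟨toWeakSpace ℝ X x, mem_image_of_mem _ hx,
          mem_iInter₂.2 fun f hf => by simpa [T] using congrFun he ⟨f, hf⟩⟩
      by_contra hno
      have hcl : IsClosed (T '' K) := by
        have hc : Continuous fun x : WeakSpace ℝ X => T ((toWeakSpace ℝ X).symm x) :=
          continuous_pi fun f => hcont f.1
        have := (hK.isCompact.image hc).isClosed
        rw [image_image] at this
        simpa using this
      obtain ⟨φ, u, h1, h2⟩ := geometric_hahn_banach_closed_point (hK.convex.linear_image T) hcl hno
      have hφ : ∀ v : s → ℝ, φ v = ∑ f, v f * φ fun j => if f = j then 1 else 0 := fun v => by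
        simpa using LinearMap.pi_apply_eq_sum_univ (φ : (s → ℝ) →ₗ[ℝ] ℝ) v
      set g : X →L[ℝ] ℝ := ∑ f : s, (φ fun j => if f = j then 1 else 0) • f.1 with hg
      obtain ⟨x, hx, he⟩ := hK.exists_eq_suppFn g
      have h3 := h1 _ (mem_image_of_mem T hx)
      have h4 : φ (T x) = g x := by
        rw [hφ, hg, sum_apply]
        exact Finset.sum_congr rfl fun f _ => by simp [T, mul_comm]
      have h5 : (φ fun f : s => l f.1) = l g := by
        rw [hφ, hg, map_sum]
        exact Finset.sum_congr rfl fun f _ => by simp [mul_comm]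
      linarith [hl g]
  exact ⟨x, hx, fun f => (by simpa using (mem_iInter.1 h f).symm)⟩

lemma mem_topologicalClosure_of_forall_dual {p : Submodule ℝ X} {x : X}
    (h : ∀ f : X →L[ℝ] ℝ, (∀ y ∈ p, f y = 0) → f x = 0) : x ∈ p.topologicalClosure := by
  by_contra hx
  obtain ⟨f, u, h1, h2⟩ := geometric_hahn_banach_closed_point
    p.topologicalClosure.convex p.isClosed_topologicalClosure hx
  have h0 : 0 < u := by simpa using h1 0 (zero_mem _)
  have := h f fun y hy => by
    by_contra hne
    have h3 := h1 ((u / f y) • y) (Submodule.smul_mem _ _ (p.le_topologicalClosure hy))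
    rw [map_smul, smul_eq_mul, div_mul_cancel₀ _ hne] at h3
    exact lt_irrefl _ h3
  linarith

/-- A form of the Orlicz–Pettis theorem: the terms of a weakly subseries convergent series are not
bounded away from zero. -/
lemma exists_norm_le_of_subseries {x : ℕ → X}
    (h : ∀ S : ℕ → Bool, ∃ y : X, ∀ f : X →L[ℝ] ℝ,
      HasSum (fun k => if S k then f (x k) else 0) (f y)) {ε : ℝ} (hε : 0 < ε) :
    ∃ k, ‖x k‖ ≤ ε := by
  choose y hy using h
  have hsum : ∀ f : X →L[ℝ] ℝ, Summable fun k => |f (x k)| := fun f => by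
    simpa using (hy (fun _ => true) f).summable.abs
  have hycont : ∀ f : X →L[ℝ] ℝ, Continuous fun S => f (y S) := fun f => by
    have : (fun S => f (y S)) = fun S => ∑' k, if S k then f (x k) else 0 :=
      funext fun S => (hy S f).tsum_eq.symm
    rw [this]
    refine continuous_tsum (fun k => ?_) (hsum f) fun k S => ?_
    · exact (continuous_of_discreteTopology (f := fun b : Bool => if b then f (x k) else 0)).comp
        (continuous_apply k)
    · rw [Real.norm_eq_abs]
      split_ifs <;> simp
  set p := Submodule.span ℝ (range x) with hp
  have hmem : ∀ S, y S ∈ p.topologicalClosure := fun S =>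
    mem_topologicalClosure_of_forall_dual fun f hf => by
      refine (hy S f).unique ?_
      simp [hf _ (Submodule.subset_span (mem_range_self _))]
  have hsep : TopologicalSpace.IsSeparable (p : Set X) :=
    ((countable_range x).isSeparable).span
  obtain ⟨c, hcc, hc⟩ := hsep.closure
  have hne : c.Nonempty := closure_nonempty_iff.1 ⟨0, hc (subset_closure (zero_mem p))⟩
  obtain ⟨d, rfl⟩ := hcc.exists_eq_range hne
  obtain ⟨n, S, hS⟩ := nonempty_interior_of_iUnion_of_closed
    (f := fun n => {S : ℕ → Bool | ‖y S - d n‖ ≤ ε / 2}) (fun n => by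
      have : {S : ℕ → Bool | ‖y S - d n‖ ≤ ε / 2} =
          ⋂ f : X →L[ℝ] ℝ, {S | ‖f (y S) - f (d n)‖ ≤ ε / 2 * ‖f‖} := by
        ext S
        simp only [mem_ofPred_eq, mem_iInter]
        constructor
        · intro hS f
          rw [← map_sub, mul_comm]
          exact (f.le_opNorm _).trans (mul_le_mul_of_nonneg_left hS (norm_nonneg _))
        · intro hS
          exact NormedSpace.norm_le_dual_bound ℝ _ (by positivity) fun f => by
            simpa using hS f
      rw [this]
      exact isClosed_iInter fun f =>
        isClosed_le ((hycont f).sub continuous_const).norm continuous_const) (by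
    refine eq_univ_of_forall fun S => mem_iUnion.2 ?_
    obtain ⟨_, ⟨n, rfl⟩, hn⟩ := Metric.mem_closure_iff.1 (hc (hmem S)) (ε / 2) (by positivity)
    exact ⟨n, by simpa [dist_eq_norm] using hn.le⟩)
  have hup : ∀ b : Bool, Filter.Tendsto (fun k => Function.update S k b) Filter.atTop (nhds S) :=
    fun b => tendsto_pi_nhds.2 fun i => by
      refine tendsto_const_nhds.congr' ?_
      filter_upwards [Filter.eventually_gt_atTop i] with k hk
      rw [Function.update_of_ne hk.ne]
  have hnhds := mem_interior_iff_mem_nhds.1 hS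
  obtain ⟨k, hk1, hk2⟩ := (((hup true).eventually hnhds).and ((hup false).eventually hnhds)).exists
  have hk : y (Function.update S k true) - y (Function.update S k false) = x k := by
    refine (SeparatingDual.eq_iff_forall_dual_eq (R := ℝ)).2 fun f => ?_
    rw [map_sub]
    refine ((hy _ f).sub (hy _ f)).unique ?_
    refine (hasSum_ite_eq k (f (x k))).congr_fun fun i => ?_
    rcases eq_or_ne i k with rfl | hik
    · simp
    · simp [hik]
  refine ⟨k, ?_⟩
  rw [← hk, ← sub_sub_sub_cancel_right _ _ (d n)]
  linarith [norm_sub_le (y (Function.update S k true) - d n) (y (Function.update S k false) - d n)]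

lemma exists_subset_half_lt_abs_setIntegral {g : ℝ → ℝ} {E : Set ℝ} (hE : MeasurableSet E)
    (hg : IntegrableOn g E) {ε : ℝ} (h : ε < ∫ x in E, |g x|) :
    ∃ F ⊆ E, MeasurableSet F ∧ ε / 2 < |∫ x in F, g x| := by
  set G := hg.aestronglyMeasurable.mk g with hG
  have hGm : StronglyMeasurable G := hg.aestronglyMeasurable.stronglyMeasurable_mk
  have hae : ∀ᵐ x ∂volume.restrict E, g x = G x := hg.aestronglyMeasurable.ae_eq_mk
  have hP : MeasurableSet {x | 0 ≤ G x} := measurableSet_le measurable_const hGm.measurable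
  by_contra! hno
  have h1 := (le_abs_self _).trans (hno (E ∩ {x | 0 ≤ G x}) inter_subset_left (hE.inter hP))
  have h2 := (neg_le_abs _).trans (hno (E \ {x | 0 ≤ G x}) sdiff_subset (hE.diff hP))
  have h3 : ∫ x in E ∩ {x | 0 ≤ G x}, |g x| = ∫ x in E ∩ {x | 0 ≤ G x}, g x := by
    refine setIntegral_congr_ae (hE.inter hP) ?_
    filter_upwards [(ae_restrict_iff' hE).1 hae] with x hx hx'
    exact abs_of_nonneg (by rw [hx hx'.1]; exact hx'.2)
  have h4 : ∫ x in E \ {x | 0 ≤ G x}, |g x| = -∫ x in E \ {x | 0 ≤ G x}, g x := by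
    rw [← integral_neg]
    refine setIntegral_congr_ae (hE.diff hP) ?_
    filter_upwards [(ae_restrict_iff' hE).1 hae] with x hx hx'
    exact abs_of_neg (by rw [hx hx'.1]; exact not_le.1 hx'.2)
  have h5 := integral_inter_add_sdiff hP hg.abs
  linarith

/-- A family of integrable functions which is not uniformly absolutely continuous has large
integrals over pairwise disjoint sets. -/
lemma exists_disjoint_of_not_unifAbsCont {Θ : Type*} {g : Θ → ℝ → ℝ}
    (hg : ∀ θ, IntegrableOn (g θ) (Icc (0:ℝ) 1)) (h : ¬ UnifAbsCont g) :
    ∃ ε > 0, ∃ (θ : ℕ → Θ) (A : ℕ → Set ℝ), (∀ k, A k ⊆ Icc 0 1) ∧ (∀ k, MeasurableSet (A k)) ∧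
      Pairwise (Function.onFun Disjoint A) ∧ ∀ k, ε < |∫ x in A k, g (θ k) x| := by
  unfold UnifAbsCont at h
  push Not at h
  obtain ⟨ε, hε, h⟩ := h
  have h' : ∀ n : ℕ, ∃ (θ : Θ) (E : Set ℝ), E ⊆ Icc 0 1 ∧ MeasurableSet E ∧
      volume E ≤ ENNReal.ofReal ((1 / 2) ^ n) ∧ ε / 2 < |∫ x in E, g θ x| := fun n => by
    obtain ⟨θ, E, hE, hEm, hEv, hlt⟩ := h ((1 / 2) ^ n) (by positivity)
    obtain ⟨F, hFE, hFm, hF⟩ := exists_subset_half_lt_abs_setIntegral hEm ((hg θ).mono_set hE) hlt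
    exact ⟨θ, F, hFE.trans hE, hFm, (measure_mono hFE).trans hEv, hF⟩
  choose θ E hE hEm hEv hlt using h'
  set F : ℕ → Set ℝ := fun n => ⋃ m, E (n + m) with hF
  have hFm : ∀ n, MeasurableSet (F n) := fun n => MeasurableSet.iUnion fun m => hEm _
  have hFI : ∀ n, F n ⊆ Icc 0 1 := fun n => iUnion_subset fun m => hE _
  have hEF : ∀ {n m}, n ≤ m → E m ⊆ F n := fun {n m} hnm => by
    obtain ⟨j, rfl⟩ := Nat.exists_eq_add_of_le hnm
    exact subset_iUnion (fun j => E (n + j)) j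
  have hFv : Filter.Tendsto (fun n => volume (F n)) Filter.atTop (nhds 0) := by
    have h1 : ∀ n, volume (F n) ≤ ENNReal.ofReal ((1 / 2) ^ n * 2) := fun n => by
      refine (measure_iUnion_le _).trans ?_
      refine (ENNReal.tsum_le_tsum fun m => hEv (n + m)).trans ?_
      rw [← ENNReal.ofReal_tsum_of_nonneg (fun m => by positivity)]
      · simp only [pow_add]
        rw [tsum_mul_left, tsum_geometric_two]
      · simp only [pow_add]
        exact summable_geometric_two.mul_left _
    refine tendsto_of_tendsto_of_tendsto_of_le_of_le tendsto_const_nhds ?_ (fun _ => zero_le) h1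
    have h2 := ((tendsto_pow_atTop_nhds_zero_of_lt_one (r := (1 / 2 : ℝ)) (by norm_num)
      (by norm_num)).mul_const 2)
    rw [zero_mul] at h2
    rw [← ENNReal.ofReal_zero]
    exact (ENNReal.continuous_ofReal.tendsto 0).comp h2
  have hnext : ∀ n, ∃ m, n < m ∧ |∫ x in E n ∩ F m, g (θ n) x| < ε / 4 := fun n => by
    have h1 : Filter.Tendsto (fun m => (volume.restrict (Icc (0:ℝ) 1)) (E n ∩ F m)) Filter.atTop
        (nhds 0) :=
      tendsto_of_tendsto_of_tendsto_of_le_of_le tendsto_const_nhds hFv (fun _ => zero_le)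
        fun m => (Measure.restrict_apply_le _ _).trans (measure_mono inter_subset_right)
    have h2 := ((hg (θ n)).tendsto_setIntegral_nhds_zero h1).abs
    rw [abs_zero] at h2
    obtain ⟨m, hm1, hm2⟩ := ((h2.eventually (gt_mem_nhds (by positivity : 0 < ε / 4))).and
      (Filter.eventually_gt_atTop n)).exists
    refine ⟨m, hm2, ?_⟩
    rwa [Measure.restrict_restrict ((hEm n).inter (hFm m)),
      inter_eq_left.2 (inter_subset_left.trans (hE n))] at hm1
  choose N hN hNlt using hnext
  set φ : ℕ → ℕ := fun k => N^[k] 0 with hφ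
  have hφs : ∀ k, φ (k + 1) = N (φ k) := fun k => Function.iterate_succ_apply' N k 0
  have hφm : StrictMono φ := strictMono_nat_of_lt_succ fun k => by rw [hφs]; exact hN _
  refine ⟨ε / 4, by positivity, fun k => θ (φ k), fun k => E (φ k) \ F (φ (k + 1)),
    fun k => sdiff_subset.trans (hE _), fun k => (hEm _).diff (hFm _), ?_, fun k => ?_⟩
  · refine (pairwise_disjoint_on _).2 fun j k hjk => ?_
    exact (disjoint_sdiff_left).mono_right
      (sdiff_subset.trans (hEF (hφm.monotone (Nat.succ_le_of_lt hjk))))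
  · have h1 := integral_inter_add_sdiff (hFm (φ (k + 1))) ((hg (θ (φ k))).mono_set (hE (φ k)))
    have h2 := hlt (φ k)
    have h3 := hNlt (φ k)
    rw [← hφs] at h3
    rw [← h1] at h2
    linarith [abs_add_le (∫ x in E (φ k) ∩ F (φ (k + 1)), g (θ (φ k)) x)
      (∫ x in E (φ k) \ F (φ (k + 1)), g (θ (φ k)) x)]

/-- The support functions of a Pettis integrable multifunction in the directions of the dual unit
ball are uniformly absolutely continuous. -/
lemma PettisIntegrable.unifAbsCont {Γ : ℝ → Set X} (h : PettisIntegrable Γ) :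
    UnifAbsCont fun (f : {f : X →L[ℝ] ℝ // ‖f‖ ≤ 1}) t => suppFn f.1 (Γ t) := by
  obtain ⟨hint, hW⟩ := h
  by_contra hno
  obtain ⟨ε, hε, θ, A, hA, hAm, hAd, hlt⟩ :=
    exists_disjoint_of_not_unifAbsCont (fun f : {f : X →L[ℝ] ℝ // ‖f‖ ≤ 1} => hint f.1) hno
  choose W hWc hWs using fun k => hW (A k) (hA k) (hAm k).nullMeasurableSet
  choose x hx hxe using fun k => (hWc k).exists_eq_suppFn (θ k).1
  have hbig : ∀ k, ε < ‖x k‖ := fun k => by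
    have h1 := hlt k
    rw [← hWs k, ← hxe k] at h1
    refine h1.trans_le (((θ k).1.le_opNorm (x k)).trans ?_)
    exact mul_le_of_le_one_left (norm_nonneg _) (θ k).2
  obtain ⟨k, hk⟩ := exists_norm_le_of_subseries (x := x) (fun S => by
    set B : ℕ → Set ℝ := fun k => if S k then A k else ∅ with hB
    have hBA : ∀ k, B k ⊆ A k := fun k => by
      simp only [hB]
      split_ifs <;> simp
    have hBm : ∀ k, MeasurableSet (B k) := fun k => by
      simp only [hB]
      split_ifs
      exacts [hAm k, MeasurableSet.empty]
    have hBd : Pairwise (Function.onFun Disjoint B) :=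
      fun j k hjk => (hAd hjk).mono (hBA j) (hBA k)
    have hBI : ⋃ k, B k ⊆ Icc (0:ℝ) 1 := iUnion_subset fun k => (hBA k).trans (hA k)
    have hsum : ∀ f : X →L[ℝ] ℝ, HasSum (fun k => if S k then suppFn f (W k) else 0)
        (∫ t in ⋃ k, B k, suppFn f (Γ t)) := fun f => by
      refine (hasSum_integral_iUnion hBm hBd ((hint f).mono_set hBI)).congr_fun fun k => ?_
      simp only [hB]
      split_ifs
      · exact hWs k f
      · simp
    have hle : ∀ k (f : X →L[ℝ] ℝ), f (x k) ≤ suppFn f (W k) :=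
      fun k f => (hWc k).le_suppFn f (hx k)
    have hsx : ∀ f : X →L[ℝ] ℝ, Summable fun k => if S k then f (x k) else 0 := fun f => by
      refine Summable.of_norm_bounded
        ((hsum f).summable.abs.add (hsum (-f)).summable.abs) fun k => ?_
      split_ifs
      · have h1 := hle k f
        have h2 := hle k (-f)
        rw [neg_apply] at h2
        rw [Real.norm_eq_abs, abs_le]
        constructor
        · linarith [le_abs_self (suppFn (-f) (W k)), abs_nonneg (suppFn f (W k))]
        · linarith [le_abs_self (suppFn f (W k)), abs_nonneg (suppFn (-f) (W k))]
      · simp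
    obtain ⟨V, hVc, hVs⟩ := hW _ hBI (MeasurableSet.iUnion hBm).nullMeasurableSet
    let l : (X →L[ℝ] ℝ) →ₗ[ℝ] ℝ :=
      { toFun := fun f => ∑' k, if S k then f (x k) else 0
        map_add' := fun f g => by
          rw [← (hsx f).tsum_add (hsx g)]
          exact tsum_congr fun k => by split_ifs <;> simp
        map_smul' := fun c f => by
          rw [smul_eq_mul, RingHom.id_apply, ← tsum_mul_left]
          exact tsum_congr fun k => by split_ifs <;> simp }
    obtain ⟨y, -, hy⟩ := hVc.exists_eq_of_le_suppFn l fun f => by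
      rw [hVs]
      refine hasSum_le (fun k => ?_) (hsx f).hasSum (hsum f)
      split_ifs
      exacts [hle k f, le_rfl]
    exact ⟨y, fun f => hy f ▸ (hsx f).hasSum⟩) hε
  exact (hbig k).not_ge hk

/-! ### Uniform convergence of the Riemann sums of families of scalar functions -/

lemma PSum.gaugeErr_of_sum {g : ℝ → ℝ} (hg : IntegrableOn g (Icc (0:ℝ) 1))
    {R : ℝ → ℝ → ℝ → Prop} {S : ℝ} (h : PSum R (fun u v t => (v - u) * g t) 0 1 S) :
    PSum R (gaugeErr g) 0 1 (S - ∫ x in (0:ℝ)..1, g x) := by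
  have h1 := h.restrict.sub_increment fun y => ∫ x in (0:ℝ)..y, g x
  rw [intervalIntegral.integral_same, sub_zero] at h1
  exact h1.map (AddMonoidHom.id ℝ) fun u v t huv hp =>
    ⟨t, hp.1, by simp [integral_sub_integral_eq hg hp.2.1 huv hp.2.2]⟩

lemma PSum.sum_of_gaugeErr {g : ℝ → ℝ} (hg : IntegrableOn g (Icc (0:ℝ) 1))
    {R : ℝ → ℝ → ℝ → Prop} {S : ℝ} (h : PSum R (gaugeErr g) 0 1 S) :
    PSum R (fun u v t => (v - u) * g t) 0 1 (S + ∫ x in (0:ℝ)..1, g x) := by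
  have h1 : PSum R (fun u v t => (v - u) * g t -
      ((∫ x in (0:ℝ)..v, g x) - ∫ x in (0:ℝ)..u, g x)) 0 1 S :=
    h.restrict.map (AddMonoidHom.id ℝ) fun u v t huv hp =>
      ⟨t, hp.1, by simp [integral_sub_integral_eq hg hp.2.1 huv hp.2.2]⟩
  have h2 := PSum.add_increment (fun y => ∫ x in (0:ℝ)..y, g x) h1
  rwa [intervalIntegral.integral_same, sub_zero] at h2

/-- The Riemann sums of the functions `g θ` converge to `A θ` uniformly in `θ`, over the given
pieces. -/
def UnifSum {Θ : Type*} (R : (ℝ → ℝ) → ℝ → ℝ → ℝ → Prop) (g : Θ → ℝ → ℝ) (A : Θ → ℝ) : Prop :=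
  ∀ ε > 0, ∃ δ : ℝ → ℝ, IsGauge δ ∧ ∀ θ S,
    PSum (R δ) (fun u v t => (v - u) * g θ t) 0 1 S → |S - A θ| ≤ ε

namespace UnifSum

variable {Θ : Type*} {g : Θ → ℝ → ℝ} {A : Θ → ℝ}

lemma perron (h : UnifSum FreePiece g A) : UnifSum PerronPiece g A := fun ε hε => by
  obtain ⟨δ, hδ, H⟩ := h ε hε
  exact ⟨δ, hδ, fun θ S hS => H θ S (hS.mono fun _ _ _ _ h => h.2)⟩

lemma aemeasurable (h : UnifSum PerronPiece g A) (θ : Θ) :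
    AEMeasurable (g θ) (volume.restrict (Icc (0:ℝ) 1)) :=
  aemeasurable_of_hkGauge (A := A θ) fun ε hε => by
    obtain ⟨δ, hδ, H⟩ := h ε hε
    exact ⟨δ, hδ, H θ⟩

lemma integral_eq (h : UnifSum PerronPiece g A) {θ : Θ} (hg : IntegrableOn (g θ) (Icc (0:ℝ) 1)) :
    ∫ x in (0:ℝ)..1, g θ x = A θ := by
  refine eq_of_forall_dist_le fun ε hε => ?_
  obtain ⟨δ, hδ, H⟩ := h (ε / 2) (by positivity)
  obtain ⟨S, hS, hSε⟩ := exists_psum_gaugeErr_small hg hδ (half_pos hε) le_rfl zero_le_one le_rfl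
  have h1 := H θ _ (hS.sum_of_gaugeErr hg)
  rw [Real.dist_eq, abs_le]
  rw [abs_le] at hSε h1
  constructor <;> linarith [h1.1, h1.2, hSε.1, hSε.2]

lemma unifGauge (h : UnifSum PerronPiece g A) (hg : ∀ θ, IntegrableOn (g θ) (Icc (0:ℝ) 1)) :
    UnifGauge PerronPiece g := fun ε hε => by
  obtain ⟨δ, hδ, H⟩ := h ε hε
  refine ⟨δ, hδ, fun θ S hS => ?_⟩
  have h1 := H θ _ (hS.sum_of_gaugeErr (hg θ))
  rwa [h.integral_eq (hg θ), add_sub_cancel_right] at h1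

/-- A uniformly Henstock integrable, uniformly absolutely continuous, pointwise bounded family is
uniformly McShane integrable. -/
lemma free (h : UnifSum PerronPiece g A) (hg : ∀ θ, IntegrableOn (g θ) (Icc (0:ℝ) 1))
    (hac : UnifAbsCont g) (hb : ∀ t ∈ Icc (0:ℝ) 1, ∃ M, ∀ θ, |g θ t| ≤ M) :
    UnifSum FreePiece g A := fun ε hε => by
  obtain ⟨δ, hδ, H⟩ := (h.unifGauge hg).free_of_perron hg hac hb ε hε
  refine ⟨δ, hδ, fun θ S hS => ?_⟩
  rw [← h.integral_eq (hg θ)]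
  exact H θ _ (hS.gaugeErr_of_sum (hg θ))

lemma unifMcShane (h : UnifSum FreePiece g A) : UnifMcShane g := ⟨A, h⟩

end UnifSum

/-! ### Scalarization of the gauge integrals -/

section Scalarization

variable {Γ : ℝ → Set X} {I : Set X} {f : ℝ → X} {w : X} {Θ : Type*} {F : Θ → X →L[ℝ] ℝ} {C : ℝ}

lemma abs_suppFn_mSum_sub_le {n : ℕ} {P : TP n} (hΓ : ∀ t ∈ Icc (0:ℝ) 1, IsCWK X (Γ t))
    (hI : IsCWK X I)
    {ε : ℝ} (hC : 0 < C) (h : hausdorffDist I (mSum P Γ) < ε / C) {x' : X →L[ℝ] ℝ}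
    (hx' : ‖x'‖ ≤ C) : |∑ i, P.len i * suppFn x' (Γ (P.tag i)) - suppFn x' I| ≤ ε := by
  rw [← P.suppFn_mSum hΓ, abs_sub_comm]
  refine (hI.abs_suppFn_sub_le (P.isCWK_mSum hΓ) x').trans ?_
  rw [lt_div_iff₀ hC] at h
  nlinarith [hausdorffDist_nonneg (s := I) (t := mSum P Γ)]

lemma abs_map_fSum_sub_le {n : ℕ} {P : TP n} {ε : ℝ} (hC : 0 < C) (h : ‖w - fSum P f‖ < ε / C)
    {x' : X →L[ℝ] ℝ} (hx' : ‖x'‖ ≤ C) : |∑ i, P.len i * x' (f (P.tag i)) - x' w| ≤ ε := by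
  rw [← P.map_fSum, abs_sub_comm, ← map_sub]
  refine (x'.le_opNorm _).trans ?_
  rw [lt_div_iff₀ hC] at h
  nlinarith [norm_nonneg (w - fSum P f)]

lemma unifSum_suppFn_of_henstock (hΓ : ∀ t ∈ Icc (0:ℝ) 1, IsCWK X (Γ t)) (hI : IsCWK X I)
    (h : ∀ ε > 0, ∃ δ : ℝ → ℝ, IsGauge δ ∧
      ∀ (n : ℕ) (P : TP n), P.IsPerron → P.IsFine δ → hausdorffDist I (mSum P Γ) < ε)
    (hC : 0 < C) (hF : ∀ θ, ‖F θ‖ ≤ C) :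
    UnifSum PerronPiece (fun θ t => suppFn (F θ) (Γ t)) (fun θ => suppFn (F θ) I) := fun ε hε => by
  obtain ⟨δ, hδ, H⟩ := h (ε / C) (by positivity)
  refine ⟨δ, hδ, fun θ S hS => ?_⟩
  obtain ⟨n, P, h1, h2, rfl⟩ := hS.exists_tp_perron
  exact abs_suppFn_mSum_sub_le hΓ hI hC (H n P h1 h2) (hF θ)

lemma unifSum_suppFn_of_mcShane (hΓ : ∀ t ∈ Icc (0:ℝ) 1, IsCWK X (Γ t)) (hI : IsCWK X I)
    (h : ∀ ε > 0, ∃ δ : ℝ → ℝ, IsGauge δ ∧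
      ∀ (n : ℕ) (P : TP n), P.IsFine δ → hausdorffDist I (mSum P Γ) < ε)
    (hC : 0 < C) (hF : ∀ θ, ‖F θ‖ ≤ C) :
    UnifSum FreePiece (fun θ t => suppFn (F θ) (Γ t)) (fun θ => suppFn (F θ) I) := fun ε hε => by
  obtain ⟨δ, hδ, H⟩ := h (ε / C) (by positivity)
  refine ⟨δ, hδ, fun θ S hS => ?_⟩
  obtain ⟨n, P, h2, rfl⟩ := hS.exists_tp_free
  exact abs_suppFn_mSum_sub_le hΓ hI hC (H n P h2) (hF θ)

lemma unifSum_of_henstock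
    (h : ∀ ε > 0, ∃ δ : ℝ → ℝ, IsGauge δ ∧
      ∀ (n : ℕ) (P : TP n), P.IsPerron → P.IsFine δ → ‖w - fSum P f‖ < ε)
    (hC : 0 < C) (hF : ∀ θ, ‖F θ‖ ≤ C) :
    UnifSum PerronPiece (fun θ t => F θ (f t)) (fun θ => F θ w) := fun ε hε => by
  obtain ⟨δ, hδ, H⟩ := h (ε / C) (by positivity)
  refine ⟨δ, hδ, fun θ S hS => ?_⟩
  obtain ⟨n, P, h1, h2, rfl⟩ := hS.exists_tp_perron
  exact abs_map_fSum_sub_le hC (H n P h1 h2) (hF θ)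

lemma unifSum_of_mcShane
    (h : ∀ ε > 0, ∃ δ : ℝ → ℝ, IsGauge δ ∧
      ∀ (n : ℕ) (P : TP n), P.IsFine δ → ‖w - fSum P f‖ < ε)
    (hC : 0 < C) (hF : ∀ θ, ‖F θ‖ ≤ C) :
    UnifSum FreePiece (fun θ t => F θ (f t)) (fun θ => F θ w) := fun ε hε => by
  obtain ⟨δ, hδ, H⟩ := h (ε / C) (by positivity)
  refine ⟨δ, hδ, fun θ S hS => ?_⟩
  obtain ⟨n, P, h2, rfl⟩ := hS.exists_tp_free
  exact abs_map_fSum_sub_le hC (H n P h2) (hF θ)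

lemma exists_pos_mul_norm_le_one (x' : X →L[ℝ] ℝ) :
    ∃ y' : X →L[ℝ] ℝ, ‖y'‖ ≤ 1 ∧ ‖x'‖ • y' = x' := by
  rcases eq_or_ne x' 0 with rfl | h
  · exact ⟨0, by simp, by simp⟩
  · have h' : ‖x'‖ ≠ 0 := norm_ne_zero_iff.2 h
    exact ⟨‖x'‖⁻¹ • x', by rw [norm_smul, norm_inv, norm_norm, inv_mul_cancel₀ h'],
      smul_inv_smul₀ h' x'⟩

lemma mcShaneIntegrable_of_unifSum (hΓ : ∀ t ∈ Icc (0:ℝ) 1, IsCWK X (Γ t)) (hI : IsCWK X I)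
    (h : UnifSum FreePiece (fun (f : {f : X →L[ℝ] ℝ // ‖f‖ ≤ 1}) t => suppFn f.1 (Γ t))
      fun f => suppFn f.1 I) : McShaneIntegrable Γ := by
  refine ⟨I, hI, fun ε hε => ?_⟩
  obtain ⟨δ, hδ, H⟩ := h (ε / 2) (by positivity)
  refine ⟨δ, hδ, fun n P hP => lt_of_le_of_lt ?_ (half_lt_self hε)⟩
  refine hI.hausdorffDist_le (P.isCWK_mSum hΓ) (by positivity) fun x' => ?_
  obtain ⟨y', hy', hx'⟩ := exists_pos_mul_norm_le_one x'
  have h1 := H ⟨y', hy'⟩ _ (P.psum_of_isFine _ hP)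
  have h2 : ∑ i, (P.pt i.succ - P.pt i.castSucc) * suppFn y' (Γ (P.tag i)) =
    suppFn y' (mSum P Γ) := (P.suppFn_mSum hΓ y').symm
  rw [h2] at h1
  have h3 : ∀ {A : Set X}, IsCWK X A → suppFn x' A = ‖x'‖ * suppFn y' A := fun hA => by
    rw [← hA.suppFn_functional_smul (norm_nonneg _), hx']
  rw [h3 hI, h3 (P.isCWK_mSum hΓ), ← mul_sub, abs_mul, abs_norm, mul_comm, abs_sub_comm]
  exact mul_le_mul_of_nonneg_right h1 (norm_nonneg _)

lemma fMcShaneIntegrable_of_unifSum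
    (h : UnifSum FreePiece (fun (x' : {f : X →L[ℝ] ℝ // ‖f‖ ≤ 1}) t => x'.1 (f t))
      fun x' => x'.1 w) : FMcShaneIntegrable f := by
  refine ⟨w, fun ε hε => ?_⟩
  obtain ⟨δ, hδ, H⟩ := h (ε / 2) (by positivity)
  refine ⟨δ, hδ, fun n P hP => lt_of_le_of_lt ?_ (half_lt_self hε)⟩
  refine NormedSpace.norm_le_dual_bound ℝ _ (by positivity) fun x' => ?_
  obtain ⟨y', hy', hx'⟩ := exists_pos_mul_norm_le_one x'
  have h1 := H ⟨y', hy'⟩ _ (P.psum_of_isFine _ hP)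
  have h2 : ∑ i, (P.pt i.succ - P.pt i.castSucc) * y' (f (P.tag i)) = y' (fSum P f) :=
    (P.map_fSum f y').symm
  rw [h2, abs_sub_comm, ← map_sub] at h1
  have h3 : x' (w - fSum P f) = ‖x'‖ * y' (w - fSum P f) := by
    rw [← smul_eq_mul, ← smul_apply, hx']
  rw [h3, norm_mul, norm_norm, mul_comm, Real.norm_eq_abs]
  exact mul_le_mul_of_nonneg_right h1 (norm_nonneg _)

end Scalarization

/-! ### McShane integrability from Henstock and Pettis integrability -/

section

variable {Γ : ℝ → Set X}

lemma McShaneIntegrable.henstockIntegrable (h : McShaneIntegrable Γ) : HenstockIntegrable Γ := by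
  obtain ⟨I, hI, H⟩ := h
  refine ⟨I, hI, fun ε hε => ?_⟩
  obtain ⟨δ, hδ, h⟩ := H ε hε
  exact ⟨δ, hδ, fun n P _ => h n P⟩

lemma exists_forall_abs_suppFn_le (hΓ : ∀ t ∈ Icc (0:ℝ) 1, IsCWK X (Γ t)) :
    ∀ t ∈ Icc (0:ℝ) 1, ∃ M, ∀ f : {f : X →L[ℝ] ℝ // ‖f‖ ≤ 1}, |suppFn f.1 (Γ t)| ≤ M := by
  intro t ht
  obtain ⟨C, hC0, hC⟩ := (hΓ t ht).exists_pos_norm_le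
  exact ⟨C, fun f => ((hΓ t ht).abs_suppFn_le hC _).trans (mul_le_of_le_one_left hC0.le f.2)⟩

theorem HenstockIntegrable.mcShaneIntegrable (hΓ : ∀ t ∈ Icc (0:ℝ) 1, IsCWK X (Γ t))
    (h : HenstockIntegrable Γ) (hP : PettisIntegrable Γ) : McShaneIntegrable Γ := by
  obtain ⟨I, hI, H⟩ := h
  exact mcShaneIntegrable_of_unifSum hΓ hI <|
    (unifSum_suppFn_of_henstock hΓ hI H one_pos fun f => f.2).free (fun f => hP.1 f.1)
      hP.unifAbsCont (exists_forall_abs_suppFn_le hΓ)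

/-! ### Henstock integrable selections of a McShane integrable multifunction -/

theorem McShaneIntegrable.fMcShaneIntegrable (hΓ : ∀ t ∈ Icc (0:ℝ) 1, IsCWK X (Γ t))
    (h : McShaneIntegrable Γ) {f : ℝ → X} (hf : Selection Γ f) (hfH : FHenstockIntegrable f) :
    FMcShaneIntegrable f := by
  obtain ⟨I, hI, H⟩ := h
  obtain ⟨w, Hw⟩ := hfH
  have hsum : UnifSum FreePiece (fun (f : {f : X →L[ℝ] ℝ // ‖f‖ ≤ 1}) t => suppFn f.1 (Γ t))
      fun f => suppFn f.1 I := unifSum_suppFn_of_mcShane hΓ hI H one_pos fun f => f.2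
  have hbd := exists_forall_abs_suppFn_le hΓ
  have hm := hsum.perron.aemeasurable
  have hac := hsum.unifMcShane.unifAbsCont hm hbd
  obtain ⟨τ, -, hτ⟩ := hsum.unifMcShane.exists_simpleFunc hm one_pos
  have hint : ∀ x' : {f : X →L[ℝ] ℝ // ‖f‖ ≤ 1},
      IntegrableOn (fun t => suppFn x'.1 (Γ t)) (Icc (0:ℝ) 1) := fun x' => (hτ x').1
  have hfsum : UnifSum PerronPiece (fun (x' : {f : X →L[ℝ] ℝ // ‖f‖ ≤ 1}) t => x'.1 (f t))
      fun x' => x'.1 w := unifSum_of_henstock Hw one_pos fun x' => x'.2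
  let neg : {f : X →L[ℝ] ℝ // ‖f‖ ≤ 1} → {f : X →L[ℝ] ℝ // ‖f‖ ≤ 1} :=
    fun x' => ⟨-x'.1, by rw [norm_neg]; exact x'.2⟩
  have hle : ∀ (x' : {f : X →L[ℝ] ℝ // ‖f‖ ≤ 1}), ∀ t ∈ Icc (0:ℝ) 1,
      |x'.1 (f t)| ≤ |suppFn x'.1 (Γ t)| + |suppFn (neg x').1 (Γ t)| := by
    intro x' t ht
    have h1 := (hΓ t ht).le_suppFn x'.1 (hf t ht)
    have h2 := (hΓ t ht).le_suppFn (neg x').1 (hf t ht)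
    rw [show (neg x').1 = -x'.1 from rfl, neg_apply] at h2
    rw [show (neg x').1 = -x'.1 from rfl, abs_le]
    constructor <;> linarith [le_abs_self (suppFn x'.1 (Γ t)), le_abs_self (suppFn (-x'.1) (Γ t)),
      abs_nonneg (suppFn x'.1 (Γ t)), abs_nonneg (suppFn (-x'.1) (Γ t))]
  have hfint : ∀ x' : {f : X →L[ℝ] ℝ // ‖f‖ ≤ 1},
      IntegrableOn (fun t => x'.1 (f t)) (Icc (0:ℝ) 1) := fun x' =>
    ((hint x').abs.add (hint (neg x')).abs).mono' (hfsum.aemeasurable x').aestronglyMeasurable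
      ((ae_restrict_mem measurableSet_Icc).mono fun t ht => hle x' t ht)
  refine fMcShaneIntegrable_of_unifSum (hfsum.free hfint (fun ε hε => ?_) fun t ht => ?_)
  · obtain ⟨η, hη, hηE⟩ := hac (ε / 2) (half_pos hε)
    refine ⟨η, hη, fun x' E hE hEm hEη => ?_⟩
    have i1 := ((hint x').mono_set hE).abs
    have i2 := ((hint (neg x')).mono_set hE).abs
    calc ∫ t in E, |x'.1 (f t)|
        ≤ ∫ t in E, (|suppFn x'.1 (Γ t)| + |suppFn (neg x').1 (Γ t)|) :=
          setIntegral_mono_on ((hfint x').mono_set hE).abs (i1.add i2) hEm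
            fun t ht => hle x' t (hE ht)
      _ = (∫ t in E, |suppFn x'.1 (Γ t)|) + ∫ t in E, |suppFn (neg x').1 (Γ t)| :=
          integral_add i1 i2
      _ ≤ ε := by linarith [hηE x' E hE hEm hEη, hηE (neg x') E hE hEm hEη]
  · obtain ⟨M, hM⟩ := hbd t ht
    exact ⟨M + M, fun x' => (hle x' t ht).trans (add_le_add (hM x') (hM (neg x')))⟩

end

/-! ### McShane integrable functions are Pettis integrable -/

theorem FMcShaneIntegrable.fPettisIntegrable [CompleteSpace X] {f : ℝ → X}
    (h : FMcShaneIntegrable f) : FPettisIntegrable f := by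
  obtain ⟨w, H⟩ := h
  have hsum : UnifSum FreePiece (fun (x' : {f : X →L[ℝ] ℝ // ‖f‖ ≤ 1}) t => x'.1 (f t))
      fun x' => x'.1 w := unifSum_of_mcShane H one_pos fun x' => x'.2
  choose τ hτ01 hτ using fun k : ℕ => hsum.unifMcShane.exists_simpleFunc hsum.perron.aemeasurable
    (Nat.one_div_pos_of_nat (α := ℝ) (n := k))
  refine ⟨fun x' => ?_, fun E hE hEm => ?_⟩
  · obtain ⟨y', hy', hx'⟩ := exists_pos_mul_norm_le_one x'
    rw [← hx']
    exact (hτ 0 ⟨y', hy'⟩).1.const_mul ‖x'‖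
  set y : ℕ → X := fun k => ∫ t in E, (τ k).map f t with hy
  have hEfin : IsFiniteMeasure (volume.restrict E) :=
    ⟨by rw [Measure.restrict_apply_univ]; exact (measure_mono hE).trans_lt (by simp)⟩
  have hyE : ∀ (k : ℕ) (x' : X →L[ℝ] ℝ), ‖x'‖ ≤ 1 →
      |x' (y k) - ∫ t in E, x' (f t)| ≤ 1 / ((k:ℝ) + 1) := by
    intro k x' hx'
    obtain ⟨h1, h2, h3⟩ := hτ k ⟨x', hx'⟩
    have hyk : x' (y k) = ∫ t in E, x' (f (τ k t)) :=
      (x'.integral_comp_comm ((τ k).map f).integrable_of_isFiniteMeasure).symm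
    rw [hyk, ← integral_sub (h2.mono_set hE) (h1.mono_set hE)]
    refine abs_integral_le_integral_abs.trans (le_trans ?_ h3)
    simp_rw [abs_sub_comm]
    exact setIntegral_mono_set (h1.sub h2).abs (Filter.Eventually.of_forall fun _ => abs_nonneg _)
      hE.eventuallyLE
  have hcau : CauchySeq y := by
    refine cauchySeq_of_le_tendsto_0 (fun N : ℕ => 2 * (1 / ((N:ℝ) + 1))) (fun n m N hn hm => ?_)
      (by simpa using (tendsto_one_div_add_atTop_nhds_zero_nat (𝕜 := ℝ)).const_mul 2)
    rw [dist_eq_norm]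
    refine NormedSpace.norm_le_dual_bound ℝ _ (by positivity) fun x' => ?_
    obtain ⟨y', hy', hx'⟩ := exists_pos_mul_norm_le_one x'
    have h1 := (hyE n y' hy').trans (Nat.one_div_le_one_div hn)
    have h2 := (hyE m y' hy').trans (Nat.one_div_le_one_div hm)
    have h3 : |y' (y n - y m)| ≤ 2 * (1 / ((N:ℝ) + 1)) := by
      rw [abs_le] at h1 h2 ⊢
      rw [map_sub]
      constructor <;> linarith [h1.1, h1.2, h2.1, h2.2]
    calc ‖x' (y n - y m)‖ = ‖x'‖ * |y' (y n - y m)| := by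
          nth_rw 1 [← hx']
          rw [smul_apply, norm_smul, norm_norm, Real.norm_eq_abs]
      _ ≤ _ := by rw [mul_comm]; exact mul_le_mul_of_nonneg_right h3 (norm_nonneg _)
  obtain ⟨ν, hν⟩ := cauchySeq_tendsto_of_complete hcau
  have hball : ∀ x' : X →L[ℝ] ℝ, ‖x'‖ ≤ 1 → x' ν = ∫ t in E, x' (f t) := by
    intro x' hx'
    refine tendsto_nhds_unique ((x'.continuous.tendsto ν).comp hν) ?_
    rw [tendsto_iff_dist_tendsto_zero]
    exact squeeze_zero (fun _ => dist_nonneg) (fun k => hyE k x' hx')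
      tendsto_one_div_add_atTop_nhds_zero_nat
  refine ⟨ν, fun x' => ?_⟩
  obtain ⟨y', hy', hx'⟩ := exists_pos_mul_norm_le_one x'
  rw [← hx']
  simp only [smul_apply, smul_eq_mul]
  rw [integral_const_mul, hball y' hy']

/-! ### Sublinear functionals dominated by a support function -/

lemma exists_linearMap_eq_le_sublinear {V : Type*} [AddCommGroup V] [Module ℝ V] {q : V → ℝ}
    (hsmul : ∀ c : ℝ, 0 < c → ∀ x, q (c • x) = c * q x) (hadd : ∀ x y, q (x + y) ≤ q x + q y)
    (x₀ : V) : ∃ l : V →ₗ[ℝ] ℝ, l x₀ = q x₀ ∧ ∀ x, l x ≤ q x := by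
  have h0 : q 0 = 0 := by
    have := hsmul 2 two_pos 0
    rw [smul_zero] at this
    linarith
  have hH : ∀ c : ℝ, c • x₀ = 0 → c • q x₀ = 0 := fun c hc => by
    rcases smul_eq_zero.1 hc with rfl | rfl
    · simp
    · simp [h0]
  obtain ⟨l, h1, h2⟩ := exists_extension_of_le_sublinear (LinearPMap.mkSpanSingleton' x₀ (q x₀) hH)
    q hsmul hadd (by
      rintro ⟨x, hx⟩
      obtain ⟨c, rfl⟩ := Submodule.mem_span_singleton.1 hx
      rw [LinearPMap.mkSpanSingleton'_apply, smul_eq_mul]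
      rcases lt_trichotomy c 0 with hc | rfl | hc
      · have h3 := hadd (c • x₀) (-c • x₀)
        rw [← add_smul, add_neg_cancel, zero_smul, h0, hsmul _ (neg_pos.2 hc)] at h3
        simpa using by linarith
      · simp [h0]
      · exact (hsmul c hc x₀).ge)
  refine ⟨l, ?_, h2⟩
  exact (h1 ⟨x₀, Submodule.mem_span_singleton_self x₀⟩).trans
    (LinearPMap.mkSpanSingleton'_apply_self x₀ _ hH _)

lemma IsCWK.exists_suppFn_eq {K : Set X} (hK : IsCWK X K) {q : (X →L[ℝ] ℝ) → ℝ}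
    (hsmul : ∀ c : ℝ, 0 < c → ∀ f, q (c • f) = c * q f) (hadd : ∀ f g, q (f + g) ≤ q f + q g)
    (hq : ∀ f, q f ≤ suppFn f K) : ∃ W, IsCWK X W ∧ ∀ f, suppFn f W = q f := by
  have hex : ∀ f, ∃ x ∈ K, (∀ g, g x ≤ q g) ∧ f x = q f := fun f => by
    obtain ⟨l, h1, h2⟩ := exists_linearMap_eq_le_sublinear hsmul hadd f
    obtain ⟨x, hx, h3⟩ := hK.exists_eq_of_le_suppFn l fun g => (h2 g).trans (hq g)
    exact ⟨x, hx, fun g => h3 g ▸ h2 g, h3 f ▸ h1⟩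
  set W := {x ∈ K | ∀ g : X →L[ℝ] ℝ, g x ≤ q g}
  have hW : IsCWK X W := by
    refine hK.of_subset ?_ (fun x hx y hy a b ha hb hab => ⟨hK.convex hx.1 hy.1 ha hb hab,
      fun g => ?_⟩) ?_ (sep_subset _ _)
    · obtain ⟨x, hx, h, -⟩ := hex 0
      exact ⟨x, hx, h⟩
    · have h1 := mul_le_mul_of_nonneg_left (hx.2 g) ha
      have h2 := mul_le_mul_of_nonneg_left (hy.2 g) hb
      simp only [map_add, map_smul, smul_eq_mul]
      have h3 : a * q g + b * q g = q g := by rw [← add_mul, hab, one_mul]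
      linarith
    · have : W = K ∩ ⋂ g : X →L[ℝ] ℝ, {x | g x ≤ q g} := by
        ext x
        simp [W]
      rw [this]
      exact hK.isClosed.inter (isClosed_iInter fun g => isClosed_le g.continuous continuous_const)
  refine ⟨W, hW, fun f => le_antisymm (hW.suppFn_le_iff.2 fun x hx => hx.2 f) ?_⟩
  obtain ⟨x, hx, h1, h2⟩ := hex f
  exact h2 ▸ hW.le_suppFn f ⟨hx, h1⟩

/-! ### Pettis integrability from a Pettis integrable selection -/

lemma UnifSum.integrableOn_of_le {Θ : Type*} {g : Θ → ℝ → ℝ} {A : Θ → ℝ}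
    (h : UnifSum PerronPiece g A) {θ : Θ} {k : ℝ → ℝ} (hk : IntegrableOn k (Icc (0:ℝ) 1))
    (hkg : ∀ t ∈ Icc (0:ℝ) 1, k t ≤ g θ t) : IntegrableOn (g θ) (Icc (0:ℝ) 1) := by
  obtain ⟨δ₁, hδ₁, H₁⟩ := h 1 one_pos
  obtain ⟨δ₂, hδ₂, H₂⟩ := exists_gauge_abs_sub_integral_le hk one_pos
  have key := integrableOn_of_psum_le (h := fun t => g θ t - k t) le_rfl zero_le_one le_rfl
    (B := A θ + 1 - ((∫ x in (0:ℝ)..1, k x) - 1))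
    (fun t ht => sub_nonneg.2 (hkg t ht)) ((h.aemeasurable θ).sub hk.1.aemeasurable)
    fun δ hδ => by
      obtain ⟨s, hs⟩ := exists_psum_perron
        (fun u v t => (((v - u) * g θ t, (v - u) * k t) : ℝ × ℝ)) (hδ.min (hδ₁.min hδ₂))
        le_rfl zero_le_one le_rfl
      have h1 := H₁ θ _ (hs.map (AddMonoidHom.fst ℝ ℝ) fun u v t _ hp => ⟨t,
        hp.1.mono ((min_le_right _ _).trans (min_le_left _ _)), rfl⟩)
      have h2 := H₂ 0 1 _ le_rfl le_rfl (PSum.gaugeErr_of_sum hk (hs.map (AddMonoidHom.snd ℝ ℝ)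
        fun u v t _ hp => ⟨t, hp.1.2.mono ((min_le_right _ _).trans (min_le_right _ _)), rfl⟩))
      refine ⟨_, hs.map (AddMonoidHom.fst ℝ ℝ - AddMonoidHom.snd ℝ ℝ) fun u v t _ hp =>
        ⟨t, hp.1.2.mono (min_le_left _ _), ?_⟩, ?_⟩
      · simp [mul_sub]
      · simp only [AddMonoidHom.sub_apply, AddMonoidHom.coe_fst, AddMonoidHom.coe_snd] at h1 h2 ⊢
        rw [abs_le] at h1 h2
        linarith [h1.2, h2.1]
  exact (key.1.add hk).congr (.of_forall fun t => sub_add_cancel (g θ t) (k t))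

theorem HenstockIntegrable.pettisIntegrable {Γ : ℝ → Set X}
    (hΓ : ∀ t ∈ Icc (0:ℝ) 1, IsCWK X (Γ t)) (h : HenstockIntegrable Γ) {f : ℝ → X}
    (hf : Selection Γ f) (hfP : FPettisIntegrable f) : PettisIntegrable Γ := by
  obtain ⟨I, hI, H⟩ := h
  obtain ⟨hfint, hfν⟩ := hfP
  have hsum : ∀ x' : X →L[ℝ] ℝ, UnifSum PerronPiece (fun (_ : Unit) t => suppFn x' (Γ t))
      fun _ => suppFn x' I := fun x' =>
    unifSum_suppFn_of_henstock hΓ hI H (C := ‖x'‖ + 1) (by positivity) fun _ => by linarith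
  have hint : ∀ x' : X →L[ℝ] ℝ, IntegrableOn (fun t => suppFn x' (Γ t)) (Icc (0:ℝ) 1) := fun x' =>
    (hsum x').integrableOn_of_le (θ := ()) (hfint x') fun t ht => (hΓ t ht).le_suppFn x' (hf t ht)
  have hI' : ∀ x' : X →L[ℝ] ℝ, ∫ t in Icc (0:ℝ) 1, suppFn x' (Γ t) = suppFn x' I := fun x' => by
    rw [← (hsum x').integral_eq (θ := ()) (hint x'), intervalIntegral.integral_of_le zero_le_one,
      integral_Icc_eq_integral_Ioc]
  obtain ⟨ν, hν⟩ := hfν _ Subset.rfl measurableSet_Icc.nullMeasurableSet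
  have hK : IsCWK X (I + {-ν}) := hI.add (.singleton _)
  refine ⟨hint, fun E hE hEm => ?_⟩
  have hmem : ∀ᵐ t ∂volume.restrict E, t ∈ Icc (0:ℝ) 1 :=
    ae_restrict_of_ae_restrict_of_subset hE (ae_restrict_mem measurableSet_Icc)
  have hd : ∀ x' : X →L[ℝ] ℝ,
      IntegrableOn (fun t => suppFn x' (Γ t) - x' (f t)) (Icc (0:ℝ) 1) :=
    fun x' => (hint x').sub (hfint x')
  suffices h : ∃ W, IsCWK X W ∧ ∀ x', suppFn x' W = ∫ t in E, (suppFn x' (Γ t) - x' (f t)) by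
    obtain ⟨W, hW, hWq⟩ := h
    obtain ⟨νE, hνE⟩ := hfν E hE hEm
    refine ⟨W + {νE}, hW.add (.singleton _), fun x' => ?_⟩
    rw [hW.suppFn_add (.singleton _), suppFn_singleton, hWq, hνE,
      integral_sub ((hint x').mono_set hE) ((hfint x').mono_set hE), sub_add_cancel]
  refine hK.exists_suppFn_eq (fun c hc x' => ?_) (fun x' y' => ?_) fun x' => ?_
  · rw [← integral_const_mul]
    refine integral_congr_ae (hmem.mono fun t ht => ?_)
    simp only [(hΓ t ht).suppFn_functional_smul hc.le, smul_apply, smul_eq_mul, mul_sub]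
  · rw [← integral_add ((hd x').mono_set hE) ((hd y').mono_set hE)]
    refine integral_mono_ae ((hd _).mono_set hE)
      (((hd x').mono_set hE).add ((hd y').mono_set hE)) (hmem.mono fun t ht => ?_)
    have := (hΓ t ht).suppFn_functional_add x' y'
    simp only [add_apply]
    linarith
  · calc ∫ t in E, (suppFn x' (Γ t) - x' (f t))
        ≤ ∫ t in Icc (0:ℝ) 1, (suppFn x' (Γ t) - x' (f t)) :=
          setIntegral_mono_set (hd x') ((ae_restrict_mem measurableSet_Icc).mono fun t ht =>
            sub_nonneg.2 ((hΓ t ht).le_suppFn x' (hf t ht))) hE.eventuallyLE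
      _ = suppFn x' (I + {-ν}) := by
          rw [integral_sub (hint x') (hfint x'), hI', ← hν, hI.suppFn_add (.singleton _),
            suppFn_singleton, map_neg, sub_eq_add_neg]

/-- Theorem `t3` of the paper. For a scalarly measurable multifunction
`Γ : [0,1] → cwk(X)` the following are equivalent: (i) `Γ` is McShane integrable;
(ii) `Γ` is Henstock integrable and every Henstock integrable selection is McShane integrable;
(iii) `Γ` is Henstock integrable and every Henstock integrable selection is Pettis integrable;
(iv) `Γ` is Henstock integrable and has a Pettis integrable selection;
(v) `Γ` is Henstock and Pettis integrable. -/
theorem mcshane_tfae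
    {X : Type*} [NormedAddCommGroup X] [NormedSpace ℝ X] [CompleteSpace X]
    (Γ : ℝ → Set X) (hΓ : ∀ t ∈ Icc (0:ℝ) 1, IsCWK X (Γ t))
    (hsc : ∀ x' : X →L[ℝ] ℝ,
      AEMeasurable (fun t => suppFn x' (Γ t)) (volume.restrict (Icc (0:ℝ) 1))) :
    List.TFAE [
      McShaneIntegrable Γ,
      HenstockIntegrable Γ ∧
        ∀ f : ℝ → X, Selection Γ f → FHenstockIntegrable f → FMcShaneIntegrable f,
      HenstockIntegrable Γ ∧
        ∀ f : ℝ → X, Selection Γ f → FHenstockIntegrable f → FPettisIntegrable f,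
      HenstockIntegrable Γ ∧ ∃ f : ℝ → X, Selection Γ f ∧ FPettisIntegrable f,
      HenstockIntegrable Γ ∧ PettisIntegrable Γ
    ] := by
  tfae_have 1 → 2 := fun h => ⟨h.henstockIntegrable, fun _ hf hfH => h.fMcShaneIntegrable hΓ hf hfH⟩
  tfae_have 2 → 3 := fun h => ⟨h.1, fun f hf hfH => (h.2 f hf hfH).fPettisIntegrable⟩
  tfae_have 3 → 4 := fun h => by
    obtain ⟨f, hf, hfH⟩ := h.1.exists_selection hΓ
    exact ⟨h.1, f, hf, h.2 f hf hfH⟩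
  tfae_have 4 → 5 := fun ⟨h, _, hf, hfP⟩ => ⟨h, h.pettisIntegrable hΓ hf hfP⟩
  tfae_have 5 → 1 := fun h => h.1.mcShaneIntegrable hΓ h.2
  tfae_finish

end GaugePaper
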